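/- Let φ: X → Y be a proper surjective morphism between normal varieties such that R^1 φ_* O_X = 0 and dim φ^{−1}(y) ≤ 1 for every closed point y ∈ Y. Let C be a projective curve on X such that φ(C) is a point. Then H^1(C, O_C) = 0; in particular C ≅ P^1. -/

import Mathlib

open AlgebraicGeometry CategoryTheory TopologicalSpace Opposite

attribute [local instance] MvPolynomial.gradedAlgebra

/-- The projective line `ℙ¹` over `ℂ`, as `Proj ℂ[x₀, x₁]`. -/
noncomputable def ProjLine : Scheme :=
  AlgebraicGeometry.Proj (MvPolynomial.homogeneousSubmodule (Fin 2) ℂ)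

/-- Restriction of a section of the structure sheaf to a smaller open set. -/
noncomputable def resSec (X : Scheme) (V U : X.Opens) (h : V ≤ U) (s : Γ(X, U)) :
    Γ(X, V) :=
  X.presheaf.map (homOfLE h).op s

/-- A Čech 1-cochain `(s i j)` on the cover `U` is a cocycle if
`s i j + s j k = s i k` on the triple overlaps. -/
def IsCechCocycle (X : Scheme) {ι : Type} (U : ι → X.Opens)
    (s : ∀ i j, Γ(X, U i ⊓ U j)) : Prop :=
  ∀ i j k,
    resSec X (U i ⊓ U j ⊓ U k) (U i ⊓ U j) inf_le_left (s i j) +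
      resSec X (U i ⊓ U j ⊓ U k) (U j ⊓ U k)
        (le_inf (inf_le_left.trans inf_le_right) inf_le_right) (s j k) =
    resSec X (U i ⊓ U j ⊓ U k) (U i ⊓ U k)
        (le_inf (inf_le_left.trans inf_le_left) inf_le_right) (s i k)

/-- A Čech 1-cochain `(s i j)` on the cover `U` is a coboundary if
`s i j = t i - t j` on overlaps, for some 0-cochain `(t i)`. -/
def IsCechCoboundary (X : Scheme) {ι : Type} (U : ι → X.Opens)
    (s : ∀ i j, Γ(X, U i ⊓ U j)) : Prop :=
  ∃ t : ∀ i, Γ(X, U i), ∀ i j,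
    s i j = resSec X (U i ⊓ U j) (U i) inf_le_left (t i) -
      resSec X (U i ⊓ U j) (U j) inf_le_right (t j)

/-- `H¹(X, O_X) = 0`, via Čech cohomology (which computes `H¹` on any space):
every Čech 1-cocycle of the structure sheaf with respect to any open cover
is a coboundary. -/
def FirstStructureCohomologyVanishes (X : Scheme) : Prop :=
  ∀ {ι : Type} (U : ι → X.Opens), iSup U = ⊤ →
    ∀ s : ∀ i j, Γ(X, U i ⊓ U j), IsCechCocycle X U s → IsCechCoboundary X U s

/-- `R¹φ_* O_X = 0`: the sheafification of `V ↦ H¹(φ⁻¹V, O_X)` vanishes, i.e.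
every Čech 1-cocycle of `O_X` on a cover of `φ⁻¹V` becomes a coboundary after
shrinking `V` around any given point. -/
def FirstDirectImageVanishes {X Y : Scheme} (φ : X ⟶ Y) : Prop :=
  ∀ (V : Y.Opens) {ι : Type} (U : ι → X.Opens),
    (∀ i, U i ≤ φ ⁻¹ᵁ V) → φ ⁻¹ᵁ V ≤ iSup U →
    ∀ s : ∀ i j, Γ(X, U i ⊓ U j), IsCechCocycle X U s →
    ∀ y ∈ V, ∃ V' : Y.Opens, V' ≤ V ∧ y ∈ V' ∧
      IsCechCoboundary X (fun i => U i ⊓ φ ⁻¹ᵁ V')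
        (fun i j => resSec X ((U i ⊓ φ ⁻¹ᵁ V') ⊓ (U j ⊓ φ ⁻¹ᵁ V')) (U i ⊓ U j)
          (le_inf (inf_le_left.trans inf_le_left) (inf_le_right.trans inf_le_left))
          (s i j))

/-- A scheme is normal if all of its stalks are integrally closed (domains). -/
def IsNormalScheme (X : Scheme) : Prop :=
  ∀ x : X, IsIntegrallyClosed (X.presheaf.stalk x)

universe u

namespace AlgebraicGeometry.Scheme

/-- The rational functions on an integral scheme which are regular at the point `x`. -/
noncomputable def regularAt (C : Scheme) [IsIntegral C] (x : C) : Subring C.functionField :=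
  (algebraMap (C.presheaf.stalk x) C.functionField).range

variable {C : Scheme} [IsIntegral C]

lemma genericPoint_mem {U : C.Opens} {x : C} (hx : x ∈ U) : genericPoint C ∈ U :=
  (genericPoint_specializes x).mem_open U.isOpen hx

lemma algebraMap_germ_eq_germ_genericPoint {U : C.Opens} {x : C} (hx : x ∈ U) (s : Γ(C, U)) :
    algebraMap (C.presheaf.stalk x) C.functionField (C.presheaf.germ U x hx s) =
      C.presheaf.germ U (genericPoint C) (genericPoint_mem hx) s := by
  have : Nonempty U := ⟨⟨x, hx⟩⟩
  exact algebraMap_germ_eq_germToFunctionField C hx s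

lemma germ_genericPoint_mem_regularAt {U : C.Opens} {x : C} (hx : x ∈ U) (s : Γ(C, U)) :
    C.presheaf.germ U (genericPoint C) (genericPoint_mem hx) s ∈ C.regularAt x :=
  ⟨_, algebraMap_germ_eq_germ_genericPoint hx s⟩

lemma exists_germ_genericPoint_eq_of_mem_regularAt {x : C} {f : C.functionField}
    (hf : f ∈ C.regularAt x) :
    ∃ (U : C.Opens) (hx : x ∈ U) (s : Γ(C, U)),
      C.presheaf.germ U (genericPoint C) (genericPoint_mem hx) s = f := by
  obtain ⟨a, rfl⟩ := hf
  obtain ⟨U, hx, s, rfl⟩ := C.presheaf.exists_germ_eq a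
  exact ⟨U, hx, s, (algebraMap_germ_eq_germ_genericPoint hx s).symm⟩

lemma mem_regularAt_genericPoint (f : C.functionField) : f ∈ C.regularAt (genericPoint C) := by
  obtain ⟨U, hx, s, rfl⟩ := C.presheaf.exists_germ_eq f
  exact germ_genericPoint_mem_regularAt hx s

lemma exists_germ_genericPoint_eq {U : C.Opens} (hU : genericPoint C ∈ U) {f : C.functionField}
    (hf : ∀ x ∈ U, f ∈ C.regularAt x) :
    ∃ s : Γ(C, U), C.presheaf.germ U (genericPoint C) hU s = f := by
  choose V hxV s hs using fun x : U ↦ exists_germ_genericPoint_eq_of_mem_regularAt (hf x x.2)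
  let W : U → C.Opens := fun x ↦ V x ⊓ U
  have hW : ∀ x, W x ≤ U := fun x ↦ inf_le_right
  let s' : ∀ x : U, Γ(C, W x) := fun x ↦ C.presheaf.map (homOfLE inf_le_left).op (s x)
  have hs' : ∀ x, C.presheaf.germ (W x) (genericPoint C) ⟨genericPoint_mem (hxV x), hU⟩ (s' x) = f :=
    fun x ↦ by
      rw [← hs x]; exact C.presheaf.germ_res_apply (homOfLE inf_le_left) _ _ _
  obtain ⟨t, ht, -⟩ := C.sheaf.existsUnique_gluing' W U (fun x ↦ homOfLE (hW x))
    (fun x hx ↦ Opens.mem_iSup.mpr ⟨⟨x, hx⟩, hxV ⟨x, hx⟩, hx⟩) s' (fun x y ↦ by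
      have hη : genericPoint C ∈ W x ⊓ W y :=
        ⟨⟨genericPoint_mem (hxV x), hU⟩, ⟨genericPoint_mem (hxV y), hU⟩⟩
      apply germ_injective_of_isIntegral C (genericPoint C) hη
      refine (C.presheaf.germ_res_apply (Opens.infLELeft _ _) _ hη _).trans
        (Eq.trans ?_ (C.presheaf.germ_res_apply (Opens.infLERight _ _) _ hη _).symm)
      rw [hs' x, hs' y])
  refine ⟨t, ?_⟩
  let x : U := ⟨genericPoint C, hU⟩
  rw [← hs' x, ← ht x]
  exact (C.presheaf.germ_res_apply (homOfLE (hW x)) _ _ t).symm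

lemma germ_genericPoint_resSec {V U : C.Opens} (h : V ≤ U) (hV : genericPoint C ∈ V) (s : Γ(C, U)) :
    C.presheaf.germ V (genericPoint C) hV (resSec C V U h s) =
      C.presheaf.germ U (genericPoint C) (h hV) s :=
  C.presheaf.germ_res_apply (homOfLE h) _ _ _

/-- The rational function `f` is regular at `x` with non-vanishing, i.e. invertible, value. -/
lemma isUnit_germ_iff_inv_mem_regularAt {U : C.Opens} {x : C} (hx : x ∈ U) (s : Γ(C, U))
    (hs : s ≠ 0) : x ∈ C.basicOpen s ↔
      (C.presheaf.germ U (genericPoint C) (genericPoint_mem hx) s)⁻¹ ∈ C.regularAt x := by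
  rw [C.mem_basicOpen s x hx, ← algebraMap_germ_eq_germ_genericPoint hx s]
  set a := C.presheaf.germ U x hx s
  have ha : a ≠ 0 := fun h ↦ hs (germ_injective_of_isIntegral C x hx (by simpa using h))
  have hinj := IsFractionRing.injective (C.presheaf.stalk x) C.functionField
  have ha' : algebraMap (C.presheaf.stalk x) C.functionField a ≠ 0 := by
    rwa [Ne, map_eq_zero_iff _ hinj]
  constructor
  · rintro ⟨u, hu⟩
    refine ⟨(u⁻¹ : (C.presheaf.stalk x)ˣ), ?_⟩
    rw [eq_comm, ← hu]
    refine (eq_inv_of_mul_eq_one_left ?_).symm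
    rw [← map_mul, Units.inv_mul, map_one]
  · rintro ⟨b, hb⟩
    refine IsUnit.of_mul_eq_one b (hinj ?_)
    rw [map_mul, hb, mul_inv_cancel₀ ha', map_one]

end AlgebraicGeometry.Scheme

/-- A strictly increasing chain of two primes in a fibre of dimension at most one: the larger one
contains an element, outside the smaller one, which cuts out a finite subscheme of the fibre. -/
lemma exists_mem_notMem_finite_quotient {R A : Type*} [CommRing R] [CommRing A] [Algebra R A]
    [Algebra.FiniteType R A] (P : Ideal R) [P.IsMaximal] (q c : Ideal A) [q.IsPrime] [c.IsPrime]
    (hc : P.map (algebraMap R A) ≤ c) (hcq : c < q)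
    (hdim : ∀ p₀ p₁ p₂ : Ideal A, p₀.IsPrime → p₁.IsPrime → p₂.IsPrime →
      P.map (algebraMap R A) ≤ p₀ → p₀ < p₁ → ¬ p₁ < p₂) :
    ∃ g ∈ q, g ∉ c ∧ Module.Finite R (A ⧸ (P.map (algebraMap R A) ⊔ Ideal.span {g})) := by
  have key (J : Ideal A) (hJ : P.map (algebraMap R A) ≤ J) :
      ∃ _ : Algebra (R ⧸ P) (A ⧸ J), IsScalarTower R (R ⧸ P) (A ⧸ J) := by
    let f : R ⧸ P →+* A ⧸ J := Ideal.Quotient.lift P (algebraMap R (A ⧸ J)) fun a ha ↦ by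
      rw [IsScalarTower.algebraMap_apply R A]
      exact Ideal.Quotient.eq_zero_iff_mem.mpr (hJ (Ideal.mem_map_of_mem _ ha))
    let : Algebra (R ⧸ P) (A ⧸ J) := f.toAlgebra
    exact ⟨this, .of_algebraMap_eq fun x ↦ rfl⟩
  let : Field (R ⧸ P) := Ideal.Quotient.field P
  have hfin : (P.map (algebraMap R A)).minimalPrimes.Finite := by
    obtain ⟨_, _⟩ := key _ le_rfl
    have : Algebra.FiniteType (R ⧸ P) (A ⧸ P.map (algebraMap R A)) :=
      .of_restrictScalars_finiteType R _ _
    have := Algebra.FiniteType.isNoetherianRing (R ⧸ P) (A ⧸ P.map (algebraMap R A))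
    rw [Ideal.minimalPrimes_eq_comap]
    exact (minimalPrimes.finite_of_isNoetherianRing _).image _
  have hq : ∀ p ∈ (P.map (algebraMap R A)).minimalPrimes, ¬ q ≤ p := by
    intro p hp hqp
    exact (hcq.trans_le hqp).not_ge (hp.2 ⟨inferInstance, hc⟩ (hcq.le.trans hqp))
  have hcmin : c ∈ (P.map (algebraMap R A)).minimalPrimes := by
    refine ⟨⟨inferInstance, hc⟩, fun p hp hpc ↦ ?_⟩
    by_contra h
    exact hdim p c q hp.1 inferInstance inferInstance hp.2 (lt_of_le_not_ge hpc h) hcq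
  obtain ⟨g, hgq, hg⟩ : ∃ g ∈ q, ∀ p ∈ (P.map (algebraMap R A)).minimalPrimes, g ∉ p := by
    by_contra! h
    obtain ⟨p, hp, hqp⟩ := (Ideal.subset_union_prime (s := hfin.toFinset) (f := id) c c
      (fun i hi _ _ ↦ (hfin.mem_toFinset.mp hi).1.1) (I := q)).mp (fun x hx ↦ by
        obtain ⟨p, hp, hxp⟩ := h x hx
        exact Set.mem_biUnion (hfin.mem_toFinset.mpr hp) hxp)
    exact hq p (hfin.mem_toFinset.mp hp) hqp
  refine ⟨g, hgq, hg c hcmin, ?_⟩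
  set J := P.map (algebraMap R A) ⊔ Ideal.span {g} with hJ
  obtain ⟨_, _⟩ := key J le_sup_left
  have : Algebra.FiniteType (R ⧸ P) (A ⧸ J) := .of_restrictScalars_finiteType R _ _
  have : IsNoetherianRing (A ⧸ J) := Algebra.FiniteType.isNoetherianRing (R ⧸ P) (A ⧸ J)
  have hK : Ring.KrullDimLE 0 (A ⧸ J) := by
    rw [Ring.krullDimLE_zero_iff]
    intro I hI
    have hI' : (I.comap (Ideal.Quotient.mk J)).IsPrime := hI.comap _
    have hJI : J ≤ I.comap (Ideal.Quotient.mk J) := fun x hx ↦ by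
      rw [Ideal.mem_comap, Ideal.Quotient.eq_zero_iff_mem.mpr hx]; exact I.zero_mem
    obtain ⟨p₀, hp₀, hp₀I⟩ := Ideal.exists_minimalPrimes_le (le_sup_left.trans hJI)
    have hlt : p₀ < I.comap (Ideal.Quotient.mk J) := lt_of_le_of_ne hp₀I fun h ↦
      hg p₀ hp₀ (h ▸ hJI (Ideal.mem_sup_right (Ideal.mem_span_singleton_self g)))
    have hmax : (I.comap (Ideal.Quotient.mk J)).IsMaximal := by
      obtain ⟨m, hm, hIm⟩ := Ideal.exists_le_maximal _ hI'.ne_top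
      obtain h | h := hIm.eq_or_lt
      · rwa [h]
      · exact (hdim _ _ _ hp₀.1.1 hI' hm.isPrime hp₀.1.2 hlt h).elim
    have := Ideal.map_eq_top_or_isMaximal_of_surjective (Ideal.Quotient.mk J)
      Ideal.Quotient.mk_surjective hmax
    rw [Ideal.map_comap_of_surjective _ Ideal.Quotient.mk_surjective] at this
    exact this.resolve_left hI.ne_top
  have : Module.Finite (R ⧸ P) (A ⧸ J) := by
    rw [Module.finite_iff_isArtinianRing, isArtinianRing_iff_isNoetherianRing_krullDimLE_zero]
    exact ⟨inferInstance, hK⟩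
  exact Module.Finite.trans (R ⧸ P) _

/-- The quasi-finite locus at a prime of a quotient `A ⧸ (g)` with finite fibre. -/
lemma quasiFiniteAt_of_finite_quotient {R S : Type*} [CommRing R] [CommRing S]
    [Algebra R S] [Algebra.FiniteType R S] (P : Ideal R) (q : Ideal S) [q.IsPrime] [q.LiesOver P]
    [Module.Finite R (S ⧸ P.map (algebraMap R S))] : Algebra.QuasiFiniteAt R q := by
  have hP : q.under R = P := (Ideal.over_def q P).symm
  have : Module.Finite R (S ⧸ (q.under R).map (algebraMap R S)) := by rwa [hP]
  have : Algebra.WeaklyQuasiFiniteAt R q := by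
    have : Algebra.QuasiFinite R (S ⧸ (q.under R).map (algebraMap R S)) := inferInstance
    unfold Algebra.WeaklyQuasiFiniteAt
    infer_instance
  exact .of_weaklyQuasiFiniteAt q

open TensorProduct in
/-- After an étale base change with trivial residue field extension, an isolated point of a fibre
of `V(g)` is the only point over the chosen prime on a finite open and closed part of `V(g)`. -/
lemma exists_flat_finite_separating {R A : Type u} [CommRing R] [CommRing A] [Algebra R A]
    [Algebra.FiniteType R A] (P : Ideal R) [P.IsMaximal] (q : Ideal A) [q.IsPrime] [q.LiesOver P]
    (g : A) (hg : g ∈ q)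
    [Module.Finite R (A ⧸ (P.map (algebraMap R A) ⊔ Ideal.span {g}))] :
    ∃ (R' : Type u) (_ : CommRing R') (_ : Algebra R R') (P' : Ideal R') (_ : P'.IsPrime),
      Module.Flat R R' ∧
      (∀ (L : Type u) [CommRing L] (χ : R →+* L), P ≤ RingHom.ker χ →
        ∃ χ' : R' →+* L, χ'.comp (algebraMap R R') = χ ∧ (∀ r ∈ P', χ' r = 0) ∧
          ∀ r ∉ P', IsUnit (χ' r)) ∧
      ∃ (e : R' ⊗[R] A) (T : Type u) (_ : CommRing T) (_ : Algebra R' T)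
        (ψ : R' ⊗[R] A →ₐ[R'] T), Module.Finite R' T ∧ Function.Surjective ψ ∧
        (∀ p : Ideal (R' ⊗[R] A), p.IsPrime → (RingHom.ker ψ ≤ p ↔ 1 ⊗ₜ g ∈ p ∧ e ∉ p)) ∧
        (∀ p : Ideal (R' ⊗[R] A), p.IsPrime → p.comap (algebraMap R' _) = P' →
          p.comap (Algebra.TensorProduct.includeRight : A →ₐ[R] R' ⊗[R] A) = q → e ∉ p) ∧
        (∀ p : Ideal (R' ⊗[R] A), p.IsPrime → p.comap (algebraMap R' _) = P' →
          1 ⊗ₜ g ∈ p → e ∉ p →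
            p.comap (Algebra.TensorProduct.includeRight : A →ₐ[R] R' ⊗[R] A) = q) := by
  let J : Ideal A := Ideal.span {g}
  have hJq : J ≤ q := (Ideal.span_singleton_le_iff_mem _).mpr hg
  let π : A →ₐ[R] A ⧸ J := Ideal.Quotient.mkₐ R J
  have hπ : Function.Surjective π := Ideal.Quotient.mk_surjective
  have hπk : RingHom.ker π = J := Ideal.Quotient.mkₐ_ker R J
  have hcm (p : Ideal A) (hp : J ≤ p) : (p.map π).comap π = p := by
    rw [Ideal.comap_map_of_surjective _ hπ, sup_eq_left]
    exact (show Ideal.comap π ⊥ = J from hπk).trans_le hp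
  let qb : Ideal (A ⧸ J) := q.map π
  have hqb : qb.IsPrime := Ideal.map_isPrime_of_surjective hπ (hπk.trans_le hJq)
  have : qb.LiesOver P := ⟨by
    rw [Ideal.over_def q P, Ideal.under_def]
    conv_lhs => rw [← hcm q hJq]
    rfl⟩
  have : Algebra.QuasiFiniteAt R qb := by
    have : Module.Finite R ((A ⧸ J) ⧸ P.map (algebraMap R (A ⧸ J))) := by
      let f : A ⧸ (P.map (algebraMap R A) ⊔ Ideal.span {g}) →ₐ[R]
          ((A ⧸ J) ⧸ P.map (algebraMap R (A ⧸ J))) :=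
        Ideal.Quotient.liftₐ _ ((Ideal.Quotient.mkₐ R _).comp π) (fun a ha ↦ by
          suffices P.map (algebraMap R A) ⊔ Ideal.span {g} ≤
            RingHom.ker ((Ideal.Quotient.mkₐ R (P.map (algebraMap R (A ⧸ J)))).comp π) from this ha
          refine sup_le (Ideal.map_le_iff_le_comap.mpr fun x hx ↦ ?_)
            ((Ideal.span_singleton_le_iff_mem _).mpr ?_)
          · rw [Ideal.mem_comap, RingHom.mem_ker, AlgHom.commutes,
              IsScalarTower.algebraMap_apply R (A ⧸ J)]
            exact Ideal.Quotient.eq_zero_iff_mem.mpr (Ideal.mem_map_of_mem _ hx)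
          · rw [RingHom.mem_ker, AlgHom.comp_apply,
              show π g = 0 from Ideal.Quotient.eq_zero_iff_mem.mpr
                (Ideal.mem_span_singleton_self g), map_zero])
      refine Module.Finite.of_surjective f.toLinearMap ?_
      intro x
      obtain ⟨y, rfl⟩ := Ideal.Quotient.mk_surjective x
      obtain ⟨z, rfl⟩ := hπ y
      exact ⟨Ideal.Quotient.mk _ z, rfl⟩
    exact quasiFiniteAt_of_finite_quotient P qb
  obtain ⟨R', _, _, _, P', _, _, e, he, Q, _, _, hQ, heQ, hbij, hfin, huniq⟩ :=
    Algebra.exists_etale_isIdempotentElem_forall_liesOver_eq P qb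
  let ρ : R' ⊗[R] A →ₐ[R'] R' ⊗[R] (A ⧸ J) := Algebra.TensorProduct.map (AlgHom.id R' R') π
  have hρ : Function.Surjective ρ :=
    Algebra.TensorProduct.map_surjective _ _ Function.surjective_id hπ
  have hρk : RingHom.ker ρ = Ideal.span {1 ⊗ₜ g} := by
    refine (Algebra.TensorProduct.lTensor_ker (A := R') π hπ).trans ?_
    rw [hπk, Ideal.map_span, Set.image_singleton]
    rfl
  obtain ⟨e', he'⟩ := hρ e
  have hcmρ (p : Ideal (R' ⊗[R] A)) (hp : 1 ⊗ₜ g ∈ p) : (p.map ρ).comap ρ = p := by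
    rw [Ideal.comap_map_of_surjective _ hρ, sup_eq_left]
    exact (show Ideal.comap ρ ⊥ = _ from hρk).trans_le ((Ideal.span_singleton_le_iff_mem _).mpr hp)
  have hprime (p : Ideal (R' ⊗[R] A)) [p.IsPrime] (hp : 1 ⊗ₜ g ∈ p) : (p.map ρ).IsPrime :=
    Ideal.map_isPrime_of_surjective hρ (hρk.trans_le ((Ideal.span_singleton_le_iff_mem _).mpr hp))
  have hmem (p : Ideal (R' ⊗[R] A)) (hp : 1 ⊗ₜ g ∈ p) : e ∈ p.map ρ ↔ e' ∈ p := by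
    conv_rhs => rw [← hcmρ p hp]
    rw [Ideal.mem_comap, he']
  have hover (p : Ideal (R' ⊗[R] A)) (hp : 1 ⊗ₜ g ∈ p) (hP : p.comap (algebraMap R' _) = P') :
      (p.map ρ).LiesOver P' := ⟨by
    rw [← hP, Ideal.under_def]
    conv_lhs => rw [← hcmρ p hp]
    ext x
    simp only [Ideal.mem_comap]
    rw [AlgHom.commutes]⟩
  have hright (p : Ideal (R' ⊗[R] A)) (hp : 1 ⊗ₜ g ∈ p) :
      ((p.map ρ).comap (Algebra.TensorProduct.includeRight (R := R) (A := R')).toRingHom).comap π =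
        p.comap (Algebra.TensorProduct.includeRight : A →ₐ[R] R' ⊗[R] A) := by
    conv_rhs => rw [← hcmρ p hp]
    rfl
  let T := Localization.Away e
  let ψ : R' ⊗[R] A →ₐ[R'] T := (IsScalarTower.toAlgHom R' (R' ⊗[R] (A ⧸ J)) T).comp ρ
  refine ⟨R', _, _, P', inferInstance, inferInstance, ?_, e', T, inferInstance, inferInstance, ψ,
    hfin, (IsLocalization.Away.algebraMap_surjective_of_isIdempotentElem e he).comp hρ, ?_, ?_, ?_⟩
  · intro L _ χ hχ
    let : Field (R ⧸ P) := Ideal.Quotient.field P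
    let χ₁ : R ⧸ P →+* L := Ideal.Quotient.lift P χ hχ
    have hb : Function.Bijective (algebraMap (R ⧸ P) P.ResidueField) :=
      P.bijective_algebraMap_quotient_residueField
    let E₁ := RingEquiv.ofBijective _ hb
    let E₂ := RingEquiv.ofBijective _ hbij
    let θ : P'.ResidueField →+* L := χ₁.comp (E₁.symm.toRingHom.comp E₂.symm.toRingHom)
    refine ⟨θ.comp (algebraMap R' P'.ResidueField), ?_, ?_, ?_⟩
    · ext x
      have h₁ : algebraMap R' P'.ResidueField (algebraMap R R' x) =
          E₂ (E₁ (Ideal.Quotient.mk P x)) := by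
        have h₂ : E₁ (Ideal.Quotient.mk P x) = algebraMap R P.ResidueField x := rfl
        rw [h₂, ← IsScalarTower.algebraMap_apply]
        exact (AlgHom.commutes (Ideal.ResidueField.mapₐ P P' (Algebra.ofId R R') _) x).symm
      change χ₁ (E₁.symm (E₂.symm _)) = _
      rw [h₁, RingEquiv.symm_apply_apply, RingEquiv.symm_apply_apply]
      rfl
    · intro r hr
      simp [Ideal.algebraMap_residueField_eq_zero.mpr hr]
    · intro r hr
      exact (IsUnit.mk0 _ (mt Ideal.algebraMap_residueField_eq_zero.mp hr)).map θ
  · intro p hp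
    have hψe : ψ e' = 1 := by
      have h₁ : IsIdempotentElem (ψ e') := by
        simp only [ψ, AlgHom.comp_apply, he']
        exact he.map _
      have h₂ : IsUnit (ψ e') := by
        simp only [ψ, AlgHom.comp_apply, he']
        exact IsLocalization.Away.algebraMap_isUnit e
      exact h₂.mul_left_cancel (h₁.eq.trans (mul_one _).symm)
    constructor
    · intro h
      refine ⟨h ?_, fun he'p ↦ hp.ne_top ((Ideal.eq_top_iff_one _).mpr ?_)⟩
      · have : ρ (1 ⊗ₜ g) = 0 := by
          rw [← RingHom.mem_ker, hρk]; exact Ideal.mem_span_singleton_self _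
        rw [RingHom.mem_ker, AlgHom.comp_apply, this, map_zero]
      · have : 1 - e' ∈ p := h (by rw [RingHom.mem_ker, map_sub, hψe, map_one, sub_self])
        simpa using p.add_mem this he'p
    · rintro ⟨hgp, hep⟩ a ha
      obtain ⟨⟨_, n, rfl⟩, hn⟩ := (IsLocalization.map_eq_zero_iff (.powers e) T (ρ a)).mp ha
      have : e' ^ n * a ∈ RingHom.ker ρ := by
        rw [RingHom.mem_ker, map_mul, map_pow, he']; exact hn
      rw [hρk] at this
      exact (hp.mem_or_mem (((Ideal.span_singleton_le_iff_mem _).mpr hgp) this)).resolve_left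
        (mt (hp.mem_of_pow_mem n) hep)
  · intro p hp hpP hpq hep
    have hgp : 1 ⊗ₜ g ∈ p := by
      have : g ∈ p.comap (Algebra.TensorProduct.includeRight : A →ₐ[R] R' ⊗[R] A) := hpq ▸ hg
      exact this
    have := hprime p hgp
    have := hover p hgp hpP
    refine heQ ?_
    rw [← Ideal.eq_of_comap_eq_comap_of_bijective_residueFieldMap hbij (p.map ρ) Q ?_]
    · exact (hmem p hgp).mpr hep
    · refine Ideal.comap_injective_of_surjective π hπ ?_
      rw [hright p hgp, hpq, hQ, hcm q hJq]
  · intro p hp hpP hgp hep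
    have := hprime p hgp
    rw [← hright p hgp, huniq _ this (hover p hgp hpP) (mt (hmem p hgp).mp hep), hQ, hcm q hJq]

open TensorProduct in
/-- Kernels commute with flat base change. -/
lemma mem_span_image_ker_of_isBaseChange {R R' M N M' N' : Type*} [CommRing R] [CommRing R']
    [Algebra R R'] [Module.Flat R R'] [AddCommGroup M] [AddCommGroup N] [AddCommGroup M']
    [AddCommGroup N'] [Module R M] [Module R N] [Module R M'] [Module R N'] [Module R' M']
    [Module R' N'] [IsScalarTower R R' M'] [IsScalarTower R R' N'] {f : M →ₗ[R] M'}
    {h : N →ₗ[R] N'} (hf : IsBaseChange R' f) (hh : IsBaseChange R' h) (d : M →ₗ[R] N)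
    (d' : M' →ₗ[R'] N') (hd : ∀ x, d' (f x) = h (d x)) {x : M'} (hx : d' x = 0) :
    x ∈ Submodule.span R' (f '' LinearMap.ker d) := by
  obtain ⟨z, rfl⟩ := hf.equiv.surjective x
  have hcomm : ∀ z : R' ⊗[R] M, d' (hf.equiv z) = hh.equiv (LinearMap.lTensor R' d z) := by
    intro z
    induction z with
    | zero => simp
    | add a b ha hb => rw [map_add, map_add, ha, hb, map_add, map_add]
    | tmul a m => rw [IsBaseChange.equiv_tmul, map_smul, hd, LinearMap.lTensor_tmul,
        IsBaseChange.equiv_tmul]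
  have hz : LinearMap.lTensor R' d z = 0 := by
    apply hh.equiv.injective
    rw [← hcomm, hx, map_zero]
  obtain ⟨w, rfl⟩ :=
    (Module.Flat.lTensor_exact R' (LinearMap.exact_subtype_ker_map d) z).mp hz
  clear hz hx
  induction w with
  | zero => simp
  | add a b ha hb => rw [map_add, map_add]; exact Submodule.add_mem _ ha hb
  | tmul a m =>
    rw [LinearMap.lTensor_tmul, IsBaseChange.equiv_tmul]
    exact Submodule.smul_mem _ _ (Submodule.subset_span ⟨_, m.2, rfl⟩)

section

variable {X Y X' Y' : Scheme.{u}} {g : X' ⟶ X} {φ' : X' ⟶ Y'} {φ : X ⟶ Y} {f : Y' ⟶ Y}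
    (H : IsPullback g φ' φ f) {V : Y.Opens} (hV : IsAffineOpen V) [IsAffine Y']
    (hf : f ⁻¹ᵁ V = ⊤) {U : X.Opens} (hUV : U ≤ φ ⁻¹ᵁ V) (hU : IsAffineOpen U)

include H hV hf hU in
lemma isPushout_sections : IsPushout (φ.appLE V U hUV) (f.appLE V ⊤ hf.ge)
    (g.appLE U (g ⁻¹ᵁ U) le_rfl) (φ'.appLE ⊤ (g ⁻¹ᵁ U) le_top) :=
  (isIso_pushoutSection_iff H hf.ge hUV (UY := g ⁻¹ᵁ U) (by simp)).mp
    (isIso_pushoutSection_of_isAffineOpen H hf.ge hUV _ hV (isAffineOpen_top _) hU)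

include H hV hf hUV hU in
lemma isAffineOpen_preimage_of_isPullback : IsAffineOpen (g ⁻¹ᵁ U) := by
  have : IsAffine _ := hV
  have : IsAffine _ := isAffineOpen_top Y'
  have : IsAffine _ := hU
  exact .of_isIso (Scheme.Hom.isPullback_resLE H hf.ge
    (show U ≤ φ ⁻¹ᵁ V from hUV) (UY := g ⁻¹ᵁ U) (by simp)).isoPullback.hom

end

lemma isBaseChange_of_isPushout {R R' A A' : Type u} [CommRing R] [CommRing R'] [CommRing A]
    [CommRing A'] [Algebra R R'] [Algebra R A] [Algebra R A'] [Algebra R' A']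
    [IsScalarTower R R' A'] (F : A →ₐ[R] A')
    (sq : IsPushout (CommRingCat.ofHom (algebraMap R A)) (CommRingCat.ofHom (algebraMap R R'))
      (CommRingCat.ofHom F.toRingHom) (CommRingCat.ofHom (algebraMap R' A'))) :
    IsBaseChange R' F.toLinearMap := by
  let : Algebra A A' := F.toRingHom.toAlgebra
  have : IsScalarTower R A A' := .of_algebraMap_eq fun x ↦ (F.commutes x).symm
  have : Algebra.IsPushout R R' A A' := CommRingCat.isPushout_iff_isPushout.mp sq.flip
  exact this.out

/-- Induction principle for cocycles after a flat base change. -/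
lemma flat_cocycle_induction {R R' : CommRingCat.{u}} (b : R ⟶ R') (hb : b.hom.Flat)
    {κ l : Type} [Finite κ] [Finite l] {A A' : κ → CommRingCat.{u}} {B B' : l → CommRingCat.{u}}
    {α : ∀ k, R ⟶ A k} {α' : ∀ k, R' ⟶ A' k} {f : ∀ k, A k ⟶ A' k}
    (sqA : ∀ k, IsPushout (α k) b (f k) (α' k))
    {β : ∀ k, R ⟶ B k} {β' : ∀ k, R' ⟶ B' k} {h : ∀ k, B k ⟶ B' k}
    (sqB : ∀ k, IsPushout (β k) b (h k) (β' k))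
    (a : Fin 3 → l → κ) (u : ∀ n k, A (a n k) ⟶ B k) (u' : ∀ n k, A' (a n k) ⟶ B' k)
    (hu : ∀ n k, α _ ≫ u n k = β k) (hu' : ∀ n k, α' _ ≫ u' n k = β' k)
    (huu' : ∀ n k, f _ ≫ u' n k = u n k ≫ h k)
    (motive : (∀ k, A' k) → Prop)
    (zero : motive 0) (add : ∀ x y, motive x → motive y → motive (x + y))
    (smul : ∀ (r : R') x, motive x → motive fun k ↦ α' k r * x k)
    (base : ∀ x : ∀ k, A k, (∀ k, u 0 k (x _) + u 1 k (x _) = u 2 k (x _)) →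
      motive fun k ↦ f k (x k))
    (x : ∀ k, A' k) (hx : ∀ k, u' 0 k (x _) + u' 1 k (x _) = u' 2 k (x _)) : motive x := by
  let : Algebra R R' := b.hom.toAlgebra
  have : Module.Flat R R' := hb
  let (k : _) : Algebra R (A k) := (α k).hom.toAlgebra
  let (k : _) : Algebra R (B k) := (β k).hom.toAlgebra
  let (k : _) : Algebra R' (A' k) := (α' k).hom.toAlgebra
  let (k : _) : Algebra R' (B' k) := (β' k).hom.toAlgebra
  let (k : _) : Algebra R (A' k) := (b ≫ α' k).hom.toAlgebra
  let (k : _) : Algebra R (B' k) := (b ≫ β' k).hom.toAlgebra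
  have (k : _) : IsScalarTower R R' (A' k) := .of_algebraMap_eq fun x ↦ rfl
  have (k : _) : IsScalarTower R R' (B' k) := .of_algebraMap_eq fun x ↦ rfl
  let F (k) : A k →ₐ[R] A' k := ⟨(f k).hom, fun r ↦ congr($((sqA k).w) r)⟩
  let G (k) : B k →ₐ[R] B' k := ⟨(h k).hom, fun r ↦ congr($((sqB k).w) r)⟩
  let u₁ (n k) : A (a n k) →ₐ[R] B k := ⟨(u n k).hom, fun r ↦ congr($(hu n k) r)⟩
  let u₂ (n k) : A' (a n k) →ₐ[R'] B' k := ⟨(u' n k).hom, fun r ↦ congr($(hu' n k) r)⟩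
  let d : (∀ k, A k) →ₗ[R] ∀ k, B k := LinearMap.pi fun k ↦
    (u₁ 0 k).toLinearMap ∘ₗ .proj _ + (u₁ 1 k).toLinearMap ∘ₗ .proj _ -
      (u₁ 2 k).toLinearMap ∘ₗ .proj _
  let d' : (∀ k, A' k) →ₗ[R'] ∀ k, B' k := LinearMap.pi fun k ↦
    (u₂ 0 k).toLinearMap ∘ₗ .proj _ + (u₂ 1 k).toLinearMap ∘ₗ .proj _ -
      (u₂ 2 k).toLinearMap ∘ₗ .proj _
  have hF := IsBaseChange.pi (fun k ↦ (F k).toLinearMap)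
    fun k ↦ isBaseChange_of_isPushout (F k) (sqA k)
  have hG := IsBaseChange.pi (fun k ↦ (G k).toLinearMap)
    fun k ↦ isBaseChange_of_isPushout (G k) (sqB k)
  have hcomm (n k) (y : A (a n k)) : u' n k (f _ y) = h k (u n k y) := congr($(huu' n k) y)
  have := mem_span_image_ker_of_isBaseChange hF hG d d' (fun x ↦ by
    ext k
    change u' 0 k (f _ (x _)) + u' 1 k (f _ (x _)) - u' 2 k (f _ (x _)) =
      h k (u 0 k (x _) + u 1 k (x _) - u 2 k (x _))
    rw [hcomm, hcomm, hcomm, map_sub, map_add]) (x := x)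
    (by ext k; exact sub_eq_zero.mpr (hx k))
  clear hx
  induction this using Submodule.span_induction with
  | mem x hx =>
    obtain ⟨y, hy, rfl⟩ := hx
    exact base y fun k ↦ sub_eq_zero.mp congr($(hy) k)
  | zero => exact zero
  | add x y _ _ hx hy => exact add x y hx hy
  | smul r x _ hx => exact smul r x hx

namespace AlgebraicGeometry.Scheme

lemma resSec_resSec {X : Scheme} {W V U : X.Opens} (h : V ≤ U) (h' : W ≤ V) (s : Γ(X, U)) :
    resSec X W V h' (resSec X V U h s) = resSec X W U (h'.trans h) s := by
  simp only [resSec, ← CommRingCat.comp_apply, ← Functor.map_comp]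
  rfl

lemma subsingleton_sections_of_genericPoint_notMem {X : Scheme} [IsIntegral X] {U : X.Opens}
    (hU : genericPoint X ∉ U) : Subsingleton Γ(X, U) := by
  have : U = ⊥ := by
    ext x
    exact ⟨fun hx ↦ hU (genericPoint_mem hx), fun hx ↦ hx.elim⟩
  subst this
  exact CommRingCat.subsingleton_of_isTerminal X.sheaf.isTerminalOfEmpty

lemma germ_genericPoint_appLE {X Y : Scheme} [IsIntegral X] (φ : X ⟶ Y) {V : Y.Opens}
    {U : X.Opens} (h : U ≤ φ ⁻¹ᵁ V) (hU : genericPoint X ∈ U) (r : Γ(Y, V)) :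
    X.presheaf.germ U (genericPoint X) hU (φ.appLE V U h r) =
      X.presheaf.germ (φ ⁻¹ᵁ V) (genericPoint X) (h hU) (φ.app V r) := by
  rw [Scheme.Hom.appLE, CommRingCat.comp_apply]
  exact X.presheaf.germ_res_apply (homOfLE h) _ _ _

end AlgebraicGeometry.Scheme

/-- On a finite affine cover of the preimage of an affine open set, a cocycle becomes a
coboundary after multiplication by a function which does not vanish at a given point. -/
lemma FirstDirectImageVanishes.exists_isCechCoboundary_mul {X Y : Scheme} {φ : X ⟶ Y}
    [IsIntegral X] [Surjective φ] (hR1 : FirstDirectImageVanishes φ) {V : Y.Opens}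
    (hV : IsAffineOpen V) {ι : Type} [Finite ι] {U : ι → X.Opens} (hU : ∀ i, IsAffineOpen (U i))
    (hUV : ∀ i, U i ≤ φ ⁻¹ᵁ V) (hcov : φ ⁻¹ᵁ V ≤ iSup U) {s : ∀ i j, Γ(X, U i ⊓ U j)}
    (hs : IsCechCocycle X U s) {y : Y} (hy : y ∈ V) :
    ∃ r : Γ(Y, V), y ∈ Y.basicOpen r ∧ IsCechCoboundary X U fun i j ↦
      φ.appLE V (U i ⊓ U j) (inf_le_left.trans (hUV i)) r * s i j := by
  obtain ⟨V', hV'V, hyV', t, ht⟩ := hR1 V U hUV hcov s hs y hy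
  obtain ⟨r, hrV', hyr⟩ := hV.exists_basicOpen_le ⟨y, hyV'⟩ hy
  let ρ (i : ι) : Γ(X, U i) := φ.appLE V (U i) (hUV i) r
  have hρ (i : ι) : X.basicOpen (ρ i) ≤ U i ⊓ φ ⁻¹ᵁ V' := by
    refine le_inf (X.basicOpen_le _) ?_
    refine le_trans ?_ (φ.preimage_mono hrV')
    simp only [ρ, Scheme.Hom.appLE, CommRingCat.comp_apply]
    rw [X.basicOpen_res, Scheme.preimage_basicOpen]
    exact inf_le_right
  choose n a ha using fun i ↦ exists_eq_pow_mul_of_isAffineOpen X (U i) (hU i) (ρ i)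
    (resSec X _ _ (hρ i) (t i))
  cases nonempty_fintype ι
  let N := Finset.univ.sup n
  have hηr : genericPoint X ∈ φ ⁻¹ᵁ Y.basicOpen r := by
    obtain ⟨x, rfl⟩ := φ.surjective y
    exact Scheme.genericPoint_mem (U := φ ⁻¹ᵁ Y.basicOpen r) hyr
  have hηV : genericPoint X ∈ φ ⁻¹ᵁ V := φ.preimage_mono (Y.basicOpen_le r) hηr
  refine ⟨r ^ N, ?_, fun i ↦ ρ i ^ (N - n i) * a i, fun i j ↦ ?_⟩
  · rw [Y.mem_basicOpen _ _ hy, map_pow]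
    exact ((Y.mem_basicOpen _ _ hy).mp hyr).pow _
  by_cases hη : genericPoint X ∈ U i ⊓ U j
  swap
  · have := Scheme.subsingleton_sections_of_genericPoint_notMem hη
    exact Subsingleton.elim _ _
  have hρη (i : ι) (hi : genericPoint X ∈ U i) : genericPoint X ∈ X.basicOpen (ρ i) := by
    simp only [ρ, Scheme.Hom.appLE, CommRingCat.comp_apply]
    rw [X.basicOpen_res, ← Scheme.preimage_basicOpen]
    exact ⟨hi, hηr⟩
  set c := X.presheaf.germ (φ ⁻¹ᵁ V) (genericPoint X) hηV (φ.app V r) with hc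
  have key (i : ι) (hi : genericPoint X ∈ U i) :
      X.presheaf.germ (U i) (genericPoint X) hi (ρ i ^ (N - n i) * a i) =
        c ^ N * X.presheaf.germ (U i ⊓ φ ⁻¹ᵁ V') (genericPoint X) ⟨hi, φ.preimage_mono hrV' hηr⟩
          (t i) := by
    have h₁ := congr(X.presheaf.germ _ (genericPoint X) (hρη i hi) $(ha i))
    rw [map_mul, map_pow] at h₁
    erw [Scheme.germ_genericPoint_resSec (X.basicOpen_le (ρ i)) (hρη i hi) (a i),
      Scheme.germ_genericPoint_resSec (X.basicOpen_le (ρ i)) (hρη i hi) (ρ i),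
      Scheme.germ_genericPoint_resSec (hρ i) (hρη i hi) (t i)] at h₁
    have h₂ : X.presheaf.germ (U i) (genericPoint X) hi (ρ i) = c :=
      Scheme.germ_genericPoint_appLE φ (hUV i) hi r
    rw [h₂] at h₁
    rw [map_mul, map_pow, h₁, h₂, ← mul_assoc, ← pow_add,
      Nat.sub_add_cancel (Finset.le_sup (f := n) (Finset.mem_univ i))]
  apply germ_injective_of_isIntegral X (genericPoint X) hη
  have hη' : genericPoint X ∈ (U i ⊓ φ ⁻¹ᵁ V') ⊓ (U j ⊓ φ ⁻¹ᵁ V') :=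
    ⟨⟨hη.1, φ.preimage_mono hrV' hηr⟩, ⟨hη.2, φ.preimage_mono hrV' hηr⟩⟩
  have hst := congr(X.presheaf.germ _ (genericPoint X) hη' $(ht i j))
  beta_reduce at hst ⊢
  rw [map_sub, Scheme.germ_genericPoint_resSec, Scheme.germ_genericPoint_resSec,
    Scheme.germ_genericPoint_resSec] at hst
  rw [map_mul, map_sub, Scheme.germ_genericPoint_resSec, Scheme.germ_genericPoint_resSec,
    Scheme.germ_genericPoint_appLE, map_pow, map_pow, key i hη.1, key j hη.2, hst, mul_sub]

section

variable {X : Scheme} {V U : X.Opens} (h : V ≤ U) (s t : Γ(X, U))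

lemma resSec_add : resSec X V U h (s + t) = resSec X V U h s + resSec X V U h t :=
  map_add _ _ _

lemma resSec_sub : resSec X V U h (s - t) = resSec X V U h s - resSec X V U h t :=
  map_sub _ _ _

lemma resSec_mul : resSec X V U h (s * t) = resSec X V U h s * resSec X V U h t :=
  map_mul _ _ _

lemma resSec_pow (n : ℕ) : resSec X V U h (s ^ n) = resSec X V U h s ^ n :=
  map_pow _ _ _

variable {ι : Type} {W : ι → X.Opens} {z z' : ∀ i j, Γ(X, W i ⊓ W j)}

lemma IsCechCoboundary.add (hz : IsCechCoboundary X W z) (hz' : IsCechCoboundary X W z') :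
    IsCechCoboundary X W fun i j ↦ z i j + z' i j := by
  obtain ⟨t, ht⟩ := hz
  obtain ⟨t', ht'⟩ := hz'
  refine ⟨fun i ↦ t i + t' i, fun i j ↦ ?_⟩
  beta_reduce
  rw [ht, ht', resSec_add, resSec_add]
  ring

lemma IsCechCoboundary.mul (hz : IsCechCoboundary X W z) (c : Γ(X, ⊤)) :
    IsCechCoboundary X W fun i j ↦ resSec X _ ⊤ le_top c * z i j := by
  obtain ⟨t, ht⟩ := hz
  refine ⟨fun i ↦ resSec X _ ⊤ le_top c * t i, fun i j ↦ ?_⟩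
  beta_reduce
  rw [ht, resSec_mul, resSec_mul, Scheme.resSec_resSec, Scheme.resSec_resSec]
  ring

end

section

variable {X Y X' Y' : Scheme} {g : X' ⟶ X} {φ' : X' ⟶ Y'} {φ : X ⟶ Y} {f : Y' ⟶ Y}

lemma isAffineOpen_inf_of_isSeparated [IsSeparated φ] {V : Y.Opens} (hV : IsAffineOpen V)
    {U₁ U₂ : X.Opens} (h₁ : U₁ ≤ φ ⁻¹ᵁ V) (h₂ : U₂ ≤ φ ⁻¹ᵁ V) (hU₁ : IsAffineOpen U₁)
    (hU₂ : IsAffineOpen U₂) : IsAffineOpen (U₁ ⊓ U₂) :=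
  isAffineHom_diagonal_iff.mp inferInstance V hV U₁ h₁ U₂ h₂ hU₁ hU₂

lemma appLE_resSec (φ : X ⟶ Y) {V : Y.Opens} {U U' : X.Opens} (h : U ≤ φ ⁻¹ᵁ V) (h' : U' ≤ U)
    (r : Γ(Y, V)) : resSec X U' U h' (φ.appLE V U h r) = φ.appLE V U' (h'.trans h) r := by
  rw [resSec, ← CommRingCat.comp_apply, Scheme.Hom.appLE_map]

lemma appLE_map_resSec (φ : X ⟶ Y) {V V' : Y.Opens} {U : X.Opens} (hV : V' ≤ V)
    (h : U ≤ φ ⁻¹ᵁ V') (r : Γ(Y, V)) :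
    φ.appLE V' U h (resSec Y V' V hV r) = φ.appLE V U (h.trans (φ.preimage_mono hV)) r := by
  rw [resSec, ← CommRingCat.comp_apply, Scheme.Hom.map_appLE]

lemma appLE_appLE (g : X' ⟶ X) (φ : X ⟶ Y) {V : Y.Opens} {U : X.Opens} {W : X'.Opens}
    (h : U ≤ φ ⁻¹ᵁ V) (h' : W ≤ g ⁻¹ᵁ U) (r : Γ(Y, V)) :
    g.appLE U W h' (φ.appLE V U h r) =
      (g ≫ φ).appLE V W (h'.trans (g.preimage_mono h)) r := by
  rw [← CommRingCat.comp_apply, Scheme.Hom.appLE_comp_appLE]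

lemma resSec_appTop (φ : X ⟶ Y) {U : X.Opens} (r : Γ(Y, ⊤)) :
    resSec X U ⊤ le_top (φ.appTop r) = φ.appLE ⊤ U le_top r := by
  rw [resSec, ← CommRingCat.comp_apply]
  rfl

lemma FirstDirectImageVanishes.exists_isCechCoboundary_mul_of_flat (H : IsPullback g φ' φ f)
    [Flat f] [IsAffine Y'] [IsIntegral X] [Surjective φ] [IsSeparated φ]
    (hR1 : FirstDirectImageVanishes φ) {V : Y.Opens}
    (hV : IsAffineOpen V) (hf : f ⁻¹ᵁ V = ⊤) {ι : Type} [Finite ι] {U : ι → X.Opens}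
    (hU : ∀ i, IsAffineOpen (U i)) (hUV : ∀ i, U i ≤ φ ⁻¹ᵁ V) (hcov : φ ⁻¹ᵁ V ≤ iSup U)
    {z : ∀ i j, Γ(X', g ⁻¹ᵁ U i ⊓ g ⁻¹ᵁ U j)} (hz : IsCechCocycle X' (fun i ↦ g ⁻¹ᵁ U i) z)
    (y' : Y') :
    ∃ r : Γ(Y', ⊤), y' ∈ Y'.basicOpen r ∧ IsCechCoboundary X' (fun i ↦ g ⁻¹ᵁ U i) fun i j ↦
      resSec X' (g ⁻¹ᵁ U i ⊓ g ⁻¹ᵁ U j) ⊤ le_top (φ'.appTop r) * z i j := by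
  have h₂ (i j) : U i ⊓ U j ≤ φ ⁻¹ᵁ V := inf_le_left.trans (hUV i)
  have h₃ (i j k) : U i ⊓ U j ⊓ U k ≤ φ ⁻¹ᵁ V := inf_le_left.trans (h₂ i j)
  have hU₂ (i j) : IsAffineOpen (U i ⊓ U j) :=
    isAffineOpen_inf_of_isSeparated hV (hUV i) (hUV j) (hU i) (hU j)
  have hU₃ (i j k) : IsAffineOpen (U i ⊓ U j ⊓ U k) :=
    isAffineOpen_inf_of_isSeparated hV (h₂ i j) (hUV k) (hU₂ i j) (hU k)
  have hy' : f y' ∈ V := show y' ∈ f ⁻¹ᵁ V from hf ▸ trivial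
  have hflat : (f.appLE V ⊤ hf.ge).hom.Flat := Flat.flat_appLE f hV (isAffineOpen_top _) _
  let a : Fin 3 → ι × ι × ι → ι × ι :=
    ![fun p ↦ (p.1, p.2.1), fun p ↦ (p.2.1, p.2.2), fun p ↦ (p.1, p.2.2)]
  have ha : ∀ n p, U p.1 ⊓ U p.2.1 ⊓ U p.2.2 ≤ U (a n p).1 ⊓ U (a n p).2 := by
    intro n p
    fin_cases n
    · exact inf_le_left
    · exact le_inf (inf_le_left.trans inf_le_right) inf_le_right
    · exact le_inf (inf_le_left.trans inf_le_left) inf_le_right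
  have := flat_cocycle_induction (f.appLE V ⊤ hf.ge) hflat
    (A := fun p : ι × ι ↦ Γ(X, U p.1 ⊓ U p.2))
    (A' := fun p : ι × ι ↦ Γ(X', g ⁻¹ᵁ U p.1 ⊓ g ⁻¹ᵁ U p.2))
    (B := fun p : ι × ι × ι ↦ Γ(X, U p.1 ⊓ U p.2.1 ⊓ U p.2.2))
    (B' := fun p : ι × ι × ι ↦ Γ(X', g ⁻¹ᵁ U p.1 ⊓ g ⁻¹ᵁ U p.2.1 ⊓ g ⁻¹ᵁ U p.2.2))
    (fun p ↦ isPushout_sections H hV hf (h₂ p.1 p.2) (hU₂ p.1 p.2))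
    (fun p ↦ isPushout_sections H hV hf (h₃ p.1 p.2.1 p.2.2) (hU₃ p.1 p.2.1 p.2.2)) a
    (fun n p ↦ X.presheaf.map (homOfLE (ha n p)).op)
    (fun n p ↦ X'.presheaf.map (homOfLE (g.preimage_mono (ha n p))).op)
    (fun n p ↦ Scheme.Hom.appLE_map ..)
    (fun n p ↦ Scheme.Hom.appLE_map ..)
    (fun n p ↦ (Scheme.Hom.appLE_map ..).trans (Scheme.Hom.map_appLE ..).symm)
    (fun x ↦ ∃ r : Γ(Y', ⊤), y' ∈ Y'.basicOpen r ∧ IsCechCoboundary X' (fun i ↦ g ⁻¹ᵁ U i)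
      fun i j ↦ resSec X' (g ⁻¹ᵁ U i ⊓ g ⁻¹ᵁ U j) ⊤ le_top (φ'.appTop r) * x (i, j))
    ⟨1, by simp, 0, fun i j ↦ by simp [resSec]⟩ ?_ ?_ ?_ (fun p ↦ z p.1 p.2)
    (fun p ↦ hz p.1 p.2.1 p.2.2)
  · exact this
  · rintro x x' ⟨r, hr, h⟩ ⟨r', hr', h'⟩
    refine ⟨r * r', by rw [Scheme.basicOpen_mul]; exact ⟨hr, hr'⟩, ?_⟩
    convert (h.mul (φ'.appTop r')).add (h'.mul (φ'.appTop r)) using 3 with i j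
    rw [map_mul, resSec_mul, Pi.add_apply]
    ring
  · rintro c x ⟨r, hr, h⟩
    refine ⟨r, hr, ?_⟩
    convert h.mul (φ'.appTop c) using 3 with i j
    exact mul_left_comm _ _ _
  · intro x hx
    obtain ⟨r, hr, t, ht⟩ := hR1.exists_isCechCoboundary_mul hV hU hUV hcov
      (s := fun i j ↦ x (i, j)) (fun i j k ↦ hx (i, j, k)) hy'
    refine ⟨f.appLE V ⊤ hf.ge r, ?_, fun i ↦ g.appLE _ _ le_rfl (t i), fun i j ↦ ?_⟩
    · rw [Scheme.basicOpen_appLE]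
      exact ⟨trivial, hr⟩
    · have key := congr(g.appLE (U i ⊓ U j) (g ⁻¹ᵁ U i ⊓ g ⁻¹ᵁ U j) le_rfl $(ht i j))
      have hcomp : resSec X' (g ⁻¹ᵁ U i ⊓ g ⁻¹ᵁ U j) ⊤ le_top
          (φ'.appTop (f.appLE V ⊤ hf.ge r)) =
          g.appLE (U i ⊓ U j) (g ⁻¹ᵁ U i ⊓ g ⁻¹ᵁ U j) le_rfl (φ.appLE V (U i ⊓ U j) (h₂ i j) r) := by
        rw [resSec_appTop]
        refine (appLE_appLE φ' f hf.ge le_top r).trans ?_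
        refine Eq.trans ?_ (appLE_appLE g φ _ _ r).symm
        simp only [H.w]
      rw [map_mul, map_sub] at key
      beta_reduce
      rw [hcomp]
      refine key.trans ?_
      congr 1
      · exact (appLE_map_resSec g _ _ _).trans (appLE_resSec g _ _ _).symm
      · exact (appLE_map_resSec g _ _ _).trans (appLE_resSec g _ _ _).symm

end

section

variable {X : Scheme}

lemma basicOpen_resSec {V U : X.Opens} (h : V ≤ U) (s : Γ(X, U)) :
    X.basicOpen (resSec X V U h s) = V ⊓ X.basicOpen s := X.basicOpen_res s (homOfLE h).op

lemma exists_resSec_eq {κ : Type} {A : κ → X.Opens} {B : X.Opens} (hA : ∀ k, A k ≤ B)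
    (hB : B ≤ iSup A) (s : ∀ k, Γ(X, A k))
    (h : ∀ k l, resSec X (A k ⊓ A l) (A k) inf_le_left (s k) =
      resSec X (A k ⊓ A l) (A l) inf_le_right (s l)) :
    ∃ t : Γ(X, B), ∀ k, resSec X (A k) B (hA k) t = s k := by
  obtain ⟨t, ht, -⟩ := X.sheaf.existsUnique_gluing' A B (fun k ↦ homOfLE (hA k)) hB s h
  exact ⟨t, ht⟩

lemma eq_of_resSec_eq {κ : Type} {A : κ → X.Opens} {B : X.Opens} (hA : ∀ k, A k ≤ B)
    (hB : B ≤ iSup A) {s t : Γ(X, B)}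
    (h : ∀ k, resSec X (A k) B (hA k) s = resSec X (A k) B (hA k) t) : s = t :=
  X.sheaf.eq_of_locally_eq' A B (fun k ↦ homOfLE (hA k)) hB s t h

lemma exists_resSec_eq_and_resSec_eq {A₀ A₁ B : X.Opens} (h₀ : A₀ ≤ B) (h₁ : A₁ ≤ B)
    (hB : B ≤ A₀ ⊔ A₁) (s₀ : Γ(X, A₀)) (s₁ : Γ(X, A₁))
    (h : resSec X (A₀ ⊓ A₁) A₀ inf_le_left s₀ = resSec X (A₀ ⊓ A₁) A₁ inf_le_right s₁) :
    ∃ t : Γ(X, B), resSec X A₀ B h₀ t = s₀ ∧ resSec X A₁ B h₁ t = s₁ := by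
  let A (b : Bool) : X.Opens := b.rec A₀ A₁
  have hA (b : Bool) : A b ≤ B := by cases b <;> assumption
  obtain ⟨t, ht⟩ := exists_resSec_eq hA (by rwa [iSup_bool_eq, sup_comm])
    (fun b ↦ (b.rec s₀ s₁ : Γ(X, A b))) (by
      rintro (_ | _) (_ | _)
      · rfl
      · exact h
      · have := congr(resSec X (A₁ ⊓ A₀) _ (inf_comm A₁ A₀).le $h)
        rw [Scheme.resSec_resSec, Scheme.resSec_resSec] at this
        exact this.symm
      · rfl)
  exact ⟨t, ht false, ht true⟩

lemma exists_pow_mul_eq_resSec {U A B : X.Opens} (hA : A ≤ U) (hBA : B ≤ A)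
    (hAc : IsCompact (A : Set X)) (hAs : IsQuasiSeparated (A : Set X)) (hB : IsCompact (B : Set X))
    (ρ : Γ(X, U)) (hρ : A ⊓ X.basicOpen ρ ≤ B) (σ : Γ(X, B)) :
    ∃ (n : ℕ) (β : Γ(X, A)),
      resSec X B U (hBA.trans hA) ρ ^ n * σ = resSec X B A hBA β := by
  have h₁ : X.basicOpen (resSec X A U hA ρ) ≤ B := by rwa [basicOpen_resSec]
  obtain ⟨n, y, hy⟩ := exists_eq_pow_mul_of_isCompact_of_isQuasiSeparated X A hAc hAs
    (resSec X A U hA ρ) (resSec X _ B h₁ σ)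
  have h₂ : X.basicOpen (resSec X B U (hBA.trans hA) ρ) ≤ X.basicOpen (resSec X A U hA ρ) := by
    rw [basicOpen_resSec, basicOpen_resSec]
    exact inf_le_inf_right _ hBA
  have h₃ := X.basicOpen_le (resSec X B U (hBA.trans hA) ρ)
  replace hy := congr(resSec X _ _ h₂ $hy)
  change resSec X _ _ h₂ (resSec X _ _ (X.basicOpen_le _) y) =
    resSec X _ _ h₂ (resSec X _ _ (X.basicOpen_le _) (resSec X A U hA ρ) ^ n * _) at hy
  obtain ⟨m, hm⟩ := exists_pow_mul_eq_zero_of_res_basicOpen_eq_zero_of_isCompact X hB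
    (resSec X B U (hBA.trans hA) ρ ^ n * σ - resSec X B A hBA y)
    (resSec X B U (hBA.trans hA) ρ) (by
      change resSec X _ _ h₃ _ = 0
      rw [resSec_sub, resSec_mul, resSec_pow, sub_eq_zero]
      simp only [resSec_mul, resSec_pow, Scheme.resSec_resSec] at hy ⊢
      exact hy.symm)
  refine ⟨m + n, resSec X A U hA ρ ^ m * y, ?_⟩
  rw [resSec_mul, resSec_pow, Scheme.resSec_resSec, pow_add, mul_assoc, ← sub_eq_zero, ← mul_sub,
    hm]

/-- Sections on the overlap of a cover of an affine open set by two open sets split. -/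
lemma AlgebraicGeometry.IsAffineOpen.exists_eq_sub [QuasiSeparatedSpace X] {U W₀ W₁ : X.Opens}
    (hU : IsAffineOpen U) (h₀ : IsCompact (W₀ : Set X)) (h₁ : IsCompact (W₁ : Set X))
    (hUW : U ≤ W₀ ⊔ W₁) (σ : Γ(X, W₀ ⊓ W₁)) :
    ∃ (α : Γ(X, U ⊓ W₀)) (β : Γ(X, U ⊓ W₁)),
      resSec X (U ⊓ (W₀ ⊓ W₁)) (W₀ ⊓ W₁) inf_le_right σ =
      resSec X (U ⊓ (W₀ ⊓ W₁)) (U ⊓ W₀) (inf_le_inf_left _ inf_le_left) α -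
      resSec X (U ⊓ (W₀ ⊓ W₁)) (U ⊓ W₁) (inf_le_inf_left _ inf_le_right) β := by
  have hc {A B : X.Opens} (hA : IsCompact (A : Set X)) (hB : IsCompact (B : Set X)) :
      IsCompact ((A ⊓ B : X.Opens) : Set X) := 
    QuasiSeparatedSpace.inter_isCompact _ _ A.2 hA B.2 hB
  have hqs (A : X.Opens) : IsQuasiSeparated (A : Set X) :=
    isQuasiSeparated_univ.of_subset (Set.subset_univ _)
  let J : Ideal Γ(X, U) :=
    { carrier := {r | ∃ (α : Γ(X, U ⊓ W₀)) (β : Γ(X, U ⊓ W₁)),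
        resSec X (U ⊓ (W₀ ⊓ W₁)) U inf_le_left r *
          resSec X (U ⊓ (W₀ ⊓ W₁)) (W₀ ⊓ W₁) inf_le_right σ =
        resSec X (U ⊓ (W₀ ⊓ W₁)) (U ⊓ W₀) (inf_le_inf_left _ inf_le_left) α -
        resSec X (U ⊓ (W₀ ⊓ W₁)) (U ⊓ W₁) (inf_le_inf_left _ inf_le_right) β}
      zero_mem' := ⟨0, 0, by simp [resSec]⟩
      add_mem' := by
        rintro a b ⟨α, β, h⟩ ⟨α', β', h'⟩
        exact ⟨α + α', β + β', by rw [resSec_add, resSec_add, resSec_add, add_mul, h, h']; ring⟩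
      smul_mem' := by
        rintro c a ⟨α, β, h⟩
        refine ⟨resSec X _ U inf_le_left c * α, resSec X _ U inf_le_left c * β, ?_⟩
        rw [smul_eq_mul, resSec_mul, resSec_mul, resSec_mul, mul_assoc, h, Scheme.resSec_resSec,
          Scheme.resSec_resSec]
        ring }
  suffices (1 : Γ(X, U)) ∈ J by
    obtain ⟨α, β, h⟩ := this
    refine ⟨α, β, ?_⟩
    rw [← h]
    simp [resSec]
  by_contra h1
  obtain ⟨m, hm, hJm⟩ := Ideal.exists_le_maximal J fun h ↦ h1 (h ▸ trivial)
  obtain ⟨x, hxU, hx⟩ : ∃ x ∈ U, ∀ r : Γ(X, U), x ∈ X.basicOpen r → r ∉ m := by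
    refine ⟨hU.fromSpec ⟨m, hm.isPrime⟩, ?_, fun r hr ↦ ?_⟩
    · rw [← SetLike.mem_coe, ← hU.range_fromSpec]
      exact ⟨_, rfl⟩
    · change _ ∈ hU.fromSpec ⁻¹ᵁ X.basicOpen r at hr
      rwa [hU.fromSpec_preimage_basicOpen] at hr
  rcases hUW hxU with hxW | hxW
  · obtain ⟨ρ, hρ, hxρ⟩ := hU.exists_basicOpen_le ⟨x, hxW⟩ hxU
    obtain ⟨n, β, h⟩ := exists_pow_mul_eq_resSec (U := U) (A := U ⊓ W₁) (B := U ⊓ (W₀ ⊓ W₁))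
      inf_le_left (inf_le_inf_left _ inf_le_right) (hc hU.isCompact h₁) (hqs _)
      (hc hU.isCompact (hc h₀ h₁)) ρ
      (le_inf (inf_le_left.trans inf_le_left)
        (le_inf (inf_le_right.trans hρ) (inf_le_left.trans inf_le_right)))
      (resSec X _ _ inf_le_right σ)
    refine hx ρ hxρ (hm.isPrime.mem_of_pow_mem n (hJm ⟨0, -β, ?_⟩))
    rw [resSec_pow, h]
    simp [resSec]
  · obtain ⟨ρ, hρ, hxρ⟩ := hU.exists_basicOpen_le ⟨x, hxW⟩ hxU
    obtain ⟨n, α, h⟩ := exists_pow_mul_eq_resSec (U := U) (A := U ⊓ W₀) (B := U ⊓ (W₀ ⊓ W₁))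
      inf_le_left (inf_le_inf_left _ inf_le_left) (hc hU.isCompact h₀) (hqs _)
      (hc hU.isCompact (hc h₀ h₁)) ρ
      (le_inf (inf_le_left.trans inf_le_left)
        (le_inf (inf_le_left.trans inf_le_right) (inf_le_right.trans hρ)))
      (resSec X _ _ inf_le_right σ)
    refine hx ρ hxρ (hm.isPrime.mem_of_pow_mem n (hJm ⟨α, 0, ?_⟩))
    rw [resSec_pow, h]
    simp [resSec]

/-- A section on the overlap of two open sets covering the scheme splits on each member of an affine
cover; the differences of the splittings form a cocycle. -/
lemma exists_isCechCocycle_of_sup_eq_top [QuasiSeparatedSpace X] {W₀ W₁ : X.Opens}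
    (h₀ : IsCompact (W₀ : Set X)) (h₁ : IsCompact (W₁ : Set X)) (hW : W₀ ⊔ W₁ = ⊤)
    (σ : Γ(X, W₀ ⊓ W₁)) {κ : Type} {U : κ → X.Opens} (hU : ∀ i, IsAffineOpen (U i))
    (hcov : iSup U = ⊤) :
    ∃ z : ∀ i j, Γ(X, U i ⊓ U j), IsCechCocycle X U z ∧
      ∀ r : Γ(X, ⊤), (IsCechCoboundary X U fun i j ↦ resSec X _ _ le_top r * z i j) →
        ∃ (τ₀ : Γ(X, W₀)) (τ₁ : Γ(X, W₁)), resSec X _ _ le_top r * σ =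
          resSec X _ _ inf_le_left τ₀ - resSec X _ _ inf_le_right τ₁ := by
  choose α β hαβ using fun i ↦ (hU i).exists_eq_sub h₀ h₁ (hW ▸ le_top) σ
  have hz (i j) : ∃ z : Γ(X, U i ⊓ U j),
      (resSec X (U i ⊓ U j ⊓ W₀) _ inf_le_left z =
        resSec X _ (U i ⊓ W₀) (inf_le_inf_right _ inf_le_left) (α i) -
        resSec X _ (U j ⊓ W₀) (inf_le_inf_right _ inf_le_right) (α j)) ∧
      resSec X (U i ⊓ U j ⊓ W₁) _ inf_le_left z =
        resSec X _ (U i ⊓ W₁) (inf_le_inf_right _ inf_le_left) (β i) -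
        resSec X _ (U j ⊓ W₁) (inf_le_inf_right _ inf_le_right) (β j) := by
    refine exists_resSec_eq_and_resSec_eq _ _ ?_ _ _ ?_
    · rw [← inf_sup_left, hW, inf_top_eq]
    · have hi := congr(resSec X (U i ⊓ U j ⊓ W₀ ⊓ (U i ⊓ U j ⊓ W₁)) _ (le_inf (inf_le_left.trans
        (inf_le_left.trans inf_le_left)) (inf_le_inf inf_le_right inf_le_right)) $(hαβ i))
      have hj := congr(resSec X (U i ⊓ U j ⊓ W₀ ⊓ (U i ⊓ U j ⊓ W₁)) _ (le_inf (inf_le_left.trans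
        (inf_le_left.trans inf_le_right)) (inf_le_inf inf_le_right inf_le_right)) $(hαβ j))
      simp only [resSec_sub, Scheme.resSec_resSec] at hi hj ⊢
      linear_combination hj - hi
  choose z hz₀ hz₁ using hz
  have hle (A : X.Opens) : A ≤ ⨆ b : Bool, A ⊓ cond b W₁ W₀ := by
    rw [← inf_iSup_eq, iSup_bool_eq]
    simp [sup_comm, hW]
  refine ⟨z, fun i j k ↦ ?_, fun r ⟨t, ht⟩ ↦ ?_⟩
  · refine eq_of_resSec_eq (fun b ↦ inf_le_left) (hle _) ?_
    rintro (_ | _)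
    · have h₁ := congr(resSec X (U i ⊓ U j ⊓ U k ⊓ W₀) _
        (inf_le_inf_right _ inf_le_left) $(hz₀ i j))
      have h₂ := congr(resSec X (U i ⊓ U j ⊓ U k ⊓ W₀) _
        (inf_le_inf_right _ (inf_le_inf_right _ inf_le_right)) $(hz₀ j k))
      have h₃ := congr(resSec X (U i ⊓ U j ⊓ U k ⊓ W₀) _
        (inf_le_inf_right _ (inf_le_inf_right _ inf_le_left)) $(hz₀ i k))
      simp only [resSec_sub, resSec_add, Scheme.resSec_resSec, cond] at h₁ h₂ h₃ ⊢
      rw [h₁, h₂, h₃]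
      ring
    · have h₁ := congr(resSec X (U i ⊓ U j ⊓ U k ⊓ W₁) _
        (inf_le_inf_right _ inf_le_left) $(hz₁ i j))
      have h₂ := congr(resSec X (U i ⊓ U j ⊓ U k ⊓ W₁) _
        (inf_le_inf_right _ (inf_le_inf_right _ inf_le_right)) $(hz₁ j k))
      have h₃ := congr(resSec X (U i ⊓ U j ⊓ U k ⊓ W₁) _
        (inf_le_inf_right _ (inf_le_inf_right _ inf_le_left)) $(hz₁ i k))
      simp only [resSec_sub, resSec_add, Scheme.resSec_resSec, cond] at h₁ h₂ h₃ ⊢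
      rw [h₁, h₂, h₃]
      ring
  · have hcov' (A : X.Opens) : A ≤ ⨆ i, U i ⊓ A := by rw [← iSup_inf_eq, hcov, top_inf_eq]
    have hglue {A : X.Opens} (γ : ∀ i, Γ(X, U i ⊓ A)) (hγ : ∀ i j,
        resSec X (U i ⊓ U j ⊓ A) _ inf_le_left (z i j) =
        resSec X _ (U i ⊓ A) (inf_le_inf_right _ inf_le_left) (γ i) -
        resSec X _ (U j ⊓ A) (inf_le_inf_right _ inf_le_right) (γ j)) :
        ∃ τ : Γ(X, A), ∀ i, resSec X (U i ⊓ A) A inf_le_right τ =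
          resSec X _ _ le_top r * γ i - resSec X _ _ inf_le_left (t i) := by
      refine exists_resSec_eq (fun _ ↦ inf_le_right) (hcov' A) _ fun i j ↦ ?_
      have h₁ := congr(resSec X (U i ⊓ A ⊓ (U j ⊓ A)) _ (le_inf (inf_le_inf inf_le_left inf_le_left)
        (inf_le_left.trans inf_le_right)) $(hγ i j))
      have h₂ := congr(resSec X (U i ⊓ A ⊓ (U j ⊓ A)) _ (inf_le_inf inf_le_left inf_le_left)
        $(ht i j))
      simp only [resSec_sub, resSec_mul, Scheme.resSec_resSec] at h₁ h₂ ⊢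
      linear_combination h₂ - resSec X _ _ le_top r * h₁
    obtain ⟨τ₀, hτ₀⟩ := hglue α hz₀
    obtain ⟨τ₁, hτ₁⟩ := hglue β hz₁
    refine ⟨τ₀, τ₁, eq_of_resSec_eq (fun _ ↦ inf_le_right) (hcov' _) fun i ↦ ?_⟩
    have h₀ := congr(resSec X (U i ⊓ (W₀ ⊓ W₁)) _ (inf_le_inf_left _ inf_le_left) $(hτ₀ i))
    have h₁ := congr(resSec X (U i ⊓ (W₀ ⊓ W₁)) _ (inf_le_inf_left _ inf_le_right) $(hτ₁ i))
    simp only [resSec_sub, resSec_mul, Scheme.resSec_resSec] at h₀ h₁ ⊢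
    rw [hαβ, h₀, h₁]
    ring

end

/-- After a flat base change, a section on the overlap of two open sets covering the scheme splits,
up to a function which does not vanish at a given point of the base. -/
lemma FirstDirectImageVanishes.exists_mul_eq_sub {X Y X' Y' : Scheme.{0}} {g : X' ⟶ X} {φ' : X' ⟶ Y'}
    {φ : X ⟶ Y} {f : Y' ⟶ Y} (H : IsPullback g φ' φ f)
    [Flat f] [IsAffine Y'] [IsIntegral X] [Surjective φ] [IsSeparated φ] [QuasiCompact φ]
    (hR1 : FirstDirectImageVanishes φ) {V : Y.Opens}
    (hV : IsAffineOpen V) (hf : f ⁻¹ᵁ V = ⊤) {W₀ W₁ : X'.Opens} (h₀ : IsCompact (W₀ : Set X'))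
    (h₁ : IsCompact (W₁ : Set X')) (hW : W₀ ⊔ W₁ = ⊤) (σ : Γ(X', W₀ ⊓ W₁)) (y' : Y') :
    ∃ r : Γ(Y', ⊤), y' ∈ Y'.basicOpen r ∧ ∃ (τ₀ : Γ(X', W₀)) (τ₁ : Γ(X', W₁)),
      resSec X' _ _ le_top (φ'.appTop r) * σ =
        resSec X' _ _ inf_le_left τ₀ - resSec X' _ _ inf_le_right τ₁ := by
  obtain ⟨s, hs, hsV⟩ := isCompact_and_isOpen_iff_finite_and_eq_biUnion_affineOpens.mp
    ⟨φ.isCompact_preimage hV.isCompact, (φ ⁻¹ᵁ V).2⟩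
  have := hs.to_subtype
  have hcov : φ ⁻¹ᵁ V = ⨆ i : s, (i : X.Opens) := by
    ext1
    simpa using hsV
  have hUV (i : s) : (i : X.Opens) ≤ φ ⁻¹ᵁ V := by
    rw [hcov]
    exact le_iSup (fun i : s ↦ (i : X.Opens)) i
  have : IsSeparated φ' := MorphismProperty.of_isPullback H inferInstance
  have : QuasiSeparatedSpace X' := quasiSeparatedSpace_of_quasiSeparated φ'
  obtain ⟨z, hz, h⟩ := exists_isCechCocycle_of_sup_eq_top h₀ h₁ hW σ
    (κ := s) (U := fun i ↦ g ⁻¹ᵁ (i : X.Opens))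
    (fun i ↦ isAffineOpen_preimage_of_isPullback H hV hf (hUV i) i.1.2) (by
      rw [← Scheme.Hom.preimage_iSup, ← hcov, ← Scheme.Hom.comp_preimage, H.w,
        Scheme.Hom.comp_preimage, hf]
      rfl)
  obtain ⟨r, hr, hz'⟩ := hR1.exists_isCechCoboundary_mul_of_flat H hV hf
    (U := fun i : s ↦ (i : X.Opens)) (fun i ↦ i.1.2) hUV hcov.le hz y'
  exact ⟨r, hr, h _ hz'⟩

namespace AlgebraicGeometry.Scheme

variable {C : Scheme} [IsIntegral C]

lemma isClosed_singleton_of_ne_genericPoint (hdim : topologicalKrullDim C ≤ 1) {x : C}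
    (hx : x ≠ genericPoint C) : IsClosed ({x} : Set C) := by
  rcases Order.krullDim_le_one_iff.mp hdim ⟨closure {x}, isIrreducible_singleton.closure,
    isClosed_closure⟩ with h | h
  · rw [← closure_subset_iff_isClosed]
    intro z hz
    have hxz : x ⤳ z := specializes_iff_mem_closure.mpr hz
    have : (⟨closure {z}, isIrreducible_singleton.closure, isClosed_closure⟩ :
        IrreducibleCloseds C) ≤ ⟨closure {x}, isIrreducible_singleton.closure, isClosed_closure⟩ :=
      hxz.closure_subset
    have hzx : z ⤳ x := specializes_iff_closure_subset.mpr (h this)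
    exact (hxz.antisymm hzx).symm.eq
  · refine (hx ?_).elim
    have : (⟨closure {x}, isIrreducible_singleton.closure, isClosed_closure⟩ :
        IrreducibleCloseds C) ≤ ⟨Set.univ, IrreducibleSpace.isIrreducible_univ C, isClosed_univ⟩ :=
      Set.subset_univ _
    have hxη : x ⤳ genericPoint C := specializes_iff_mem_closure.mpr (h this trivial)
    exact (hxη.antisymm (genericPoint_specializes x)).eq

lemma exists_ne_genericPoint (hdim : topologicalKrullDim C = 1) : ∃ x : C, x ≠ genericPoint C := by
  by_contra! h
  have : topologicalKrullDim C ≤ 0 := by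
    have : Subsingleton C := ⟨fun x y ↦ (h x).trans (h y).symm⟩
    exact topologicalKrullDim_zero_of_discreteTopology C
  rw [hdim] at this
  exact absurd this (by decide)

lemma finite_compl_of_genericPoint_mem [NoetherianSpace C] (hdim : topologicalKrullDim C ≤ 1)
    {U : C.Opens} (hU : genericPoint C ∈ U) : ((U : Set C)ᶜ).Finite := by
  obtain ⟨S, hS, hSc, hSi, hUS⟩ :=
    NoetherianSpace.exists_finite_set_isClosed_irreducible U.isOpen.isClosed_compl
  rw [hUS]
  refine hS.sUnion fun t ht ↦ ?_
  obtain ⟨x, hx⟩ := QuasiSober.sober (hSi t ht) (hSc t ht)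
  have hxt : x ∈ t := hx.mem
  have hxη : x ≠ genericPoint C := by
    rintro rfl
    exact absurd hU (hUS.ge ⟨t, ht, hxt⟩)
  have := isClosed_singleton_of_ne_genericPoint hdim hxη
  rw [← hx.def, this.closure_eq]
  exact Set.finite_singleton x

/-- The only non-zero prime ideal of the local ring of a curve at a point is the maximal one. -/
lemma eq_maximalIdeal_of_isPrime_of_ne_bot (hdim : topologicalKrullDim C ≤ 1) {x : C}
    {P : Ideal (C.presheaf.stalk x)} [hP : P.IsPrime] (h0 : P ≠ ⊥) :
    P = IsLocalRing.maximalIdeal (C.presheaf.stalk x) := by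
  let z := C.fromSpecStalk x ⟨P, hP⟩
  have hinj : Function.Injective (C.fromSpecStalk x) := (C.fromSpecStalk x).isEmbedding.injective
  have hzx : z ⤳ x := by
    have : z ∈ Set.range (C.fromSpecStalk x) := ⟨_, rfl⟩
    rwa [range_fromSpecStalk] at this
  by_cases hz : z = genericPoint C
  · refine (h0 ?_).elim
    obtain ⟨w, hw⟩ : genericPoint C ∈ Set.range (C.fromSpecStalk x) := by
      rw [range_fromSpecStalk]
      exact genericPoint_specializes x
    have h₁ : C.fromSpecStalk x ⟨⊥, Ideal.isPrime_bot⟩ ⤳ z := by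
      refine Specializes.map ?_ (C.fromSpecStalk x).continuous
      exact (PrimeSpectrum.le_iff_specializes _ _).mp (show (⊥ : Ideal _) ≤ P from bot_le)
    have h₂ : C.fromSpecStalk x ⟨⊥, Ideal.isPrime_bot⟩ = z :=
      (h₁.antisymm (hz ▸ genericPoint_specializes _)).eq
    exact congr($(hinj h₂).1).symm
  · have h₁ : z = C.fromSpecStalk x (IsLocalRing.closedPoint _) := by
      rw [fromSpecStalk_closedPoint]
      have := isClosed_singleton_of_ne_genericPoint hdim hz
      exact (this.closure_eq ▸ specializes_iff_mem_closure.mp hzx : x ∈ ({z} : Set C)).symm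
    exact congr($(hinj h₁).1)

lemma exists_mul_pow_mem_regularAt (hdim : topologicalKrullDim C ≤ 1) {x : C} (f : C.functionField)
    {a : C.presheaf.stalk x} (ha : a ∈ IsLocalRing.maximalIdeal (C.presheaf.stalk x)) :
    ∃ n : ℕ, f * algebraMap _ C.functionField a ^ n ∈ C.regularAt x := by
  obtain ⟨b, c, hc, rfl⟩ := IsFractionRing.div_surjective (A := C.presheaf.stalk x) f
  have hc0 : c ≠ 0 := nonZeroDivisors.ne_zero hc
  have : a ∈ (Ideal.span {c}).radical := by
    rw [Ideal.radical_eq_sInf, Ideal.mem_sInf]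
    rintro P ⟨hcP, hP⟩
    rwa [eq_maximalIdeal_of_isPrime_of_ne_bot hdim (P := P)]
    rintro rfl
    exact hc0 (by simpa using hcP)
  obtain ⟨n, hn⟩ := this
  obtain ⟨d, hd⟩ := Ideal.mem_span_singleton'.mp hn
  refine ⟨n, b * d, ?_⟩
  have hc' : algebraMap (C.presheaf.stalk x) C.functionField c ≠ 0 := by
    simpa using hc0
  rw [← map_pow, ← hd, map_mul, map_mul]
  field_simp

end AlgebraicGeometry.Scheme

namespace AlgebraicGeometry.Scheme

/-- Every principal part on the integral scheme `C` is that of a rational function which is regular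
elsewhere. -/
def HasPrincipalParts (C : Scheme) [IsIntegral C] : Prop :=
  ∀ p : C, p ≠ genericPoint C → ∀ f : C.functionField,
    ∃ t : C.functionField, (∀ q ≠ p, t ∈ C.regularAt q) ∧ f - t ∈ C.regularAt p

variable {C : Scheme} [IsIntegral C]

lemma HasPrincipalParts.exists_sum (hC : C.HasPrincipalParts) {S : Set C} (hS : S.Finite)
    (hη : genericPoint C ∉ S) (f : C → C.functionField) :
    ∃ t : C.functionField, (∀ q ∉ S, t ∈ C.regularAt q) ∧ ∀ p ∈ S, f p - t ∈ C.regularAt p := by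
  classical
  induction S, hS using Set.Finite.induction_on with
  | empty => exact ⟨0, fun q _ ↦ zero_mem _, by simp⟩
  | @insert p S hp hS ih =>
    obtain ⟨t, ht, ht'⟩ := ih fun h ↦ hη (Or.inr h)
    obtain ⟨t₁, h₁, h₁'⟩ := hC p (fun h ↦ hη (Or.inl h.symm)) (f p)
    refine ⟨t + t₁, fun q hq ↦ ?_, ?_⟩
    · exact add_mem (ht q fun h ↦ hq (Or.inr h)) (h₁ q fun h ↦ hq (Or.inl h))
    · rintro q (rfl | hq)
      · convert sub_mem h₁' (ht q hp) using 1
        ring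
      · convert sub_mem (ht' q hq) (h₁ q (by rintro rfl; exact hp hq)) using 1
        ring

/-- Principal parts give the vanishing of first cohomology. -/
lemma HasPrincipalParts.firstStructureCohomologyVanishes [NoetherianSpace C]
    (hC : C.HasPrincipalParts) (hdim : topologicalKrullDim C ≤ 1) :
    FirstStructureCohomologyVanishes C := by
  classical
  intro κ U hU s hs
  have hx (x : C) : ∃ i, x ∈ U i := by
    have : x ∈ iSup U := hU ▸ trivial
    simpa using this
  choose i hi using hx
  let σ (j k : κ) : C.functionField :=
    if h : genericPoint C ∈ U j ⊓ U k then
      C.presheaf.germ (U j ⊓ U k) (genericPoint C) h (s j k) else 0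
  have hσ {j k : κ} (h : genericPoint C ∈ U j ⊓ U k) :
      σ j k = C.presheaf.germ (U j ⊓ U k) (genericPoint C) h (s j k) :=
    dif_pos h
  have hσr {j k : κ} {x : C} (h : x ∈ U j ⊓ U k) : σ j k ∈ C.regularAt x := by
    rw [hσ (genericPoint_mem h)]
    exact germ_genericPoint_mem_regularAt h _
  have hσa {j k l : κ} (hj : genericPoint C ∈ U j) (hk : genericPoint C ∈ U k)
      (hl : genericPoint C ∈ U l) : σ j k + σ k l = σ j l := by
    have h : genericPoint C ∈ U j ⊓ U k ⊓ U l := ⟨⟨hj, hk⟩, hl⟩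
    have := congr(C.presheaf.germ (U j ⊓ U k ⊓ U l) (genericPoint C) h $(hs j k l))
    rw [map_add, germ_genericPoint_resSec _ h, germ_genericPoint_resSec _ h,
      germ_genericPoint_resSec _ h] at this
    rwa [hσ ⟨hj, hk⟩, hσ ⟨hk, hl⟩, hσ ⟨hj, hl⟩]
  obtain ⟨t, ht, ht'⟩ := hC.exists_sum (finite_compl_of_genericPoint_mem hdim (hi (genericPoint C)))
    (fun h ↦ h (hi (genericPoint C))) fun x ↦ σ (i (genericPoint C)) (i x)
  have hτ (j : κ) : ∃ τ : Γ(C, U j), ∀ hj : genericPoint C ∈ U j,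
      C.presheaf.germ (U j) (genericPoint C) hj τ = t - σ (i (genericPoint C)) j := by
    by_cases hj : genericPoint C ∈ U j
    · obtain ⟨τ, h⟩ := exists_germ_genericPoint_eq hj (f := t - σ (i (genericPoint C)) j) fun x hx ↦ by
        by_cases hxi : x ∈ U (i (genericPoint C))
        · exact sub_mem (ht x fun h ↦ h hxi) (hσr ⟨hxi, hx⟩)
        · have h := hσa (hi (genericPoint C)) (genericPoint_mem (hi x)) hj
          convert neg_mem (add_mem (ht' x hxi) (hσr (⟨hi x, hx⟩ : x ∈ U (i x) ⊓ U j))) using 1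
          rw [← h]
          ring
      exact ⟨τ, fun _ ↦ h⟩
    · exact ⟨0, fun h ↦ (hj h).elim⟩
  choose τ hτ using hτ
  refine ⟨τ, fun j k ↦ ?_⟩
  by_cases h : genericPoint C ∈ U j ⊓ U k
  · refine germ_injective_of_isIntegral C (genericPoint C) h ?_
    rw [map_sub, germ_genericPoint_resSec _ h, germ_genericPoint_resSec _ h, hτ j h.1, hτ k h.2,
      ← hσ h, ← hσa (hi (genericPoint C)) h.1 h.2]
    ring
  · have := subsingleton_sections_of_genericPoint_notMem h
    exact Subsingleton.elim _ _

end AlgebraicGeometry.Scheme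

lemma finite_quotient_of_isLocalization_away {R A B : Type*} [CommRing R] [CommRing A] [CommRing B]
    [Algebra R A] [Algebra A B] [Algebra R B] [IsScalarTower R A B] (P : Ideal R) [P.IsMaximal]
    (h g : A) [IsLocalization.Away h B]
    [Module.Finite R (A ⧸ (P.map (algebraMap R A) ⊔ Ideal.span {g}))] :
    Module.Finite R (B ⧸ (P.map (algebraMap R B) ⊔ Ideal.span {algebraMap A B g})) := by
  set I := P.map (algebraMap R A) ⊔ Ideal.span {g} with hI
  set J := P.map (algebraMap R B) ⊔ Ideal.span {algebraMap A B g} with hJ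
  have hIJ : I ≤ J.comap (algebraMap A B) := by
    rw [← Ideal.map_le_iff_le_comap, hI, hJ, Ideal.map_sup, Ideal.map_span, Set.image_singleton,
      Ideal.map_map, ← IsScalarTower.algebraMap_eq]
  have hart : IsArtinian A (A ⧸ I) := by
    let : Field (R ⧸ P) := Ideal.Quotient.field P
    let f : R ⧸ P →+* A ⧸ I := Ideal.Quotient.lift P (algebraMap R (A ⧸ I)) fun a ha ↦ by
      rw [IsScalarTower.algebraMap_apply R A]
      exact Ideal.Quotient.eq_zero_iff_mem.mpr
        (Ideal.mem_sup_left (Ideal.mem_map_of_mem (algebraMap R A) ha))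
    let : Algebra (R ⧸ P) (A ⧸ I) := f.toAlgebra
    have : IsScalarTower R (R ⧸ P) (A ⧸ I) := .of_algebraMap_eq fun x ↦ rfl
    have : Module.Finite (R ⧸ P) (A ⧸ I) := .of_restrictScalars_finite R _ _
    have : IsArtinianRing (A ⧸ I) := IsArtinianRing.of_finite (R ⧸ P) _
    exact isArtinian_of_surjective_algebraMap (R := A ⧸ I) Ideal.Quotient.mk_surjective
  let π : A ⧸ I →ₐ[R] B ⧸ J := Ideal.quotientMapₐ J (IsScalarTower.toAlgHom R A B) hIJ
  refine Module.Finite.of_surjective π.toLinearMap fun b ↦ ?_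
  obtain ⟨b, rfl⟩ := Ideal.Quotient.mk_surjective b
  obtain ⟨⟨a, ⟨_, j, rfl⟩⟩, hb⟩ := IsLocalization.surj (Submonoid.powers h) b
  obtain ⟨n, y, hy⟩ := IsArtinian.exists_pow_succ_smul_dvd (M := A ⧸ I) (h ^ j)
    (Ideal.Quotient.mk I a)
  obtain ⟨y, rfl⟩ := Ideal.Quotient.mk_surjective y
  refine ⟨Ideal.Quotient.mk I y, ?_⟩
  change Ideal.Quotient.mk J (algebraMap A B y) = Ideal.Quotient.mk J b
  have hu : IsUnit (algebraMap A B h) := IsLocalization.Away.algebraMap_isUnit h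
  have hu' := ((hu.pow j).pow (n + 1)).map (Ideal.Quotient.mk J)
  have key : Ideal.Quotient.mk J (algebraMap A B ((h ^ j) ^ (n + 1) * y)) =
      Ideal.Quotient.mk J (algebraMap A B ((h ^ j) ^ n * a)) := by
    rw [Ideal.Quotient.eq, ← map_sub]
    apply hIJ
    exact Ideal.Quotient.eq.mp hy
  refine hu'.mul_left_cancel ?_
  simp only [map_mul, map_pow] at key hb ⊢
  rw [key, ← map_pow, ← map_pow, ← map_pow, ← hb, map_mul, map_pow, map_pow]
  ring

lemma not_lt_of_isInducing_quotient {A : Type*} [CommRing A] (I : Ideal A) {F : Type*}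
    [TopologicalSpace F] (hF : topologicalKrullDim F ≤ 1) (j : PrimeSpectrum (A ⧸ I) → F)
    (hj : Topology.IsInducing j) (p₀ p₁ p₂ : Ideal A) (h₀ : p₀.IsPrime) (h₁ : p₁.IsPrime)
    (h₂ : p₂.IsPrime) (hI : I ≤ p₀) (h₀₁ : p₀ < p₁) : ¬ p₁ < p₂ := by
  intro h₁₂
  have hdim : Order.krullDim (PrimeSpectrum (A ⧸ I)) ≤ 1 := by
    have := hj.topologicalKrullDim_le.trans hF
    rwa [PrimeSpectrum.topologicalKrullDim_eq_ringKrullDim] at this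
  have hex (p : Ideal A) (hp : p.IsPrime) (hIp : I ≤ p) :
      ∃ p' : PrimeSpectrum (A ⧸ I), p'.asIdeal.comap (Ideal.Quotient.mk I) = p := by
    refine ⟨⟨p.map (Ideal.Quotient.mk I), Ideal.map_isPrime_of_surjective
      Ideal.Quotient.mk_surjective (by rwa [Ideal.mk_ker])⟩, ?_⟩
    rw [Ideal.comap_map_of_surjective _ Ideal.Quotient.mk_surjective, ← RingHom.ker_eq_comap_bot,
      Ideal.mk_ker, sup_eq_left.mpr hIp]
  obtain ⟨q₀, rfl⟩ := hex p₀ h₀ hI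
  obtain ⟨q₁, rfl⟩ := hex p₁ h₁ (hI.trans h₀₁.le)
  obtain ⟨q₂, rfl⟩ := hex p₂ h₂ (hI.trans (h₀₁.trans h₁₂).le)
  have hle (a b : PrimeSpectrum (A ⧸ I)) :
      a.asIdeal.comap (Ideal.Quotient.mk I) ≤ b.asIdeal.comap (Ideal.Quotient.mk I) ↔ a ≤ b :=
    Ideal.comap_le_comap_iff_of_surjective _ Ideal.Quotient.mk_surjective _ _
  rw [lt_iff_le_not_ge, hle, hle] at h₀₁ h₁₂
  obtain h | h := Order.krullDim_le_one_iff.mp hdim q₁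
  · exact h₀₁.2 (h h₀₁.1)
  · exact h₁₂.2 (h h₁₂.1)

lemma exists_basicOpen_finite_fiber {X Y : Scheme.{0}} (φ : X ⟶ Y) [LocallyOfFiniteType φ]
    {V : Y.Opens} {U : X.Opens} (hV : IsAffineOpen V) (hU : IsAffineOpen U) (hUV : U ≤ φ ⁻¹ᵁ V)
    {y : Y} (hy : y ∈ V) (hyc : IsClosed ({y} : Set Y))
    (hfib : topologicalKrullDim (φ ⁻¹' {y} : Set X) ≤ 1) {x η : X} (hx : x ∈ U) (hη : η ∈ U)
    (hφx : φ x = y) (hφη : φ η = y) (hs : η ⤳ x) (hne : η ≠ x) :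
    ∃ g : Γ(X, U), x ∉ X.basicOpen g ∧ η ∈ X.basicOpen g ∧
      ((Ideal.Quotient.mk ((hV.primeIdealOf ⟨y, hy⟩).asIdeal.map (φ.appLE V U hUV).hom ⊔
        Ideal.span {g})).comp (φ.appLE V U hUV).hom).Finite := by
  let : Algebra Γ(Y, V) Γ(X, U) := (φ.appLE V U hUV).hom.toAlgebra
  have hmap : algebraMap Γ(Y, V) Γ(X, U) = (φ.appLE V U hUV).hom := rfl
  have : Algebra.FiniteType Γ(Y, V) Γ(X, U) := φ.finiteType_appLE hV hU hUV
  set P := (hV.primeIdealOf ⟨y, hy⟩).asIdeal with hP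
  have hPmax : P.IsMaximal := hV.primeIdealOf_isMaximal_of_isClosed ⟨y, hy⟩ hyc
  have hcomap (z : X) (hz : z ∈ U) (hφz : φ z = y) :
      P.map (algebraMap Γ(Y, V) Γ(X, U)) ≤ (hU.primeIdealOf ⟨z, hz⟩).asIdeal := by
    rw [Ideal.map_le_iff_le_comap]
    have := IsAffineOpen.comap_primeIdealOf_appLE V hV U hU hUV hz
    subst hφz
    exact congr($(this).asIdeal).ge
  have hbas (z : X) (hz : z ∈ U) (g : Γ(X, U)) :
      z ∈ X.basicOpen g ↔ g ∉ (hU.primeIdealOf ⟨z, hz⟩).asIdeal := by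
    have := congr((hU.primeIdealOf ⟨z, hz⟩) ∈ $(hU.fromSpec_preimage_basicOpen g))
    rw [eq_iff_iff] at this
    refine Iff.trans ?_ this
    change _ ↔ hU.fromSpec (hU.primeIdealOf ⟨z, hz⟩) ∈ X.basicOpen g
    rw [hU.fromSpec_primeIdealOf]
  have hlt : (hU.primeIdealOf ⟨η, hη⟩).asIdeal < (hU.primeIdealOf ⟨x, hx⟩).asIdeal := by
    refine lt_of_le_of_ne ?_ fun h ↦ hne ?_
    · intro g hg
      by_contra hgx
      exact (hbas η hη g).mp (hs.mem_open (X.basicOpen g).2 ((hbas x hx g).mpr hgx)) hg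
    · have := congrArg hU.fromSpec (PrimeSpectrum.ext h)
      rwa [hU.fromSpec_primeIdealOf, hU.fromSpec_primeIdealOf] at this
  have hch (p₀ p₁ p₂ : Ideal Γ(X, U)) (h₀ : p₀.IsPrime) (h₁ : p₁.IsPrime) (h₂ : p₂.IsPrime)
      (hI : P.map (algebraMap Γ(Y, V) Γ(X, U)) ≤ p₀) (h₀₁ : p₀ < p₁) : ¬ p₁ < p₂ := by
    have hy' (q : PrimeSpectrum (Γ(X, U) ⧸ P.map (algebraMap Γ(Y, V) Γ(X, U)))) :
        φ (hU.fromSpec (PrimeSpectrum.comap (Ideal.Quotient.mk _) q)) = y := by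
      have := congr($(IsAffineOpen.SpecMap_appLE_fromSpec φ hV hU hUV)
        (PrimeSpectrum.comap (Ideal.Quotient.mk _) q))
      refine this.symm.trans ?_
      refine Eq.trans (congrArg hV.fromSpec ?_) (hV.fromSpec_primeIdealOf ⟨y, hy⟩)
      refine PrimeSpectrum.ext (hPmax.eq_of_le
        (PrimeSpectrum.isPrime (PrimeSpectrum.comap (φ.appLE V U hUV).hom
          (PrimeSpectrum.comap (Ideal.Quotient.mk _) q))).ne_top ?_).symm
      intro a ha
      change algebraMap Γ(Y, V) Γ(X, U) a ∈ q.asIdeal.comap (Ideal.Quotient.mk _)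
      rw [Ideal.mem_comap, Ideal.Quotient.eq_zero_iff_mem.mpr (Ideal.mem_map_of_mem _ ha)]
      exact q.asIdeal.zero_mem
    refine not_lt_of_isInducing_quotient _ hfib
      (fun q ↦ ⟨hU.fromSpec (PrimeSpectrum.comap (Ideal.Quotient.mk _) q), hy' q⟩) ?_
      p₀ p₁ p₂ h₀ h₁ h₂ hI h₀₁
    exact Topology.IsInducing.subtypeVal.of_comp_iff.mp <|
      hU.fromSpec.isOpenEmbedding.isInducing.comp
      (PrimeSpectrum.isClosedEmbedding_comap_of_surjective _ _
        Ideal.Quotient.mk_surjective).isInducing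
  obtain ⟨g, hgx, hgη, hg⟩ := exists_mem_notMem_finite_quotient P
    (hU.primeIdealOf ⟨x, hx⟩).asIdeal (hU.primeIdealOf ⟨η, hη⟩).asIdeal (hcomap η hη hφη) hlt hch
  refine ⟨g, fun h ↦ (hbas x hx g).mp h hgx, (hbas η hη g).mpr hgη, ?_⟩
  exact (RingHom.finite_algebraMap (A := Γ(Y, V)) (B := Γ(X, U) ⧸ _)).mpr hg

lemma exists_affine_finite_fiber_mul_pow {X Y C : Scheme.{0}} (φ : X ⟶ Y) [LocallyOfFiniteType φ]
    (ι : C ⟶ X) [IsClosedImmersion ι] [IsIntegral C] (hdim : topologicalKrullDim C ≤ 1)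
    {V : Y.Opens} (hV : IsAffineOpen V) {y : Y} (hy : y ∈ V) (hyc : IsClosed ({y} : Set Y))
    (hfib : topologicalKrullDim (φ ⁻¹' {y} : Set X) ≤ 1) (hι : ∀ q, φ (ι q) = y)
    {p : C} (hp : p ≠ genericPoint C) (f : C.functionField) :
    ∃ (U : X.Opens) (_ : IsAffineOpen U) (hUV : U ≤ φ ⁻¹ᵁ V) (hpU : p ∈ ι ⁻¹ᵁ U) (g b : Γ(X, U))
      (n : ℕ), ι p ∉ X.basicOpen g ∧ ι (genericPoint C) ∈ X.basicOpen g ∧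
      C.presheaf.germ (ι ⁻¹ᵁ U) (genericPoint C) (Scheme.genericPoint_mem hpU) (ι.app U b) =
        f * C.presheaf.germ (ι ⁻¹ᵁ U) (genericPoint C) (Scheme.genericPoint_mem hpU)
          (ι.app U g) ^ n ∧
      ((Ideal.Quotient.mk ((hV.primeIdealOf ⟨y, hy⟩).asIdeal.map (φ.appLE V U hUV).hom ⊔
        Ideal.span {g})).comp (φ.appLE V U hUV).hom).Finite := by
  have hpV : ι p ∈ φ ⁻¹ᵁ V := by
    change φ (ι p) ∈ V
    rwa [hι]
  obtain ⟨U₀, hU₀, hp₀, hUV₀⟩ := exists_isAffineOpen_mem_and_subset hpV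
  replace hUV₀ : U₀ ≤ φ ⁻¹ᵁ V := hUV₀
  have hη₀ : ι (genericPoint C) ∈ U₀ := Scheme.genericPoint_mem (U := ι ⁻¹ᵁ U₀) hp₀
  obtain ⟨g₀, hpg, hηg, hfin⟩ := exists_basicOpen_finite_fiber φ hV hU₀ hUV₀ hy hyc hfib hp₀ hη₀
    (hι _) (hι _) ((genericPoint_specializes p).map ι.continuous)
    fun h ↦ hp (ι.isClosedEmbedding.injective h).symm
  have hp₀' : p ∈ ι ⁻¹ᵁ U₀ := hp₀
  have ha : C.presheaf.germ (ι ⁻¹ᵁ U₀) p hp₀' (ι.app U₀ g₀) ∈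
      IsLocalRing.maximalIdeal (C.presheaf.stalk p) := by
    rw [IsLocalRing.mem_maximalIdeal, mem_nonunits_iff, ← C.mem_basicOpen,
      ← Scheme.preimage_basicOpen]
    exact hpg
  obtain ⟨n, hn⟩ := Scheme.exists_mul_pow_mem_regularAt hdim f ha
  rw [Scheme.algebraMap_germ_eq_germ_genericPoint] at hn
  obtain ⟨W, hpW, s, hs⟩ := Scheme.exists_germ_genericPoint_eq_of_mem_regularAt hn
  obtain ⟨O, hO, hOW⟩ := ι.isClosedEmbedding.isInducing.isOpen_iff.mp W.2
  obtain ⟨h, hhO, hph⟩ := hU₀.exists_basicOpen_le (V := ⟨O, hO⟩) ⟨ι p, by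
    change p ∈ ι ⁻¹' O
    rw [hOW]; exact hpW⟩ hp₀
  have hUU : X.basicOpen h ≤ U₀ := X.basicOpen_le h
  have hW : ι ⁻¹ᵁ X.basicOpen h ≤ W := fun q hq ↦ by
    have : q ∈ ι ⁻¹' O := hhO hq
    rwa [hOW] at this
  obtain ⟨b, hb⟩ := ι.app_surjective _ (hU₀.basicOpen h) (resSec C _ W hW s)
  have hpU : p ∈ ι ⁻¹ᵁ X.basicOpen h := hph
  have hηU := Scheme.genericPoint_mem hpU
  refine ⟨X.basicOpen h, hU₀.basicOpen h, hUU.trans hUV₀, hpU, resSec X _ U₀ hUU g₀, b, n,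
    ?_, ?_, ?_, ?_⟩
  · rw [basicOpen_resSec]
    exact fun h ↦ hpg h.2
  · rw [basicOpen_resSec]
    exact ⟨hηU, hηg⟩
  · rw [hb, Scheme.germ_genericPoint_resSec, hs]
    congr 2
    rw [Scheme.Hom.app_eq_appLE ι (U := X.basicOpen h), appLE_map_resSec,
      Scheme.germ_genericPoint_appLE]
  · let : Algebra Γ(Y, V) Γ(X, U₀) := (φ.appLE V U₀ hUV₀).hom.toAlgebra
    let : Algebra Γ(Y, V) Γ(X, X.basicOpen h) :=
      (φ.appLE V (X.basicOpen h) (hUU.trans hUV₀)).hom.toAlgebra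
    have hres (a : Γ(X, U₀)) : algebraMap Γ(X, U₀) Γ(X, X.basicOpen h) a = resSec X _ U₀ hUU a :=
      rfl
    have : IsScalarTower Γ(Y, V) Γ(X, U₀) Γ(X, X.basicOpen h) := .of_algebraMap_eq fun r ↦ by
      rw [hres]
      exact (appLE_resSec φ hUV₀ hUU r).symm
    have := hU₀.isLocalization_basicOpen h
    have hPmax : (hV.primeIdealOf ⟨y, hy⟩).asIdeal.IsMaximal :=
      hV.primeIdealOf_isMaximal_of_isClosed ⟨y, hy⟩ hyc
    have : Module.Finite Γ(Y, V) (Γ(X, U₀) ⧸ ((hV.primeIdealOf ⟨y, hy⟩).asIdeal.map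
      (algebraMap Γ(Y, V) Γ(X, U₀)) ⊔ Ideal.span {g₀})) := hfin
    exact (RingHom.finite_algebraMap (A := Γ(Y, V)) (B := Γ(X, X.basicOpen h) ⧸ _)).mpr
      (finite_quotient_of_isLocalization_away (hV.primeIdealOf ⟨y, hy⟩).asIdeal h g₀)

lemma CategoryTheory.IsPullback.comp_mono {𝒞 : Type*} [Category* 𝒞] {P X Y Z W : 𝒞} {fst : P ⟶ X}
    {snd : P ⟶ Y} {f : X ⟶ Z} {g : Y ⟶ Z} (h : IsPullback fst snd f g) (i : Z ⟶ W) [Mono i] :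
    IsPullback fst snd (f ≫ i) (g ≫ i) :=
  .of_isLimit' ⟨by rw [reassoc_of% h.w]⟩
    (Limits.PullbackCone.isLimitOfCompMono _ _ i _ h.isLimit)

open TensorProduct in
lemma exists_isOpenImmersion_SpecMap_tensorProduct {X Y : Scheme.{0}} (φ : X ⟶ Y)
    {V : Y.Opens} {U : X.Opens} (hV : IsAffineOpen V) (hU : IsAffineOpen U) (hUV : U ≤ φ ⁻¹ᵁ V)
    {R' : Type} [CommRing R'] [Algebra Γ(Y, V) R'] [Algebra Γ(Y, V) Γ(X, U)]
    (halg : algebraMap Γ(Y, V) Γ(X, U) = (φ.appLE V U hUV).hom) {X' : Scheme.{0}} {g : X' ⟶ X}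
    {φ' : X' ⟶ Spec (.of R')}
    (H : IsPullback g φ' φ (Spec.map (CommRingCat.ofHom (algebraMap Γ(Y, V) R')) ≫ hV.fromSpec)) :
    ∃ j : Spec (.of (R' ⊗[Γ(Y, V)] Γ(X, U))) ⟶ X', IsOpenImmersion j ∧
      j ≫ φ' = Spec.map (CommRingCat.ofHom (algebraMap R' (R' ⊗[Γ(Y, V)] Γ(X, U)))) ∧
      j ≫ g = Spec.map (CommRingCat.ofHom (Algebra.TensorProduct.includeRight :
        Γ(X, U) →ₐ[Γ(Y, V)] R' ⊗[Γ(Y, V)] Γ(X, U)).toRingHom) ≫ hU.fromSpec ∧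
      ∀ z, g z ∈ U → z ∈ Set.range j := by
  have h₁ := isPullback_SpecMap_of_isPushout _ _ _ _
    (CommRingCat.isPushout_tensorProduct Γ(Y, V) R' Γ(X, U)).flip
  have h₂ := h₁.comp_mono hV.fromSpec
  have h₃ : Spec.map (CommRingCat.ofHom (algebraMap Γ(Y, V) Γ(X, U))) ≫ hV.fromSpec =
      hU.fromSpec ≫ φ := by
    rw [halg]
    exact IsAffineOpen.SpecMap_appLE_fromSpec φ hV hU hUV
  rw [h₃] at h₂
  have h₄ := IsPullback.of_bot' h₂ H
  refine ⟨_, MorphismProperty.of_isPullback h₄ inferInstance, H.lift_snd _ _ _, H.lift_fst _ _ _,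
    fun z hz ↦ ?_⟩
  rw [← SetLike.mem_coe, ← hU.range_fromSpec] at hz
  obtain ⟨a, ha⟩ := hz
  obtain ⟨b, -, hb⟩ := Scheme.exists_preimage_of_isPullback h₄ a z ha
  exact ⟨b, hb⟩

lemma exists_lift_Spec {C Y : Scheme.{0}} (κ : C ⟶ Y) {V : Y.Opens} (hV : IsAffineOpen V)
    (hκ : κ ⁻¹ᵁ V = ⊤) {R' : Type} [CommRing R'] [Algebra Γ(Y, V) R'] (χ : R' →+* Γ(C, ⊤))
    (hχ : χ.comp (algebraMap Γ(Y, V) R') = (κ.appLE V ⊤ hκ.ge).hom) (P' : PrimeSpectrum R')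
    (h₀ : ∀ r ∈ P'.asIdeal, χ r = 0) (h₁ : ∀ r ∉ P'.asIdeal, IsUnit (χ r)) :
    ∃ κ' : C ⟶ Spec (.of R'),
      κ' ≫ Spec.map (CommRingCat.ofHom (algebraMap Γ(Y, V) R')) ≫ hV.fromSpec = κ ∧
      ∀ c, κ' c = P' := by
  refine ⟨C.topIso.inv ≫ (⊤ : C.Opens).toSpecΓ ≫ Spec.map (CommRingCat.ofHom χ), ?_, fun c ↦ ?_⟩
  · have : CommRingCat.ofHom (algebraMap Γ(Y, V) R') ≫ CommRingCat.ofHom χ =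
        κ.appLE V ⊤ hκ.ge := by
      ext1; exact hχ
    rw [Category.assoc, Category.assoc, ← Spec.map_comp_assoc, this,
      Scheme.Opens.toSpecΓ_SpecMap_appLE_assoc, hV.toSpecΓ_fromSpec, Scheme.Hom.resLE_comp_ι]
    simp
  · set 𝔠 : PrimeSpectrum Γ(C, ⊤) := (⊤ : C.Opens).toSpecΓ (C.topIso.inv c)
    change PrimeSpectrum.comap χ 𝔠 = P'
    ext r
    change χ r ∈ 𝔠.asIdeal ↔ _
    refine ⟨fun hr ↦ ?_, fun hr ↦ ?_⟩
    · by_contra h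
      exact 𝔠.isPrime.ne_top (Ideal.eq_top_of_isUnit_mem _ hr (h₁ r h))
    · rw [h₀ r hr]; exact 𝔠.asIdeal.zero_mem

open TensorProduct in
/-- An étale neighbourhood of a point of the base over which an isolated point of a fibre of
`V(g)` is separated from the rest of `V(g)`: the base change of `X` is the union of two open sets,
on the first of which `g` makes sense and on whose intersection `g` is invertible. -/
lemma exists_flat_separating_cover {X Y : Scheme.{0}} (φ : X ⟶ Y) [IsSeparated φ] [QuasiCompact φ]
    [LocallyOfFiniteType φ] {V : Y.Opens} {U : X.Opens} (hV : IsAffineOpen V) (hU : IsAffineOpen U)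
    (hUV : U ≤ φ ⁻¹ᵁ V) {y : Y} (hy : y ∈ V) (hyc : IsClosed ({y} : Set Y)) (g : Γ(X, U)) {x : X}
    (hx : x ∈ U) (hφx : φ x = y) (hgx : x ∉ X.basicOpen g)
    (hfin : ((Ideal.Quotient.mk ((hV.primeIdealOf ⟨y, hy⟩).asIdeal.map (φ.appLE V U hUV).hom ⊔
        Ideal.span {g})).comp (φ.appLE V U hUV).hom).Finite) :
    ∃ (X' Y' : Scheme.{0}) (π : X' ⟶ X) (φ' : X' ⟶ Y') (f : Y' ⟶ Y) (y' : Y'),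
      IsPullback π φ' φ f ∧ Flat f ∧ IsAffine Y' ∧ f ⁻¹ᵁ V = ⊤ ∧
      (∀ (C : Scheme.{0}) (κ : C ⟶ Y) (hκ : κ ⁻¹ᵁ V = ⊤),
        (hV.primeIdealOf ⟨y, hy⟩).asIdeal ≤ RingHom.ker (κ.appLE V ⊤ hκ.ge).hom →
        ∃ κ' : C ⟶ Y', κ' ≫ f = κ ∧ ∀ c, κ' c = y') ∧
      ∃ W₀ W₁ : X'.Opens, IsCompact (W₀ : Set X') ∧ IsCompact (W₁ : Set X') ∧ W₀ ⊔ W₁ = ⊤ ∧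
        W₀ ⊓ W₁ ≤ π ⁻¹ᵁ X.basicOpen g ∧ (∀ z, φ' z = y' → π z = x → z ∈ W₀) ∧
        ∀ z, φ' z = y' → z ∉ W₁ → π z = x := by
  let : Algebra Γ(Y, V) Γ(X, U) := (φ.appLE V U hUV).hom.toAlgebra
  have hmap : algebraMap Γ(Y, V) Γ(X, U) = (φ.appLE V U hUV).hom := rfl
  have : Algebra.FiniteType Γ(Y, V) Γ(X, U) := φ.finiteType_appLE hV hU hUV
  set P := (hV.primeIdealOf ⟨y, hy⟩).asIdeal with hP
  have hPmax : P.IsMaximal := hV.primeIdealOf_isMaximal_of_isClosed ⟨y, hy⟩ hyc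
  have : Module.Finite Γ(Y, V) (Γ(X, U) ⧸ (P.map (algebraMap Γ(Y, V) Γ(X, U)) ⊔ Ideal.span {g})) :=
    hfin
  have : (hU.primeIdealOf ⟨x, hx⟩).asIdeal.LiesOver P := ⟨by
    subst hφx
    exact congr($(IsAffineOpen.comap_primeIdealOf_appLE V hV U hU hUV hx).asIdeal).symm⟩
  have hbas (p : Spec Γ(X, U)) : hU.fromSpec p ∈ X.basicOpen g ↔ g ∉ p.asIdeal :=
    eq_iff_iff.mp congr(p ∈ $(hU.fromSpec_preimage_basicOpen g))
  have hgq : g ∈ (hU.primeIdealOf ⟨x, hx⟩).asIdeal := by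
    by_contra h
    have := (hbas _).mpr h
    rw [hU.fromSpec_primeIdealOf] at this
    exact hgx this
  obtain ⟨R', _, _, P', hP', hflat, hlift, e, T, _, _, ψ, hfinT, hψ, hker, he, hsep⟩ :=
    exists_flat_finite_separating P (hU.primeIdealOf ⟨x, hx⟩).asIdeal g hgq
  have hx' : hU.fromSpec (hU.primeIdealOf ⟨x, hx⟩) = x := hU.fromSpec_primeIdealOf ⟨x, hx⟩
  let f := Spec.map (CommRingCat.ofHom (algebraMap Γ(Y, V) R')) ≫ hV.fromSpec
  let φ' := Limits.pullback.snd φ f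
  let π := Limits.pullback.fst φ f
  have H : IsPullback π φ' φ f := .of_hasPullback _ _
  obtain ⟨j, hj, hjφ, hjπ, hjr⟩ := exists_isOpenImmersion_SpecMap_tensorProduct φ hV hU hUV hmap H
  have hjφ' (p) : (φ' (j p) : Spec (.of R')).asIdeal = p.asIdeal.comap (algebraMap R' _) := by
    have := congr($hjφ p)
    exact congrArg PrimeSpectrum.asIdeal this
  have hjπ' (p) : π (j p) = hU.fromSpec (PrimeSpectrum.comap (Algebra.TensorProduct.includeRight :
        Γ(X, U) →ₐ[Γ(Y, V)] R' ⊗[Γ(Y, V)] Γ(X, U)).toRingHom p) := congr($hjπ p)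
  let k : Spec (.of T) ⟶ Spec (.of (R' ⊗[Γ(Y, V)] Γ(X, U))) :=
    Spec.map (CommRingCat.ofHom ψ.toRingHom)
  have hkjφ : (k ≫ j) ≫ φ' = Spec.map (CommRingCat.ofHom (algebraMap R' T)) := by
    rw [Category.assoc, hjφ, ← Spec.map_comp]
    congr 1
    ext r
    exact ψ.commutes r
  have hfinite : IsFinite ((k ≫ j) ≫ φ') := by
    rw [hkjφ, IsFinite.SpecMap_iff]
    exact RingHom.finite_algebraMap.mpr hfinT
  have hclosed : UniversallyClosed (k ≫ j) := .of_comp_of_isSeparated (k ≫ j) φ'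
  have hD : IsClosed (Set.range (k ≫ j)) := (k ≫ j).isClosedMap.isClosed_range
  have hDj (p : Spec (.of (R' ⊗[Γ(Y, V)] Γ(X, U)))) :
      j p ∈ Set.range (k ≫ j) ↔ 1 ⊗ₜ g ∈ p.asIdeal ∧ e ∉ p.asIdeal := by
    rw [← hker _ p.isPrime]
    have hr := range_comap_of_surjective _ ψ.toRingHom hψ
    have : p ∈ Set.range k ↔ RingHom.ker ψ ≤ p.asIdeal := iff_of_eq congr(p ∈ $hr)
    refine Iff.trans ?_ this
    constructor
    · rintro ⟨t, ht⟩
      exact ⟨t, j.isOpenEmbedding.injective ht⟩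
    · rintro ⟨t, rfl⟩
      exact ⟨t, rfl⟩
  have hDU : Set.range (k ≫ j) ⊆ Set.range j := by
    rintro _ ⟨t, rfl⟩
    exact ⟨k t, rfl⟩
  have hjU (p) : π (j p) ∈ U := by
    rw [hjπ', ← SetLike.mem_coe, ← hU.range_fromSpec]
    exact Set.mem_range_self _
  let W₀ : (Limits.pullback φ f).Opens := j ''ᵁ PrimeSpectrum.basicOpen e
  let W₁ : (Limits.pullback φ f).Opens := ⟨(Set.range (k ≫ j))ᶜ, hD.isOpen_compl⟩
  have hW₀ (p) : j p ∈ W₀ ↔ e ∉ p.asIdeal := by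
    refine ⟨?_, fun h ↦ ⟨p, h, rfl⟩⟩
    rintro ⟨p', hp', h⟩
    rwa [← j.isOpenEmbedding.injective h]
  have hW₁ (z) : z ∈ W₁ ↔ z ∉ Set.range (k ≫ j) := Iff.rfl
  have hW₀₁ : W₀ ⊓ W₁ = j ''ᵁ PrimeSpectrum.basicOpen (e * (1 ⊗ₜ g)) := by
    ext z
    constructor
    · rintro ⟨⟨p, hp, rfl⟩, hz⟩
      refine ⟨p, ?_, rfl⟩
      change e * (1 ⊗ₜ g) ∉ p.asIdeal
      exact fun h ↦ (p.isPrime.mem_or_mem h).elim hp fun h ↦ hz ((hDj p).mpr ⟨h, hp⟩)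
    · rintro ⟨p, hp, rfl⟩
      exact ⟨(hW₀ p).mpr fun h ↦ hp (Ideal.mul_mem_right _ _ h),
        fun h ↦ hp (Ideal.mul_mem_left _ _ ((hDj p).mp h).1)⟩
  have hX' : CompactSpace ↥(Limits.pullback φ f) := by
    have : QuasiCompact φ' := inferInstanceAs (QuasiCompact (Limits.pullback.snd φ f))
    exact QuasiCompact.compactSpace_of_compactSpace φ'
  refine ⟨_, _, π, φ', f, ⟨P', hP'⟩, H, ?_, inferInstance, ?_, fun C κ hκ hk ↦ ?_, W₀, W₁, ?_, ?_,
    ?_, ?_, ?_, ?_⟩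
  · have : Flat (Spec.map (CommRingCat.ofHom (algebraMap Γ(Y, V) R'))) :=
      Flat.SpecMap_iff.mpr (RingHom.flat_algebraMap_iff.mpr hflat)
    infer_instance
  · change Spec.map _ ⁻¹ᵁ (hV.fromSpec ⁻¹ᵁ V) = ⊤
    rw [hV.fromSpec_preimage_self]
    rfl
  · obtain ⟨χ, hχ, h₀, h₁⟩ := hlift Γ(C, ⊤) _ hk
    exact exists_lift_Spec κ hV hκ χ hχ ⟨P', hP'⟩ h₀ h₁
  · exact (PrimeSpectrum.isCompact_basicOpen e).image j.continuous
  · have h : (W₁ : Set ↥(Limits.pullback φ f)) = ↑(W₀ ⊓ W₁) ∪ (↑W₀)ᶜ := by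
      ext z
      constructor
      · intro hz
        by_cases hz' : z ∈ W₀
        exacts [Or.inl ⟨hz', hz⟩, Or.inr hz']
      · rintro (hz | hz)
        · exact hz.2
        · intro hzD
          obtain ⟨p, rfl⟩ := hDU hzD
          exact hz ((hW₀ p).mpr ((hDj p).mp hzD).2)
    rw [h, hW₀₁]
    exact ((PrimeSpectrum.isCompact_basicOpen _).image j.continuous).union
      W₀.isOpen.isClosed_compl.isCompact
  · refine eq_top_iff.mpr fun z _ ↦ ?_
    by_cases hz : z ∈ W₁
    · exact Or.inr hz
    · obtain ⟨p, rfl⟩ := hDU (not_not.mp hz)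
      exact Or.inl ((hW₀ p).mpr ((hDj p).mp (not_not.mp hz)).2)
  · rw [hW₀₁]
    rintro _ ⟨p, hp, rfl⟩
    have : π (j p) ∈ X.basicOpen g := by
      rw [hjπ']
      exact (hbas _).mpr fun h ↦ hp (Ideal.mul_mem_left _ _ h)
    exact this
  · intro z hz hzx
    obtain ⟨p, rfl⟩ := hjr z (show π z ∈ U by rwa [hzx])
    refine (hW₀ p).mpr (he _ p.isPrime ?_ ?_)
    · rw [← hjφ', hz]
    · exact congrArg PrimeSpectrum.asIdeal (hU.fromSpec.isOpenEmbedding.injective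
        ((hjπ' p).symm.trans (hzx.trans hx'.symm)))
  · intro z hz hzW
    obtain ⟨p, rfl⟩ := hDU (not_not.mp hzW)
    have hp := (hDj p).mp (not_not.mp hzW)
    refine (hjπ' p).trans (Eq.trans (congrArg hU.fromSpec
      (PrimeSpectrum.ext (hsep _ p.isPrime ?_ hp.1 hp.2))) hx')
    rw [← hjφ', hz]

namespace AlgebraicGeometry.Scheme

lemma germ_app_resSec {C X : Scheme.{u}} (c : C ⟶ X) {V U : X.Opens} (h : V ≤ U) {x : C}
    (hx : x ∈ c ⁻¹ᵁ V) (s : Γ(X, U)) :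
    C.presheaf.germ (c ⁻¹ᵁ V) x hx (c.app V (resSec X V U h s)) =
      C.presheaf.germ (c ⁻¹ᵁ U) x (h hx) (c.app U s) := by
  have := congr($(c.naturality (homOfLE h).op) s)
  simp only [CommRingCat.comp_apply] at this
  rw [resSec, this]
  exact C.presheaf.germ_res_apply _ _ _ _

lemma exists_principal_part_of_mul_eq_sub {C X : Scheme.{u}} [IsIntegral C] (c : C ⟶ X)
    {W₀ W₁ : X.Opens} (σ : Γ(X, W₀ ⊓ W₁)) (ρ : Γ(X, ⊤)) (τ₀ : Γ(X, W₀)) (τ₁ : Γ(X, W₁))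
    (h : resSec X _ _ le_top ρ * σ = resSec X _ _ inf_le_left τ₀ - resSec X _ _ inf_le_right τ₁)
    (hρ : ∀ q, c q ∈ X.basicOpen ρ) {p : C} (hp₀ : p ∈ c ⁻¹ᵁ W₀)
    (hp₁ : ∀ q ≠ p, q ∈ c ⁻¹ᵁ W₁) (hη : genericPoint C ∈ c ⁻¹ᵁ (W₀ ⊓ W₁)) :
    ∃ t, (∀ q ≠ p, t ∈ C.regularAt q) ∧
      C.presheaf.germ (c ⁻¹ᵁ (W₀ ⊓ W₁)) _ hη (c.app _ σ) - t ∈ C.regularAt p := by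
  have hb (q) : q ∈ C.basicOpen (c.app ⊤ ρ) := by
    rw [← preimage_basicOpen]; exact hρ q
  have hne : c.app ⊤ ρ ≠ 0 := by
    intro h
    have := hb p
    rw [h, basicOpen_zero] at this
    exact this
  have h₀ : genericPoint C ∈ c ⁻¹ᵁ W₀ := hη.1
  have h₁ : genericPoint C ∈ c ⁻¹ᵁ W₁ := hη.2
  have ht : genericPoint C ∈ c ⁻¹ᵁ ⊤ := trivial
  have key := congr(C.presheaf.germ (c ⁻¹ᵁ (W₀ ⊓ W₁)) _ hη (c.app _ $h))
  rw [map_mul, map_mul, map_sub, map_sub, germ_app_resSec, germ_app_resSec, germ_app_resSec] at key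
  have hr (q : C) : C.presheaf.germ (c ⁻¹ᵁ ⊤) _ ht (c.app ⊤ ρ) ∈ C.regularAt q :=
    germ_genericPoint_mem_regularAt (show q ∈ c ⁻¹ᵁ ⊤ from trivial) _
  have hr' (q : C) : (C.presheaf.germ (c ⁻¹ᵁ ⊤) _ ht (c.app ⊤ ρ))⁻¹ ∈ C.regularAt q :=
    (isUnit_germ_iff_inv_mem_regularAt (show q ∈ c ⁻¹ᵁ ⊤ from trivial) _ hne).mp (hb q)
  have hu : C.presheaf.germ (c ⁻¹ᵁ ⊤) _ ht (c.app ⊤ ρ) ≠ 0 := by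
    intro h
    exact hne (germ_injective_of_isIntegral C _ ht (h.trans (map_zero _).symm))
  refine ⟨-(C.presheaf.germ (c ⁻¹ᵁ W₁) _ h₁ (c.app _ τ₁)) *
    (C.presheaf.germ (c ⁻¹ᵁ ⊤) _ ht (c.app ⊤ ρ))⁻¹, fun q hq ↦ ?_, ?_⟩
  · exact mul_mem (neg_mem (germ_genericPoint_mem_regularAt (hp₁ q hq) _)) (hr' q)
  · have : C.presheaf.germ (c ⁻¹ᵁ (W₀ ⊓ W₁)) _ hη (c.app _ σ) -
        -(C.presheaf.germ (c ⁻¹ᵁ W₁) _ h₁ (c.app _ τ₁)) *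
          (C.presheaf.germ (c ⁻¹ᵁ ⊤) _ ht (c.app ⊤ ρ))⁻¹ =
        C.presheaf.germ (c ⁻¹ᵁ W₀) _ h₀ (c.app _ τ₀) *
          (C.presheaf.germ (c ⁻¹ᵁ ⊤) _ ht (c.app ⊤ ρ))⁻¹ := by
      field_simp
      linear_combination key
    rw [this]
    exact mul_mem (germ_genericPoint_mem_regularAt hp₀ _) (hr' p)

end AlgebraicGeometry.Scheme

namespace AlgebraicGeometry.Scheme

lemma germ_app_appLE {C X' X : Scheme.{u}} {c : C ⟶ X'} {π : X' ⟶ X} {ι : C ⟶ X} (hι : c ≫ π = ι)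
    {U : X.Opens} {W : X'.Opens} (h : W ≤ π ⁻¹ᵁ U) {x : C} (hx : x ∈ c ⁻¹ᵁ W) (hx' : x ∈ ι ⁻¹ᵁ U)
    (s : Γ(X, U)) :
    C.presheaf.germ (c ⁻¹ᵁ W) x hx (c.app W (π.appLE U W h s)) =
      C.presheaf.germ (ι ⁻¹ᵁ U) x hx' (ι.app U s) := by
  subst hι
  have : π.appLE U W h s = resSec X' W (π ⁻¹ᵁ U) h (π.app U s) := by
    rw [Scheme.Hom.appLE, CommRingCat.comp_apply]; rfl
  rw [this, germ_app_resSec]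
  congr 1

lemma exists_mul_resSec_pow_eq {X : Scheme.{u}} {U : X.Opens} (g b : Γ(X, U)) (n : ℕ) :
    ∃ β : Γ(X, X.basicOpen g), β * resSec X _ _ (X.basicOpen_le g) g ^ n =
      resSec X _ _ (X.basicOpen_le g) b := by
  have h : IsUnit (resSec X _ _ (X.basicOpen_le g) g) := RingedSpace.isUnit_res_basicOpen _ g
  obtain ⟨v, hv⟩ := h.pow n
  exact ⟨resSec X _ _ (X.basicOpen_le g) b * ↑v⁻¹, by rw [← hv, Units.inv_mul_cancel_right]⟩

end AlgebraicGeometry.Scheme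

open Scheme in
/-- If `φ` contracts the curve `C` to a point, has fibres of dimension at most `1` and satisfies
`R¹φ_* O_X = 0`, then the sheaf of principal parts on `C` has all its sections induced by
rational functions. -/
lemma FirstDirectImageVanishes.hasPrincipalParts {X Y C : Scheme.{0}} {φ : X ⟶ Y} [IsProper φ]
    [Surjective φ] [IsIntegral X] (hR1 : FirstDirectImageVanishes φ) (ι : C ⟶ X)
    [IsClosedImmersion ι] [IsIntegral C] (hdim : topologicalKrullDim C ≤ 1) {y : Y}
    (hyc : IsClosed ({y} : Set Y)) (hfib : topologicalKrullDim (φ ⁻¹' {y} : Set X) ≤ 1)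
    (hι : ∀ q, φ (ι q) = y) : HasPrincipalParts C := by
  intro p hp f
  obtain ⟨V, hV, hy, -⟩ := exists_isAffineOpen_mem_and_subset (U := ⊤) (x := y) trivial
  obtain ⟨U, hU, hUV, hpU, g, b, n, hpg, hηg, hb, hfin⟩ :=
    exists_affine_finite_fiber_mul_pow φ ι hdim hV hy hyc hfib hι hp f
  obtain ⟨X', Y', π, φ', e, y', H, _, _, heV, hlift, W₀, W₁, hW₀, hW₁, hcov, hinf, h₀, h₁⟩ :=
    exists_flat_separating_cover φ hV hU hUV hy hyc g hpU (hι p) hpg hfin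
  have hκ : (ι ≫ φ) ⁻¹ᵁ V = ⊤ := by
    refine eq_top_iff.mpr fun q _ ↦ ?_
    have : φ (ι q) ∈ V := by rwa [hι]
    exact this
  obtain ⟨κ, hκe, hκy⟩ := hlift C (ι ≫ φ) hκ fun r hr ↦ by
    rw [RingHom.mem_ker, ← basicOpen_eq_bot_iff]
    refine eq_bot_iff.mpr fun q hq ↦ ?_
    rw [basicOpen_appLE] at hq
    have hq' : φ (ι q) ∈ Y.basicOpen r := hq.2
    have hyV : hV.fromSpec (hV.primeIdealOf ⟨y, hy⟩) = y := hV.fromSpec_primeIdealOf ⟨y, hy⟩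
    rw [hι, ← hyV] at hq'
    exact (iff_of_eq congr(_ ∈ $(hV.fromSpec_preimage_basicOpen r))).mp hq' hr
  let c := H.lift ι κ hκe.symm
  have hcπ : c ≫ π = ι := H.lift_fst _ _ _
  have hcφ : c ≫ φ' = κ := H.lift_snd _ _ _
  have hcφ' (q) : φ' (c q) = y' := by rw [← hκy q, ← hcφ]; rfl
  have hcπ' (q) : π (c q) = ι q := by rw [← hcπ]; rfl
  have hp₀ : p ∈ c ⁻¹ᵁ W₀ := h₀ _ (hcφ' p) (hcπ' p)
  have hp₁ (q) (hq : q ≠ p) : q ∈ c ⁻¹ᵁ W₁ := by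
    by_contra h
    exact hq (ι.isClosedEmbedding.injective ((hcπ' q).symm.trans (h₁ _ (hcφ' q) h)))
  have hη : genericPoint C ∈ c ⁻¹ᵁ (W₀ ⊓ W₁) := ⟨genericPoint_mem hp₀, hp₁ _ hp.symm⟩
  obtain ⟨β, hβ⟩ := exists_mul_resSec_pow_eq g b n
  have hηg' : genericPoint C ∈ ι ⁻¹ᵁ X.basicOpen g := hηg
  obtain ⟨r, hr, τ₀, τ₁, hτ⟩ := hR1.exists_mul_eq_sub H hV heV hW₀ hW₁ hcov
    (π.appLE _ _ hinf β) y'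
  obtain ⟨t, ht, hft⟩ := exists_principal_part_of_mul_eq_sub c (π.appLE _ _ hinf β)
    (φ'.appTop r) τ₀ τ₁ hτ (fun q ↦ by
      have : φ' (c q) ∈ Y'.basicOpen r := by rwa [hcφ']
      rw [← Scheme.preimage_basicOpen_top]
      exact this) hp₀ hp₁ hη
  refine ⟨t, ht, ?_⟩
  rw [germ_app_appLE hcπ hinf hη hηg'] at hft
  convert hft using 2
  have hg : C.presheaf.germ (ι ⁻¹ᵁ U) (genericPoint C) (genericPoint_mem hpU) (ι.app U g) ≠ 0 := by
    intro h0
    have h1 : ι.app U g = 0 :=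
      germ_injective_of_isIntegral C _ (genericPoint_mem hpU) (h0.trans (map_zero _).symm)
    have h2 : genericPoint C ∈ C.basicOpen (ι.app U g) := by
      rw [← preimage_basicOpen]; exact hηg
    rw [h1, basicOpen_zero] at h2
    exact h2
  have := congr(C.presheaf.germ _ _ hηg' (ι.app _ $hβ))
  rw [map_mul, map_pow, map_mul, map_pow, germ_app_resSec, germ_app_resSec, hb] at this
  exact (mul_right_cancel₀ (pow_ne_zero n hg) this).symm

namespace AlgebraicGeometry.Scheme

variable {C : Scheme.{u}} {k : Type u} [Field k]

/-- The global function on a scheme over a field given by a constant. -/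
noncomputable def const (f : C ⟶ Spec (.of k)) : k →+* Γ(C, ⊤) :=
  ((ΓSpecIso (.of k)).inv ≫ f.appTop).hom

lemma fromSpecStalk_eq_SpecMap_const (f : C ⟶ Spec (.of k)) (x : C) :
    C.fromSpecStalk x ≫ f = Spec.map (CommRingCat.ofHom (const f) ≫ C.presheaf.germ ⊤ x trivial) := by
  have h : f = C.toSpecΓ ≫ Spec.map (CommRingCat.ofHom (const f)) := by
    change f = C.toSpecΓ ≫ Spec.map ((ΓSpecIso (.of k)).inv ≫ f.appTop)
    rw [Spec.map_comp, ← toSpecΓ_naturality_assoc, toSpecΓ_SpecMap_ΓSpecIso_inv, Category.comp_id]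
  conv_lhs => rw [h]
  rw [fromSpecStalk_toSpecΓ_assoc, Spec.map_comp]

lemma exists_germ_const_sub_mem_maximalIdeal [IsAlgClosed k] (f : C ⟶ Spec (.of k))
    [LocallyOfFiniteType f] {x : C} (hx : IsClosed {x}) (a : C.presheaf.stalk x) :
    ∃ c : k, a - C.presheaf.germ ⊤ x trivial (const f c) ∈
      IsLocalRing.maximalIdeal (C.presheaf.stalk x) := by
  have h := SpecMap_residueFieldIsoBase_inv f x hx
  have h' : (residueFieldIsoBase f x hx).inv =
      CommRingCat.ofHom (const f) ≫ C.presheaf.germ ⊤ x trivial ≫ C.residue x := by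
    apply Spec.map_injective
    rw [h, fromSpecResidueField, Category.assoc, fromSpecStalk_eq_SpecMap_const, ← Spec.map_comp,
      Category.assoc]
  refine ⟨(residueFieldIsoBase f x hx).hom (C.residue x a), ?_⟩
  have h2 := congr($h' ((residueFieldIsoBase f x hx).hom (C.residue x a)))
  rw [← CommRingCat.comp_apply, Iso.hom_inv_id] at h2
  rw [← IsLocalRing.residue_eq_zero_iff, map_sub, sub_eq_zero]
  exact h2

variable [IsIntegral C]

/-- The constant functions as rational functions. -/
noncomputable def ratConst (f : C ⟶ Spec (.of k)) : k →+* C.functionField :=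
  (C.presheaf.germ ⊤ (genericPoint C) trivial).hom.comp (const f)

lemma ratConst_mem_regularAt (f : C ⟶ Spec (.of k)) (c : k) (x : C) :
    ratConst f c ∈ C.regularAt x :=
  germ_genericPoint_mem_regularAt (U := ⊤) trivial _

lemma exists_ratConst_eq_of_forall_mem_regularAt [IsAlgClosed k] (f : C ⟶ Spec (.of k))
    [UniversallyClosed f] {t : C.functionField} (ht : ∀ x, t ∈ C.regularAt x) :
    ∃ c, ratConst f c = t := by
  obtain ⟨s, rfl⟩ := exists_germ_genericPoint_eq (U := ⊤) trivial fun x _ ↦ ht x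
  have h_integral : (const f).IsIntegral := by
    apply RingHom.isIntegral_respectsIso.2 (e := (Scheme.ΓSpecIso _).symm.commRingCatIsoToRingEquiv)
    exact isIntegral_appTop_of_universallyClosed f
  obtain ⟨c, rfl⟩ := (IsAlgClosed.ringHom_bijective_of_isIntegral _ h_integral).2 s
  exact ⟨c, rfl⟩

end AlgebraicGeometry.Scheme

lemma exists_fg_sup_maximalIdeal_pow_eq_top {k A : Type*} [Field k] [CommRing A] [IsLocalRing A]
    [IsNoetherianRing A] [Algebra k A]
    (hk : ∀ a : A, ∃ c : k, a - algebraMap k A c ∈ IsLocalRing.maximalIdeal A) (n : ℕ) :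
    ∃ W : Submodule k A, W.FG ∧ ∀ a, ∃ w ∈ W, a - w ∈ IsLocalRing.maximalIdeal A ^ n := by
  induction n with
  | zero => exact ⟨⊥, Submodule.fg_bot, fun a ↦ ⟨0, zero_mem _, by simp⟩⟩
  | succ n ih =>
    obtain ⟨W, hW, h⟩ := ih
    obtain ⟨S, hS⟩ := (isNoetherianRing_iff_ideal_fg A).mp inferInstance
      (IsLocalRing.maximalIdeal A ^ n)
    refine ⟨W ⊔ Submodule.span k S, hW.sup ⟨S, rfl⟩, fun a ↦ ?_⟩
    have key : ∀ b ∈ Submodule.span A (S : Set A), ∃ v ∈ Submodule.span k (S : Set A),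
        b - v ∈ IsLocalRing.maximalIdeal A ^ (n + 1) := by
      intro b hb
      induction hb using Submodule.span_induction with
      | mem x hx => exact ⟨x, Submodule.subset_span hx, by simp⟩
      | zero => exact ⟨0, zero_mem _, by simp⟩
      | add x y _ _ hx hy =>
        obtain ⟨v, hv, h⟩ := hx
        obtain ⟨v', hv', h'⟩ := hy
        exact ⟨v + v', add_mem hv hv', by rw [add_sub_add_comm]; exact add_mem h h'⟩
      | smul r x hx ih =>
        obtain ⟨v, hv, h⟩ := ih
        obtain ⟨c, hc⟩ := hk r
        refine ⟨c • v, Submodule.smul_mem _ _ hv, ?_⟩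
        have : r • x - c • v = (r - algebraMap k A c) * x + algebraMap k A c * (x - v) := by
          rw [Algebra.smul_def c, smul_eq_mul]; ring
        rw [this, pow_succ']
        refine add_mem (Ideal.mul_mem_mul hc (hS ▸ hx)) (Ideal.mul_mem_left _ _ ?_)
        rwa [← pow_succ']
    obtain ⟨w, hw, hwa⟩ := h a
    obtain ⟨v, hv, hvb⟩ := key (a - w) (by rw [← hS] at hwa; exact hwa)
    exact ⟨w + v, add_mem (Submodule.mem_sup_left hw) (Submodule.mem_sup_right hv),
      by rwa [← sub_sub]⟩

/-- An element of the normalization of a one-dimensional local domain satisfies a nonconstant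
polynomial congruence with constant coefficients modulo the local domain. -/
lemma exists_aeval_mem_of_isIntegral {k A K : Type*} [Field k] [CommRing A] [IsDomain A]
    [IsLocalRing A] [IsNoetherianRing A] [Algebra k A] [Field K] [Algebra A K] [IsFractionRing A K]
    [Algebra k K] [IsScalarTower k A K]
    (hk : ∀ a : A, ∃ c : k, a - algebraMap k A c ∈ IsLocalRing.maximalIdeal A)
    (hA : ∀ P : Ideal A, P.IsPrime → P ≠ ⊥ → P = IsLocalRing.maximalIdeal A)
    {t : K} (ht : IsIntegral A t) :
    ∃ g : Polynomial k, g.natDegree ≠ 0 ∧ Polynomial.aeval t g ∈ (algebraMap A K).range := by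
  obtain ⟨d, hd, hdt⟩ := FractionalIdeal.isFractional_of_fg (S := nonZeroDivisors A)
    ht.fg_adjoin_singleton
  have hd0 := nonZeroDivisors.ne_zero hd
  have hrad : IsLocalRing.maximalIdeal A ≤ (Ideal.span {d}).radical := by
    rw [Ideal.radical_eq_sInf, le_sInf_iff]
    rintro P ⟨hcP, hP⟩
    refine (hA P hP fun h ↦ hd0 ?_).ge
    rw [h, le_bot_iff, Ideal.span_singleton_eq_bot] at hcP
    exact hcP
  obtain ⟨n, hn⟩ := Ideal.exists_pow_le_of_le_radical_of_fg hrad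
    ((isNoetherianRing_iff_ideal_fg A).mp inferInstance _)
  obtain ⟨W, hW, hWn⟩ := exists_fg_sup_maximalIdeal_pow_eq_top hk n
  let π : A →ₗ[k] A ⧸ Ideal.span {d} := (Ideal.Quotient.mkₐ k (Ideal.span {d})).toLinearMap
  have hfin : Module.Finite k (A ⧸ Ideal.span {d}) := by
    refine ⟨?_⟩
    convert hW.map π
    refine (eq_top_iff.mpr fun x _ ↦ ?_).symm
    obtain ⟨a, rfl⟩ := Ideal.Quotient.mk_surjective x
    obtain ⟨w, hw, haw⟩ := hWn a
    exact ⟨w, hw, (Ideal.Quotient.eq.mpr (hn haw)).symm⟩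
  have hpow (i : ℕ) : ∃ a : A, algebraMap A K a = d • t ^ (i + 1) :=
    hdt (t ^ (i + 1)) (pow_mem (Algebra.self_mem_adjoin_singleton A t) (i + 1))
  choose a ha using hpow
  have hdep : ¬ LinearIndependent k fun i ↦ π (a i) := fun h ↦
    not_finite_iff_infinite.mpr inferInstance (h.finite (R := k))
  rw [linearIndependent_iff'] at hdep
  push Not at hdep
  obtain ⟨s, l, hl, i, hi, hli⟩ := hdep
  refine ⟨∑ j ∈ s, Polynomial.monomial (j + 1) (l j), fun h ↦ hli ?_, ?_⟩
  · rw [Polynomial.natDegree_eq_zero] at h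
    obtain ⟨c, hc⟩ := h
    simpa [Polynomial.coeff_monomial, Polynomial.coeff_C, hi] using
      congr(Polynomial.coeff $hc (i + 1)).symm
  · have hmem : ∑ j ∈ s, l j • a j ∈ Ideal.span {d} := by
      have : π (∑ j ∈ s, l j • a j) = 0 := by simpa only [map_sum, map_smul] using hl
      exact Ideal.Quotient.eq_zero_iff_mem.mp this
    obtain ⟨b, hb⟩ := Ideal.mem_span_singleton'.mp hmem
    refine ⟨b, ?_⟩
    have hdK : algebraMap A K d ≠ 0 := by simpa using hd0
    apply mul_right_cancel₀ hdK
    rw [← map_mul, hb, map_sum, map_sum, Finset.sum_mul]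
    refine Finset.sum_congr rfl fun j _ ↦ ?_
    rw [Polynomial.aeval_monomial, Algebra.smul_def, map_mul, ha, Algebra.smul_def,
      ← IsScalarTower.algebraMap_apply]
    ring

namespace AlgebraicGeometry.Scheme

variable {C : Scheme.{u}} [IsIntegral C] {k : Type u} [Field k] [IsAlgClosed k]

lemma HasPrincipalParts.isIntegrallyClosed_stalk (hC : C.HasPrincipalParts)
    (hdim : topologicalKrullDim C ≤ 1) (f : C ⟶ Spec (.of k)) [IsProper f] {p : C}
    (hp : p ≠ genericPoint C) : IsIntegrallyClosed (C.presheaf.stalk p) := by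
  rw [isIntegrallyClosed_iff C.functionField]
  intro t ht
  have := LocallyOfFiniteType.isLocallyNoetherian f
  obtain ⟨t', ht', htt'⟩ := hC p hp t
  algebraize [((C.presheaf.germ ⊤ p trivial).hom.comp (const f)), ratConst f]
  have : IsScalarTower k (C.presheaf.stalk p) C.functionField := .of_algebraMap_eq fun c ↦
    (algebraMap_germ_eq_germ_genericPoint (U := ⊤) trivial _).symm
  have h_integral : _root_.IsIntegral (C.presheaf.stalk p) t' := by
    obtain ⟨a, ha⟩ := htt'
    rw [← sub_sub_cancel t t', ← ha]
    exact ht.sub isIntegral_algebraMap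
  obtain ⟨g, hg, hgp⟩ := exists_aeval_mem_of_isIntegral (k := k)
    (exists_germ_const_sub_mem_maximalIdeal f (isClosed_singleton_of_ne_genericPoint hdim hp))
    (fun P _ hP ↦ eq_maximalIdeal_of_isPrime_of_ne_bot hdim hP) h_integral
  obtain ⟨c, hc⟩ := exists_ratConst_eq_of_forall_mem_regularAt f (t := Polynomial.aeval t' g)
    fun q ↦ by
      by_cases hq : q = p
      · rw [hq]; exact hgp
      · rw [Polynomial.aeval_eq_sum_range]
        refine sum_mem fun i _ ↦ ?_
        rw [Algebra.smul_def]
        exact mul_mem (ratConst_mem_regularAt f _ q) (pow_mem (ht' q hq) i)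
  have halg : IsAlgebraic k t' := by
    refine ⟨g - Polynomial.C c, fun h ↦ hg ?_, ?_⟩
    · rw [sub_eq_zero.mp h, Polynomial.natDegree_C]
    · rw [map_sub, Polynomial.aeval_C, ← hc, sub_eq_zero]
      rfl
  obtain ⟨c', rfl⟩ := minpoly.mem_range_of_degree_eq_one k t'
    (IsAlgClosed.degree_eq_one_of_irreducible k (minpoly.irreducible halg.isIntegral))
  have := add_mem htt' (ratConst_mem_regularAt f c' p)
  rw [show ratConst f c' = algebraMap k C.functionField c' from rfl, sub_add_cancel] at this
  exact this

lemma maximalIdeal_stalk_ne_bot {p : C} (hp : p ≠ genericPoint C) :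
    IsLocalRing.maximalIdeal (C.presheaf.stalk p) ≠ ⊥ := by
  intro h
  have : genericPoint C ∈ Set.range (C.fromSpecStalk p) := by
    rw [range_fromSpecStalk]
    exact genericPoint_specializes p
  obtain ⟨z, hz⟩ := this
  have : z = IsLocalRing.closedPoint (C.presheaf.stalk p) := by
    refine PrimeSpectrum.ext (le_antisymm (IsLocalRing.le_maximalIdeal z.isPrime.ne_top) ?_)
    exact h.trans_le bot_le
  rw [this, fromSpecStalk_closedPoint] at hz
  exact hp hz

/-- The rational function `h` has a simple pole at `p` and is regular elsewhere. -/
structure IsSimplePole {k : Type u} [Field k] (f : C ⟶ Spec (.of k)) (p : C)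
    (h : C.functionField) : Prop where
  mem_regularAt : ∀ q ≠ p, h ∈ C.regularAt q
  notMem_regularAt : h ∉ C.regularAt p
  inv_mem_regularAt : h⁻¹ ∈ C.regularAt p
  exists_eq_add : ∀ a ∈ C.regularAt p, ∃ c, ∃ b ∈ C.regularAt p, a = ratConst f c + h⁻¹ * b
  exists_mul_inv_pow_mem : ∀ t, ∃ n : ℕ, t * h⁻¹ ^ n ∈ C.regularAt p

lemma HasPrincipalParts.exists_simple_pole (hC : C.HasPrincipalParts)
    (hdim : topologicalKrullDim C ≤ 1) (f : C ⟶ Spec (.of k)) [IsProper f] {p : C}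
    (hp : p ≠ genericPoint C) :
    ∃ h, IsSimplePole f p h := by
  have := LocallyOfFiniteType.isLocallyNoetherian f
  have := hC.isIntegrallyClosed_stalk hdim f hp
  have hprin : (IsLocalRing.maximalIdeal (C.presheaf.stalk p)).IsPrincipal := by
    refine List.TFAE.out (tfae_of_isNoetherianRing_of_isLocalRing_of_isDomain
      (C.presheaf.stalk p)) 3 4 |>.mp ?_
    exact ⟨this, fun P hP _ ↦ eq_maximalIdeal_of_isPrime_of_ne_bot hdim hP⟩
  obtain ⟨ϖ, hϖ⟩ := hprin
  have hϖ0 : ϖ ≠ 0 := by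
    rintro rfl
    exact maximalIdeal_stalk_ne_bot hp (by simpa using hϖ)
  have hϖm : ϖ ∈ IsLocalRing.maximalIdeal (C.presheaf.stalk p) := by
    rw [hϖ]; exact Submodule.mem_span_singleton_self ϖ
  set ν := algebraMap (C.presheaf.stalk p) C.functionField with hν
  have hνϖ : ν ϖ ≠ 0 := by simpa [hν] using hϖ0
  obtain ⟨h, hreg, b, hb⟩ := hC p hp (ν ϖ)⁻¹
  have hu : IsUnit (1 - ϖ * b) := IsLocalRing.isUnit_one_sub_self_of_mem_nonunits _
    (Ideal.mul_mem_right _ _ hϖm)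
  obtain ⟨u, hu⟩ := hu
  have hh : h = (ν ϖ)⁻¹ * ν u := by
    rw [hu, map_sub, map_mul, map_one, hb]
    field_simp
    ring
  have hinv : h⁻¹ = ν (ϖ * ↑u⁻¹) := by
    rw [hh, mul_inv, inv_inv, map_mul]
    congr 1
    refine inv_eq_of_mul_eq_one_right ?_
    rw [← map_mul, Units.mul_inv, map_one]
  have hϖ'm : ϖ * ↑u⁻¹ ∈ IsLocalRing.maximalIdeal (C.presheaf.stalk p) :=
    Ideal.mul_mem_right _ _ hϖm
  have h0 : h ≠ 0 := by
    rw [hh]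
    exact mul_ne_zero (inv_ne_zero hνϖ) ((u.isUnit.map ν).ne_zero)
  refine ⟨h, hreg, ?_, ⟨_, hinv.symm⟩, ?_, fun t ↦ ?_⟩
  · rintro ⟨x, hx⟩
    have : ν (ϖ * ↑u⁻¹ * x) = 1 := by
      rw [map_mul, ← hinv]
      exact (congrArg (h⁻¹ * ·) hx).trans (inv_mul_cancel₀ h0)
    have : ϖ * ↑u⁻¹ * x = 1 := IsFractionRing.injective (C.presheaf.stalk p) C.functionField
      (this.trans (map_one _).symm)
    exact (IsLocalRing.mem_maximalIdeal _).mp hϖ'm (IsUnit.of_mul_eq_one _ this)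
  · rintro _ ⟨a, rfl⟩
    obtain ⟨c, hc⟩ := exists_germ_const_sub_mem_maximalIdeal f
      (isClosed_singleton_of_ne_genericPoint hdim hp) a
    rw [hϖ] at hc
    obtain ⟨x, hx⟩ := Submodule.mem_span_singleton.mp hc
    refine ⟨c, ν (u * x), ⟨_, rfl⟩, ?_⟩
    have hcc : ratConst f c = ν (C.presheaf.germ ⊤ p trivial (const f c)) :=
      (algebraMap_germ_eq_germ_genericPoint (U := ⊤) trivial _).symm
    rw [hinv, hcc, ← map_mul, ← map_add]
    congr 1
    rw [mul_assoc, Units.inv_mul_cancel_left, mul_comm ϖ, ← smul_eq_mul, hx]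
    ring
  · rw [hinv]
    exact exists_mul_pow_mem_regularAt hdim t hϖ'm

end AlgebraicGeometry.Scheme

open scoped Polynomial

namespace AlgebraicGeometry.Scheme

variable {C : Scheme.{u}} [IsIntegral C] {k : Type u} [Field k]

/-- The rational function `x` is regular away from `p`, it generates the ring of functions with
this property, and it separates the points other than `p`. -/
structure IsParameter (f : C ⟶ Spec (.of k)) (p : C) (x : C.functionField) : Prop where
  mem_regularAt : ∀ q ≠ p, x ∈ C.regularAt q
  notMem_regularAt : x ∉ C.regularAt p
  exists_eval₂_eq : ∀ t, (∀ q ≠ p, t ∈ C.regularAt q) → ∃ P : k[X], P.eval₂ (ratConst f) x = t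
  exists_inv_sub : ∀ q ≠ p, q ≠ genericPoint C → ∃ c, (x - ratConst f c)⁻¹ ∉ C.regularAt q ∧
    ∀ q' ≠ q, (x - ratConst f c)⁻¹ ∈ C.regularAt q'

variable {f : C ⟶ Spec (.of k)} {p : C} {x : C.functionField}

lemma IsParameter.mul_sub (h : IsParameter f p x) {a : k} (ha : a ≠ 0) (e : k) :
    IsParameter f p (ratConst f a * (x - ratConst f e)) := by
  have ha' : ratConst f a ≠ 0 := (_root_.map_ne_zero _).mpr ha
  refine ⟨fun q hq ↦ ?_, fun hp ↦ h.notMem_regularAt ?_, fun t ht ↦ ?_, fun q hq hq' ↦ ?_⟩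
  · exact mul_mem (ratConst_mem_regularAt ..)
      (sub_mem (h.mem_regularAt q hq) (ratConst_mem_regularAt ..))
  · have := add_mem (mul_mem (ratConst_mem_regularAt f a⁻¹ p) hp) (ratConst_mem_regularAt f e p)
    rwa [map_inv₀, inv_mul_cancel_left₀ ha', sub_add_cancel] at this
  · obtain ⟨P, rfl⟩ := h.exists_eval₂_eq t ht
    refine ⟨P.comp (.C a⁻¹ * .X + .C e), ?_⟩
    rw [Polynomial.eval₂_comp]
    congr 1
    simp [ha']
  · obtain ⟨c, hc, hc'⟩ := h.exists_inv_sub q hq hq'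
    have key : (ratConst f a * (x - ratConst f e) - ratConst f (a * (c - e)))⁻¹ =
        ratConst f a⁻¹ * (x - ratConst f c)⁻¹ := by
      rw [map_inv₀, ← mul_inv, map_mul, map_sub]
      ring_nf
    refine ⟨a * (c - e), fun h ↦ hc ?_, fun q' hq' ↦ ?_⟩
    · rw [key] at h
      have := mul_mem (ratConst_mem_regularAt f a q) h
      rwa [map_inv₀, mul_inv_cancel_left₀ ha'] at this
    · rw [key]
      exact mul_mem (ratConst_mem_regularAt ..) (hc' q' hq')

lemma eq_zero_of_eval₂_eq_zero [IsAlgClosed k] (hx : x ∉ C.regularAt p) {P : k[X]}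
    (hP : P.eval₂ (ratConst f) x = 0) : P = 0 := by
  algebraize [ratConst f]
  by_contra h0
  have halg : IsAlgebraic k x := ⟨P, h0, hP⟩
  obtain ⟨c', rfl⟩ := minpoly.mem_range_of_degree_eq_one k x
    (IsAlgClosed.degree_eq_one_of_irreducible k (minpoly.irreducible halg.isIntegral))
  exact hx (ratConst_mem_regularAt f c' p)

variable [IsAlgClosed k] [UniversallyClosed f]

lemma IsSimplePole.exists_eval₂_eq (hx : IsSimplePole f p x) {t : C.functionField}
    (ht : ∀ q ≠ p, t ∈ C.regularAt q) : ∃ P : k[X], P.eval₂ (ratConst f) x = t := by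
  have hx0 : x ≠ 0 := fun h ↦ hx.notMem_regularAt (h ▸ zero_mem _)
  obtain ⟨n, hn⟩ := hx.exists_mul_inv_pow_mem t
  induction n generalizing t with
  | zero =>
    obtain ⟨c, rfl⟩ := exists_ratConst_eq_of_forall_mem_regularAt f (t := t) fun q ↦ by
      by_cases hq : q = p
      · rw [hq]; simpa using hn
      · exact ht q hq
    exact ⟨.C c, by simp⟩
  | succ n ih =>
    obtain ⟨c, b, hb, hcb⟩ := hx.exists_eq_add _ hn
    obtain ⟨P, hP⟩ := ih (t := t - ratConst f c * x ^ (n + 1))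
      (fun q hq ↦ sub_mem (ht q hq) (mul_mem (ratConst_mem_regularAt ..)
        (pow_mem (hx.mem_regularAt q hq) _))) (by
      convert hb using 1
      rw [inv_pow] at hcb ⊢
      field_simp at hcb ⊢
      rw [pow_succ] at hcb
      have hxn : x ^ n ≠ 0 := pow_ne_zero _ hx0
      grind)
    exact ⟨P + .C c * .X ^ (n + 1), by simp [hP]⟩

lemma IsSimplePole.exists_inv_sub_eq (hx : IsSimplePole f p x) {q : C} {d : C.functionField}
    (hd : IsSimplePole f q d) (hpq : q ≠ p) :
    ∃ c a e, a ≠ 0 ∧ (x - ratConst f c)⁻¹ = ratConst f a * (d - ratConst f e) := by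
  have hx0 : x ≠ 0 := fun h ↦ hx.notMem_regularAt (h ▸ zero_mem _)
  have hd0 : d ≠ 0 := fun h ↦ hd.notMem_regularAt (h ▸ zero_mem _)
  obtain ⟨c, b, hb, hcb⟩ := hd.exists_eq_add x (hx.mem_regularAt q hpq)
  obtain ⟨e, b', hb', heb⟩ := hx.exists_eq_add d (hd.mem_regularAt p hpq.symm)
  obtain ⟨a, ha⟩ := exists_ratConst_eq_of_forall_mem_regularAt f
    (t := (x - ratConst f c) * (d - ratConst f e)) fun r ↦ by
      by_cases hr : r = p
      · have : (x - ratConst f c) * (d - ratConst f e) = (1 - ratConst f c * x⁻¹) * b' := by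
          rw [heb]
          field_simp
          ring
        rw [this, hr]
        exact mul_mem (sub_mem (one_mem _) (mul_mem (ratConst_mem_regularAt ..)
          hx.inv_mem_regularAt)) hb'
      by_cases hr' : r = q
      · have : (x - ratConst f c) * (d - ratConst f e) = b * (1 - ratConst f e * d⁻¹) := by
          nth_rw 1 [hcb]
          field_simp
          ring
        rw [this, hr']
        exact mul_mem hb (sub_mem (one_mem _) (mul_mem (ratConst_mem_regularAt ..)
          hd.inv_mem_regularAt))
      · exact mul_mem (sub_mem (hx.mem_regularAt r hr) (ratConst_mem_regularAt ..))
          (sub_mem (hd.mem_regularAt r hr') (ratConst_mem_regularAt ..))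
  have hxc : x - ratConst f c ≠ 0 := fun h ↦ hx.notMem_regularAt
    (sub_eq_zero.mp h ▸ ratConst_mem_regularAt ..)
  have hde : d - ratConst f e ≠ 0 := fun h ↦ hd.notMem_regularAt
    (sub_eq_zero.mp h ▸ ratConst_mem_regularAt ..)
  refine ⟨c, a⁻¹, e, inv_ne_zero ?_, ?_⟩
  · rintro rfl
    exact mul_ne_zero hxc hde (by rw [← ha, map_zero])
  · rw [map_inv₀, ha]
    field_simp

omit [UniversallyClosed f] in
lemma IsSimplePole.isParameter [IsProper f] (hC : C.HasPrincipalParts)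
    (hdim : topologicalKrullDim C ≤ 1) (hx : IsSimplePole f p x) : IsParameter f p x where
  mem_regularAt := hx.mem_regularAt
  notMem_regularAt := hx.notMem_regularAt
  exists_eval₂_eq t ht := hx.exists_eval₂_eq ht
  exists_inv_sub q hq hq' := by
    obtain ⟨d, hd⟩ := hC.exists_simple_pole hdim f hq'
    obtain ⟨c, a, e, ha, h⟩ := hx.exists_inv_sub_eq hd hq
    have ha' : ratConst f a ≠ 0 := (_root_.map_ne_zero _).mpr ha
    refine ⟨c, fun hmem ↦ hd.notMem_regularAt ?_, fun r hr ↦ ?_⟩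
    · have := add_mem (mul_mem (ratConst_mem_regularAt f a⁻¹ q) (h ▸ hmem))
        (ratConst_mem_regularAt f e q)
      rwa [map_inv₀, inv_mul_cancel_left₀ ha', sub_add_cancel] at this
    · rw [h]
      exact mul_mem (ratConst_mem_regularAt ..)
        (sub_mem (hd.mem_regularAt r hr) (ratConst_mem_regularAt ..))

omit [UniversallyClosed f] in
lemma HasPrincipalParts.exists_isParameter [IsProper f] (hC : C.HasPrincipalParts)
    (hdim : topologicalKrullDim C ≤ 1) (hp : p ≠ genericPoint C) :
    ∃ q x, q ≠ p ∧ q ≠ genericPoint C ∧ IsParameter f p x ∧ IsParameter f q x⁻¹ := by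
  obtain ⟨y, hy⟩ := hC.exists_simple_pole hdim f hp
  have hy' := hy.isParameter hC hdim
  obtain ⟨q, hqp, hq⟩ : ∃ q ≠ p, y⁻¹ ∉ C.regularAt q := by
    by_contra! h
    obtain ⟨P, hP⟩ := hy'.exists_eval₂_eq _ h
    have hy0 : y ≠ 0 := fun h ↦ hy.notMem_regularAt (h ▸ zero_mem _)
    have := eq_zero_of_eval₂_eq_zero (f := f) hy.notMem_regularAt (P := .X * P - 1)
      (by simp [hP, hy0])
    simpa using congr(Polynomial.eval 0 $this)
  have hq' : q ≠ genericPoint C := fun h ↦ hq (h ▸ mem_regularAt_genericPoint _)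
  obtain ⟨d, hd⟩ := hC.exists_simple_pole hdim f hq'
  obtain ⟨c, a, e, ha, h⟩ := hy.exists_inv_sub_eq hd hqp
  refine ⟨q, y - ratConst f c, hqp, hq', ?_, h ▸ (hd.isParameter hC hdim).mul_sub ha e⟩
  simpa using hy'.mul_sub one_ne_zero c

end AlgebraicGeometry.Scheme

namespace AlgebraicGeometry.Scheme

variable {C : Scheme.{u}} [IsIntegral C] {k : Type u} [Field k]
  {f : C ⟶ Spec (.of k)} {p : C} {x : C.functionField}

lemma IsParameter.ne_genericPoint (hx : IsParameter f p x) : p ≠ genericPoint C :=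
  fun h ↦ hx.notMem_regularAt (h ▸ mem_regularAt_genericPoint x)

omit [IsIntegral C] in
lemma exists_isAffineOpen_notMem {p q : C} (hp : IsClosed {p}) (hq : q ≠ p) :
    ∃ W : C.Opens, IsAffineOpen W ∧ q ∈ W ∧ p ∉ W := by
  let U : C.Opens := ⟨{p}ᶜ, hp.isOpen_compl⟩
  obtain ⟨_, ⟨W, hW, rfl⟩, hqW, hWU⟩ := C.isBasis_affineOpens.exists_subset_of_mem_open
    (show q ∈ (U : Set C) from hq) U.isOpen
  exact ⟨W, hW, hqW, fun h ↦ hWU h rfl⟩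

lemma IsParameter.isAffineOpen [NoetherianSpace C] (hdim : topologicalKrullDim C ≤ 1)
    (hx : IsParameter f p x) {U : C.Opens} (hU : (U : Set C) = {p}ᶜ) : IsAffineOpen U := by
  classical
  have hp : IsClosed {p} := isClosed_singleton_of_ne_genericPoint hdim hx.ne_genericPoint
  have hmU (q : C) : q ∈ U ↔ q ≠ p := iff_of_eq congr(q ∈ $hU)
  have hη : genericPoint C ∈ U := (hmU _).mpr hx.ne_genericPoint.symm
  choose! c hc hc' using hx.exists_inv_sub
  obtain ⟨s, hs⟩ := exists_germ_genericPoint_eq hη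
    fun q hq ↦ hx.mem_regularAt q ((hmU q).mp hq)
  let r : k → Γ(C, U) := fun a ↦ resSec C U ⊤ le_top (const f a)
  have hr (a : k) : C.presheaf.germ U _ hη (r a) = ratConst f a :=
    germ_genericPoint_resSec le_top hη _
  have hinj := germ_injective_of_isIntegral C _ hη
  have hxc (a : k) : x - ratConst f a ≠ 0 := fun h ↦ hx.notMem_regularAt
    (sub_eq_zero.mp h ▸ ratConst_mem_regularAt ..)
  have key (W : C.Opens) (hW : genericPoint C ∈ W) (hpW : p ∉ W) :
      ∃ T : Finset C, (∀ z ∈ T, z ∉ W ∧ z ≠ p ∧ z ≠ genericPoint C) ∧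
        C.basicOpen (∏ z ∈ T, (s - r (c z))) = W := by
    have hfin := finite_compl_of_genericPoint_mem hdim hW
    refine ⟨hfin.toFinset.erase p, fun z hz ↦ ?_, ?_⟩
    · rw [Finset.mem_erase, hfin.mem_toFinset] at hz
      exact ⟨hz.2, hz.1, fun h ↦ hz.2 (h ▸ hW)⟩
    set T := hfin.toFinset.erase p with hT
    have hmT (z) : z ∈ T ↔ z ≠ p ∧ z ∉ W := by
      rw [hT, Finset.mem_erase, hfin.mem_toFinset]; rfl
    have hgerm : C.presheaf.germ U _ hη (∏ z ∈ T, (s - r (c z))) =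
        ∏ z ∈ T, (x - ratConst f (c z)) := by
      rw [map_prod]
      refine Finset.prod_congr rfl fun z _ ↦ ?_
      rw [map_sub, hs, hr]
    have h0 : ∏ z ∈ T, (s - r (c z)) ≠ 0 := by
      intro h
      rw [h, map_zero] at hgerm
      exact Finset.prod_ne_zero_iff.mpr (fun z _ ↦ hxc (c z)) hgerm.symm
    ext q
    by_cases hqU : q ∈ U
    · refine (isUnit_germ_iff_inv_mem_regularAt hqU _ h0).trans ?_
      rw [hgerm, ← Finset.prod_inv_distrib]
      constructor
      · intro h
        by_contra hqW
        have hqT : q ∈ T := (hmT q).mpr ⟨(hmU q).mp hqU, hqW⟩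
        refine hc q ((hmU q).mp hqU) (fun h ↦ hqW (h ▸ hW)) ?_
        have := mul_mem h (prod_mem (t := T.erase q) (f := fun z ↦ x - ratConst f (c z))
          fun z _ ↦ sub_mem (hx.mem_regularAt q ((hmU q).mp hqU)) (ratConst_mem_regularAt f _ q))
        rw [← Finset.mul_prod_erase T _ hqT, mul_assoc, ← Finset.prod_mul_distrib,
          Finset.prod_eq_one, mul_one] at this
        · exact this
        · exact fun z _ ↦ inv_mul_cancel₀ (hxc _)
      · intro hqW
        refine prod_mem fun z hz ↦ ?_
        have hz' := (hmT z).mp hz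
        exact hc' z hz'.1 (fun h ↦ hz'.2 (h ▸ hW)) q (fun h ↦ hz'.2 (h ▸ hqW))
    · refine iff_of_false (fun h ↦ hqU (C.basicOpen_le _ h)) fun h ↦ hpW ?_
      rwa [not_ne_iff.mp (fun h ↦ hqU ((hmU q).mpr h))] at h
  refine isAffineOpen_of_isAffineOpen_basicOpen U {g | IsAffineOpen (C.basicOpen g)} ?_
    fun g hg ↦ hg
  by_contra hne
  obtain ⟨M, hM, hle⟩ := Ideal.exists_le_maximal _ hne
  have step (q : C) (hq : q ≠ p) :
      ∃ z, z ≠ q ∧ z ≠ p ∧ z ≠ genericPoint C ∧ s - r (c z) ∈ M := by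
    obtain ⟨W, hW, hqW, hpW⟩ := exists_isAffineOpen_notMem hp hq
    obtain ⟨T, hT, hTW⟩ := key W (genericPoint_mem hqW) hpW
    have := hle (Ideal.subset_span (show _ ∈ {g | IsAffineOpen (C.basicOpen g)} from
      (show IsAffineOpen (C.basicOpen _) from hTW.symm ▸ hW)))
    obtain ⟨z, hz, hzM⟩ := (hM.isPrime.prod_mem_iff).mp this
    exact ⟨z, fun h ↦ (hT z hz).1 (h ▸ hqW), (hT z hz).2.1, (hT z hz).2.2, hzM⟩
  obtain ⟨z, -, hzp, hzη, hzM⟩ := step _ hx.ne_genericPoint.symm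
  obtain ⟨z', hz'z, hz'p, hz'η, hz'M⟩ := step z hzp
  have hcc : c z = c z' := by
    by_contra hne
    refine hM.ne_top (Ideal.eq_top_of_isUnit_mem _ (x := r (c z - c z')) ?_ ?_)
    · have := sub_mem hz'M hzM
      convert this using 1
      apply hinj
      simp only [map_sub, hr]
      ring
    · refine IsUnit.of_mul_eq_one (r (c z - c z')⁻¹) (hinj ?_)
      rw [map_mul, hr, hr, map_one, ← map_mul, mul_inv_cancel₀ (sub_ne_zero.mpr hne), map_one]
  exact hc z hzp hzη (hcc ▸ hc' z' hz'p hz'η z hz'z.symm)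

end AlgebraicGeometry.Scheme

namespace AlgebraicGeometry.Scheme

variable {X Y : Scheme.{u}} {U V : X.Opens}

lemma exists_hom_of_fromSpecStalkOfMem_comp_eq [IsIntegral X] [Y.IsSeparated] (h : U ⊔ V = ⊤)
    (hU : genericPoint X ∈ U) (hV : genericPoint X ∈ V) (g₀ : U.toScheme ⟶ Y)
    (g₁ : V.toScheme ⟶ Y)
    (hg : U.fromSpecStalkOfMem _ hU ≫ g₀ = V.fromSpecStalkOfMem _ hV ≫ g₁) :
    ∃ ψ : X ⟶ Y, U.ι ≫ ψ = g₀ ∧ V.ι ≫ ψ = g₁ := by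
  let f₀ : X.PartialMap Y := ⟨U, U.isOpen.dense ⟨_, hU⟩, g₀⟩
  let f₁ : X.PartialMap Y := ⟨V, V.isOpen.dense ⟨_, hV⟩, g₁⟩
  let r : X ⤏ Y := f₀.toRationalMap
  have hr : f₁.toRationalMap = r := RationalMap.eq_of_fromFunctionField_eq _ _ hg.symm
  have hdom : ⊤ ≤ r.domain := by
    rw [← h]
    refine sup_le f₀.le_domain_toRationalMap ?_
    rw [← hr]
    exact f₁.le_domain_toRationalMap
  have key (r : X ⤏ Y) : ∃ m : r.domain.toScheme ⟶ Y, ∀ (f : X.PartialMap Y)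
      (hf : f.toRationalMap = r), X.homOfLE (hf ▸ f.le_domain_toRationalMap) ≫ m = f.hom :=
    ⟨r.toPartialMap.hom, by rintro f rfl; exact f.toPartialMap_toRationalMap_restrict⟩
  obtain ⟨m, hm⟩ := key r
  have hι (W : X.Opens) (hW : W ≤ r.domain) :
      W.ι ≫ X.topIso.inv ≫ X.homOfLE hdom ≫ m = X.homOfLE hW ≫ m := by
    have : W.ι ≫ X.topIso.inv ≫ X.homOfLE hdom = X.homOfLE hW := by
      rw [← cancel_mono (Opens.ι _)]
      simp
    rw [← this]
    simp only [Category.assoc]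
  exact ⟨X.topIso.inv ≫ X.homOfLE hdom ≫ m, (hι U _).trans (hm f₀ rfl),
    (hι V _).trans (hm f₁ hr)⟩

lemma isIso_of_isOpenImmersion_ι_comp (ψ : X ⟶ Y) (h : U ⊔ V = ⊤) [IsOpenImmersion (U.ι ≫ ψ)]
    [IsOpenImmersion (V.ι ≫ ψ)] (hsurj : (U.ι ≫ ψ).opensRange ⊔ (V.ι ≫ ψ).opensRange = ⊤)
    (hinj : ∀ x ∉ U, ∀ y ∉ V, ψ x ≠ ψ y) : IsIso ψ := by
  have hUV (x : X) : x ∈ U ∨ x ∈ V := (show x ∈ U ⊔ V from h ▸ trivial)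
  have hUi : Set.InjOn ψ U := fun x hx y hy hxy ↦ congrArg Subtype.val
    ((U.ι ≫ ψ).isOpenEmbedding.injective (a₁ := ⟨x, hx⟩) (a₂ := ⟨y, hy⟩) hxy)
  have hVi : Set.InjOn ψ V := fun x hx y hy hxy ↦ congrArg Subtype.val
    ((V.ι ≫ ψ).isOpenEmbedding.injective (a₁ := ⟨x, hx⟩) (a₂ := ⟨y, hy⟩) hxy)
  have hψ : Function.Injective ψ := by
    intro x y hxy
    by_cases hxU : x ∈ U
    · by_cases hyU : y ∈ U
      · exact hUi hxU hyU hxy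
      by_cases hxV : x ∈ V
      · exact hVi hxV ((hUV y).resolve_left hyU) hxy
      · exact (hinj y hyU x hxV hxy.symm).elim
    · by_cases hyV : y ∈ V
      · exact hVi ((hUV x).resolve_left hxU) hyV hxy
      · exact (hinj x hxU y hyV hxy).elim
  have hopen : IsOpenMap ψ := by
    intro W hW
    have hW' : ψ '' W = (U.ι ≫ ψ) '' (U.ι ⁻¹' W) ∪ (V.ι ≫ ψ) '' (V.ι ⁻¹' W) := by
      ext y
      constructor
      · rintro ⟨x, hx, rfl⟩
        rcases hUV x with hxU | hxV
        · exact .inl ⟨⟨x, hxU⟩, hx, rfl⟩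
        · exact .inr ⟨⟨x, hxV⟩, hx, rfl⟩
      · rintro (⟨x, hx, rfl⟩ | ⟨x, hx, rfl⟩)
        · exact ⟨_, hx, rfl⟩
        · exact ⟨_, hx, rfl⟩
    rw [hW']
    exact ((U.ι ≫ ψ).isOpenEmbedding.isOpenMap _ (hW.preimage U.ι.continuous)).union
      ((V.ι ≫ ψ).isOpenEmbedding.isOpenMap _ (hW.preimage V.ι.continuous))
  have hstalk (W : X.Opens) [IsOpenImmersion (W.ι ≫ ψ)] (x : W.toScheme) :
      IsIso (ψ.stalkMap (W.ι x)) := by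
    have hiso : IsIso ((W.ι ≫ ψ).stalkMap x) :=
      (IsOpenImmersion.iff_isIso_stalkMap.mp ‹IsOpenImmersion (W.ι ≫ ψ)›).2 x
    rw [Hom.stalkMap_comp] at hiso
    have hι : IsIso (W.ι.stalkMap x) :=
      (IsOpenImmersion.iff_isIso_stalkMap.mp (inferInstanceAs (IsOpenImmersion W.ι))).2 x
    exact @IsIso.of_isIso_comp_right _ _ _ _ _ _ _ hι hiso
  have (x : X) : IsIso (ψ.stalkMap x) := by
    rcases hUV x with hxU | hxV
    · exact hstalk U ⟨x, hxU⟩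
    · exact hstalk V ⟨x, hxV⟩
  have : IsOpenImmersion ψ := .of_isIso_stalkMap ψ
    (.of_continuous_injective_isOpenMap ψ.continuous hψ hopen)
  have : Surjective ψ := by
    refine ⟨fun y ↦ ?_⟩
    rcases (show y ∈ (U.ι ≫ ψ).opensRange ⊔ (V.ι ≫ ψ).opensRange from hsurj ▸ trivial) with
      ⟨x, rfl⟩ | ⟨x, rfl⟩
    · exact ⟨U.ι x, rfl⟩
    · exact ⟨V.ι x, rfl⟩
  exact (isIso_iff_isOpenImmersion_and_epi_base ψ).mpr
    ⟨inferInstance, (TopCat.epi_iff_surjective _).mpr ψ.surjective⟩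

end AlgebraicGeometry.Scheme

namespace HomogeneousLocalization

section

variable {ι A σ K : Type*} [CommRing A] [SetLike σ A] [AddSubgroupClass σ A] [AddCommMonoid ι]
  [DecidableEq ι] (𝒜 : ι → σ) [GradedRing 𝒜] [Field K] (φ : A →+* K)

/-- The ring homomorphism from the degree zero part of `A_f` to a field induced by a ring
homomorphism which does not kill `f`. -/
noncomputable def awayLift (f : A) (hf : φ f ≠ 0) : Away 𝒜 f →+* K :=
  (Localization.awayLift φ f hf.isUnit).comp (algebraMap (Away 𝒜 f) (Localization.Away f))

lemma awayLift_mk {f : A} (hf : φ f ≠ 0) {d : ι} (hd : f ∈ 𝒜 d) (n : ℕ) (a : A)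
    (ha : a ∈ 𝒜 (n • d)) : awayLift 𝒜 φ f hf (Away.mk 𝒜 hd n a ha) = φ a / φ f ^ n := by
  change Localization.awayLift φ f hf.isUnit (Localization.mk a ⟨f ^ n, by use n⟩) = _
  rw [eq_div_iff (pow_ne_zero _ hf), ← map_pow,
    ← IsLocalization.Away.lift_eq (S := Localization.Away f) f hf.isUnit (f ^ n),
    ← IsLocalization.Away.lift_eq (S := Localization.Away f) f hf.isUnit a, Localization.awayLift,
    ← map_mul, Localization.mk_eq_mk']
  congr 1
  exact IsLocalization.mk'_spec _ a (⟨f ^ n, by use n⟩ : Submonoid.powers f)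

lemma awayLift_comp_awayMap {f g x : A} (hf : φ f ≠ 0) (hx' : φ x ≠ 0) {d e : ι} (hd : f ∈ 𝒜 d)
    (hg : g ∈ 𝒜 e) (hx : x = f * g) :
    (awayLift 𝒜 φ x hx').comp (awayMap 𝒜 hg hx) = awayLift 𝒜 φ f hf := by
  ext z
  obtain ⟨n, a, ha, rfl⟩ := Away.mk_surjective 𝒜 hd z
  rw [RingHom.comp_apply, awayMap_mk, awayLift_mk, awayLift_mk, hx, map_mul, map_mul, map_pow,
    mul_pow]
  have : φ g ≠ 0 := fun h ↦ hx' (by rw [hx, map_mul, h, mul_zero])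
  field_simp

end

section

variable {k : Type u} [Field k] {i j : Fin 2}

lemma exists_eval₂_eq_pow_mul_eval₂_div {n : ℕ} {a : MvPolynomial (Fin 2) k} (hij : i ≠ j)
    (ha : a.IsHomogeneous n) :
    ∃ P : k[X], ∀ (K : Type u) [Field K] (ρ : k →+* K) (v : Fin 2 → K), v i ≠ 0 →
      a.eval₂ ρ v = v i ^ n * P.eval₂ ρ (v j / v i) := by
  refine ⟨∑ d ∈ a.support, .monomial (d j) (a.coeff d), fun K _ ρ v hv ↦ ?_⟩
  rw [MvPolynomial.eval₂_eq', Polynomial.eval₂_finsetSum, Finset.mul_sum]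
  refine Finset.sum_congr rfl fun d hd ↦ ?_
  have huniv : (Finset.univ : Finset (Fin 2)) = {i, j} := by
    ext l
    simp
    omega
  have hdn : d i + d j = n := by
    rw [← ha (MvPolynomial.mem_support_iff.mp hd), Pi.one_def, ← Finsupp.degree_eq_weight_one,
      Finsupp.degree_eq_sum, huniv, Finset.sum_pair hij]
  rw [huniv, Finset.prod_pair hij, Polynomial.eval₂_monomial, div_pow, ← hdn]
  field_simp
  rw [pow_add, mul_comm (v i ^ d i)]
  ring

lemma X_mem_homogeneousSubmodule (i : Fin 2) :
    MvPolynomial.X i ∈ MvPolynomial.homogeneousSubmodule (Fin 2) k 1 :=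
  MvPolynomial.isHomogeneous_X k i

variable {K : Type u} [Field K] (ρ : k →+* K) {v : Fin 2 → K}

lemma eval₂Hom_X_ne_zero (hv : v i ≠ 0) : MvPolynomial.eval₂Hom ρ v (.X i) ≠ 0 := by
  simpa using hv

lemma awayLift_X_injective (hij : i ≠ j) (hv : v i ≠ 0)
    (h : ∀ P : k[X], P.eval₂ ρ (v j / v i) = 0 → P = 0) :
    Function.Injective (awayLift (MvPolynomial.homogeneousSubmodule (Fin 2) k)
      (MvPolynomial.eval₂Hom ρ v) (.X i) (eval₂Hom_X_ne_zero ρ hv)) := by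
  rw [injective_iff_map_eq_zero]
  intro z hz
  obtain ⟨n, a, ha, rfl⟩ := Away.mk_surjective _ (X_mem_homogeneousSubmodule i) z
  obtain ⟨P, hP⟩ := exists_eval₂_eq_pow_mul_eval₂_div hij
    (show a.IsHomogeneous _ from ha)
  rw [awayLift_mk, MvPolynomial.coe_eval₂Hom, hP K ρ v hv, div_eq_zero_iff, mul_eq_zero] at hz
  have hP0 : P = 0 := h P (by simpa [hv] using hz)
  have ha0 : a = 0 := by
    let φ := algebraMap (MvPolynomial (Fin 2) k) (FractionRing (MvPolynomial (Fin 2) k))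
    have hφ : Function.Injective φ := FaithfulSMul.algebraMap_injective _ _
    have h1 := hP _ (φ.comp MvPolynomial.C) (fun l ↦ φ (MvPolynomial.X l))
      ((map_ne_zero_iff φ hφ).mpr (MvPolynomial.X_ne_zero i))
    rw [hP0, Polynomial.eval₂_zero, mul_zero, ← MvPolynomial.hom_eval₂,
      MvPolynomial.eval₂_eta] at h1
    exact hφ (h1.trans (map_zero φ).symm)
  subst ha0
  exact mk_eq_zero_of_num _ rfl

lemma mem_range_awayLift_X_iff (hij : i ≠ j) (hv : v i ≠ 0) (t : K) :
    t ∈ (awayLift (MvPolynomial.homogeneousSubmodule (Fin 2) k)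
      (MvPolynomial.eval₂Hom ρ v) (.X i) (eval₂Hom_X_ne_zero ρ hv)).range ↔
      ∃ P : k[X], P.eval₂ ρ (v j / v i) = t := by
  refine ⟨?_, ?_⟩
  · rintro ⟨z, rfl⟩
    obtain ⟨n, a, ha, rfl⟩ := Away.mk_surjective _ (X_mem_homogeneousSubmodule i) z
    obtain ⟨P, hP⟩ := exists_eval₂_eq_pow_mul_eval₂_div hij
      (show a.IsHomogeneous _ from ha)
    refine ⟨P, ?_⟩
    rw [awayLift_mk, MvPolynomial.coe_eval₂Hom, hP K ρ v hv, MvPolynomial.eval₂_X,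
      smul_eq_mul, mul_one]
    field_simp
  · rintro ⟨P, rfl⟩
    rw [Polynomial.eval₂_eq_sum_range]
    have hc (c : k) : ρ c ∈ (awayLift (MvPolynomial.homogeneousSubmodule (Fin 2) k)
        (MvPolynomial.eval₂Hom ρ v) (.X i) (eval₂Hom_X_ne_zero ρ hv)).range :=
      ⟨Away.mk _ (X_mem_homogeneousSubmodule i) 0 (.C c) (MvPolynomial.isHomogeneous_C _ c),
        (awayLift_mk _ _ _ _ _ _ _).trans (by simp)⟩
    have hX : v j / v i ∈ (awayLift (MvPolynomial.homogeneousSubmodule (Fin 2) k)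
        (MvPolynomial.eval₂Hom ρ v) (.X i) (eval₂Hom_X_ne_zero ρ hv)).range :=
      ⟨Away.mk _ (X_mem_homogeneousSubmodule i) 1 (.X j)
        (by simpa using X_mem_homogeneousSubmodule j), by rw [awayLift_mk]; simp⟩
    exact Subring.sum_mem _ fun l _ ↦ Subring.mul_mem _ (hc _) (Subring.pow_mem _ hX l)

end

end HomogeneousLocalization

lemma RingHom.exists_ringEquiv_comp_eq {A B R : Type*} [CommRing A] [CommRing B] [CommRing R]
    {α : A →+* R} {β : B →+* R} (hα : Function.Injective α) (hβ : Function.Injective β)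
    (h : α.range = β.range) : ∃ e : A ≃+* B, β.comp e = α := by
  let eα := RingEquiv.ofBijective α.rangeRestrict
    ⟨fun _ _ hab ↦ hα (congrArg Subtype.val hab), α.rangeRestrict_surjective⟩
  let eβ := RingEquiv.ofBijective β.rangeRestrict
    ⟨fun _ _ hab ↦ hβ (congrArg Subtype.val hab), β.rangeRestrict_surjective⟩
  refine ⟨(eα.trans (RingEquiv.subringCongr h)).trans eβ.symm, RingHom.ext fun a ↦ ?_⟩
  exact congrArg Subtype.val (eβ.apply_symm_apply (RingEquiv.subringCongr h (eα a)))

namespace AlgebraicGeometry.Scheme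

variable {C : Scheme.{u}} [IsIntegral C]

lemma exists_iso_fromSpecStalkOfMem_comp_eq {U : C.Opens} (hU : IsAffineOpen U)
    (hη : genericPoint C ∈ U) {A : Type u} [CommRing A] {α : A →+* C.functionField}
    (hα : Function.Injective α) (hr : ∀ t, t ∈ α.range ↔ ∀ y ∈ U, t ∈ C.regularAt y) :
    ∃ g : U.toScheme ⟶ Spec (.of A), IsIso g ∧
      U.fromSpecStalkOfMem _ hη ≫ g = Spec.map (CommRingCat.ofHom α) ∧
      ∀ (y : U) (z : A), z ≠ 0 → g y ∈ PrimeSpectrum.basicOpen z →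
        (α z)⁻¹ ∈ C.regularAt y.1 := by
  let β : Γ(C, U) →+* C.functionField := (C.presheaf.germ U _ hη).hom
  have hβ : Function.Injective β := germ_injective_of_isIntegral C _ hη
  have hαβ : α.range = β.range := by
    ext t
    refine (hr t).trans ⟨fun h ↦ exists_germ_genericPoint_eq hη h, ?_⟩
    rintro ⟨s, rfl⟩ y hy
    exact germ_genericPoint_mem_regularAt hy s
  obtain ⟨e, he⟩ := RingHom.exists_ringEquiv_comp_eq hα hβ hαβ
  refine ⟨hU.isoSpec.hom ≫ Spec.map e.toCommRingCatIso.hom, inferInstance, ?_, ?_⟩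
  · rw [IsAffineOpen.isoSpec_hom, ← Category.assoc, Opens.fromSpecStalkOfMem_toSpecΓ,
      ← Spec.map_comp]
    congr 1
    ext a
    exact congr($he a)
  · intro y z hz hy
    have hy' : y.1 ∈ C.basicOpen (e z) := by
      have h1 : (hU.isoSpec.hom ≫ Spec.map e.toCommRingCatIso.hom) y =
          Spec.map e.toCommRingCatIso.hom (Spec.map (C.presheaf.germ U y y.2)
            (IsLocalRing.closedPoint _)) :=
        (Hom.comp_apply _ _ _).trans (congrArg _ (hU.isoSpec_hom_apply y))
      rw [h1] at hy
      rw [C.mem_basicOpen (e z) y.1 y.2]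
      by_contra h
      exact hy h
    have he' : β (e z) = α z := congr($he z)
    rw [← he']
    exact (isUnit_germ_iff_inv_mem_regularAt y.2 (e z) (by simpa using hz)).mp hy'

end AlgebraicGeometry.Scheme

namespace AlgebraicGeometry.Scheme

open MvPolynomial HomogeneousLocalization

variable {C : Scheme.{u}} [IsIntegral C] {k : Type u} [Field k] [IsAlgClosed k]
  {f : C ⟶ Spec (.of k)} {p : C} {i j : Fin 2} {v : Fin 2 → C.functionField}

lemma IsParameter.exists_isOpenImmersion [NoetherianSpace C] (hdim : topologicalKrullDim C ≤ 1)
    (hij : i ≠ j) (hi : v i ≠ 0) (hx : IsParameter f p (v j / v i)) {U : C.Opens}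
    (hU : (U : Set C) = {p}ᶜ) (hη : genericPoint C ∈ U) :
    ∃ (g : U.toScheme ⟶ Proj (homogeneousSubmodule (Fin 2) k)) (_ : IsOpenImmersion g),
      U.fromSpecStalkOfMem _ hη ≫ g = Spec.map (CommRingCat.ofHom
        (awayLift (homogeneousSubmodule (Fin 2) k) (eval₂Hom (ratConst f) v) (X i)
          (eval₂Hom_X_ne_zero _ hi))) ≫
          Proj.awayι _ (X i) (X_mem_homogeneousSubmodule i) Nat.zero_lt_one ∧
      g.opensRange = Proj.basicOpen _ (X i) ∧
      ∀ y : U, (v j / v i)⁻¹ ∉ C.regularAt y.1 →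
        g y ∉ Proj.basicOpen (homogeneousSubmodule (Fin 2) k) (X j) := by
  have hmU (q : C) : q ∈ U ↔ q ≠ p := iff_of_eq congr(q ∈ $hU)
  let α := awayLift (homogeneousSubmodule (Fin 2) k) (eval₂Hom (ratConst f) v) (X i)
    (eval₂Hom_X_ne_zero _ hi)
  have hα : Function.Injective α := awayLift_X_injective _ hij hi
    fun P hP ↦ eq_zero_of_eval₂_eq_zero hx.notMem_regularAt hP
  have hr (t) : t ∈ α.range ↔ ∀ y ∈ U, t ∈ C.regularAt y := by
    refine (mem_range_awayLift_X_iff _ hij hi t).trans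
      ⟨?_, fun h ↦ hx.exists_eval₂_eq t fun q hq ↦ h q ((hmU q).mpr hq)⟩
    rintro ⟨P, rfl⟩ y hy
    rw [Polynomial.eval₂_eq_sum_range]
    exact Subring.sum_mem _ fun l _ ↦ Subring.mul_mem _ (ratConst_mem_regularAt f _ y)
      (Subring.pow_mem _ (hx.mem_regularAt y ((hmU y).mp hy)) l)
  obtain ⟨g, hg, hgη, hg'⟩ := exists_iso_fromSpecStalkOfMem_comp_eq
    (hx.isAffineOpen hdim hU) hη hα hr
  refine ⟨g ≫ Proj.awayι _ (X i) (X_mem_homogeneousSubmodule i) Nat.zero_lt_one,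
    inferInstance, ?_, ?_, ?_⟩
  · rw [reassoc_of% hgη]
  · rw [Hom.opensRange_comp_of_isIso, Proj.opensRange_awayι]
  · intro y hy hmem
    let z := Away.isLocalizationElem (𝒜 := homogeneousSubmodule (Fin 2) k)
      (X_mem_homogeneousSubmodule i) (X_mem_homogeneousSubmodule j)
    have hαz : α z = v j / v i := by
      refine (awayLift_mk _ _ _ _ _ _ _).trans ?_
      simp
    have hgy : g y ∈ PrimeSpectrum.basicOpen z := by
      have := Proj.awayι_preimage_basicOpen (homogeneousSubmodule (Fin 2) k)
        (X_mem_homogeneousSubmodule i) Nat.zero_lt_one (X_mem_homogeneousSubmodule j)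
        Nat.zero_lt_one
      exact (iff_of_eq congr(g y ∈ $this)).mp hmem
    refine hy (hαz ▸ hg' y z ?_ hgy)
    rintro h
    rw [h, map_zero] at hαz
    exact hx.notMem_regularAt (hαz ▸ zero_mem _)

omit [IsAlgClosed k] in
lemma adjoin_range_X_eq_top : Algebra.adjoin (homogeneousSubmodule (Fin 2) k 0)
    (Set.range (X : Fin 2 → MvPolynomial (Fin 2) k)) = ⊤ := by
  refine top_le_iff.mp fun a _ ↦ ?_
  induction a using MvPolynomial.induction_on with
  | C c =>
    exact Subalgebra.algebraMap_mem _ (⟨.C c, isHomogeneous_C _ c⟩ :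
      homogeneousSubmodule (Fin 2) k 0)
  | add a b ha hb => exact add_mem (ha trivial) (hb trivial)
  | mul_X a i ha => exact mul_mem (ha trivial) (Algebra.subset_adjoin ⟨i, rfl⟩)

lemma IsParameter.nonempty_iso_proj [NoetherianSpace C] (hdim : topologicalKrullDim C ≤ 1)
    {q : C} {x : C.functionField} (hqp : q ≠ p) (hx : IsParameter f p x)
    (hx' : IsParameter f q x⁻¹) : Nonempty (C ≅ Proj (homogeneousSubmodule (Fin 2) k)) := by
  have hx0 : x ≠ 0 := fun h ↦ hx.notMem_regularAt (h ▸ zero_mem _)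
  let v : Fin 2 → C.functionField := ![1, x]
  let U : C.Opens := ⟨{p}ᶜ, (isClosed_singleton_of_ne_genericPoint hdim
    hx.ne_genericPoint).isOpen_compl⟩
  let V : C.Opens := ⟨{q}ᶜ, (isClosed_singleton_of_ne_genericPoint hdim
    hx'.ne_genericPoint).isOpen_compl⟩
  have hηU : genericPoint C ∈ U := hx.ne_genericPoint.symm
  have hηV : genericPoint C ∈ V := hx'.ne_genericPoint.symm
  have hqU : q ∈ U := hqp
  have hpV : p ∈ V := hqp.symm
  have hUV : U ⊔ V = ⊤ := by
    refine top_le_iff.mp fun y _ ↦ ?_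
    by_cases hy : y = p
    · exact Or.inr (hy ▸ hpV)
    · exact Or.inl hy
  have hv0 : v 0 ≠ 0 := one_ne_zero
  have hv1 : v 1 ≠ 0 := hx0
  have e0 : v 1 / v 0 = x := div_one x
  have e1 : v 0 / v 1 = x⁻¹ := one_div x
  obtain ⟨g₀, hg₀, hη₀, hr₀, hb₀⟩ := IsParameter.exists_isOpenImmersion (v := v) (U := U) hdim
    zero_ne_one hv0 (e0 ▸ hx) rfl hηU
  obtain ⟨g₁, hg₁, hη₁, hr₁, -⟩ := IsParameter.exists_isOpenImmersion (v := v) (U := V) hdim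
    one_ne_zero hv1 (e1 ▸ hx') rfl hηV
  have hmul : eval₂Hom (ratConst f) v (X 0 * X 1) ≠ 0 := by
    rw [map_mul]
    exact mul_ne_zero (eval₂Hom_X_ne_zero _ hv0) (eval₂Hom_X_ne_zero _ hv1)
  have hagree : U.fromSpecStalkOfMem _ hηU ≫ g₀ = V.fromSpecStalkOfMem _ hηV ≫ g₁ := by
    rw [hη₀, hη₁]
    rw [← awayLift_comp_awayMap (homogeneousSubmodule (Fin 2) k) _ (eval₂Hom_X_ne_zero _ hv0)
      hmul (X_mem_homogeneousSubmodule 0) (X_mem_homogeneousSubmodule 1) rfl,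
      ← awayLift_comp_awayMap (homogeneousSubmodule (Fin 2) k) _ (eval₂Hom_X_ne_zero _ hv1)
      hmul (X_mem_homogeneousSubmodule 1) (X_mem_homogeneousSubmodule 0) (mul_comm _ _),
      CommRingCat.ofHom_comp, CommRingCat.ofHom_comp, Spec.map_comp, Spec.map_comp,
      Category.assoc, Category.assoc, Proj.SpecMap_awayMap_awayι, Proj.SpecMap_awayMap_awayι]
  obtain ⟨ψ, rfl, rfl⟩ := exists_hom_of_fromSpecStalkOfMem_comp_eq hUV hηU hηV g₀ g₁ hagree
  have htop : Proj.basicOpen (homogeneousSubmodule (Fin 2) k) (X 0) ⊔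
      Proj.basicOpen (homogeneousSubmodule (Fin 2) k) (X 1) = ⊤ := by
    rw [← Proj.iSup_basicOpen_eq_top' (homogeneousSubmodule (Fin 2) k) (X : Fin 2 → _)
      (fun i ↦ ⟨1, X_mem_homogeneousSubmodule i⟩) ?_]
    · refine le_antisymm (sup_le (le_iSup_of_le 0 le_rfl) (le_iSup_of_le 1 le_rfl))
        (iSup_le fun i ↦ ?_)
      fin_cases i
      exacts [le_sup_left, le_sup_right]
    · exact adjoin_range_X_eq_top
  have : IsIso ψ := by
    refine isIso_of_isOpenImmersion_ι_comp ψ hUV (by rw [hr₀, hr₁, htop]) ?_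
    intro y hy z hz hyz
    obtain rfl : y = p := not_not.mp hy
    obtain rfl : z = q := not_not.mp hz
    refine hb₀ ⟨z, hqU⟩ (e0 ▸ hx'.notMem_regularAt) ?_
    have h1 : (V.ι ≫ ψ) ⟨y, hpV⟩ ∈ (V.ι ≫ ψ).opensRange := ⟨_, rfl⟩
    rw [hr₁] at h1
    have h2 : (V.ι ≫ ψ) ⟨y, hpV⟩ = (U.ι ≫ ψ) ⟨z, hqU⟩ :=
      (Hom.comp_apply V.ι ψ _).trans (hyz.trans (Hom.comp_apply U.ι ψ ⟨z, hqU⟩).symm)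
    exact h2 ▸ h1
  exact ⟨asIso ψ⟩

end AlgebraicGeometry.Scheme

/-- Let `φ : X ⟶ Y` be a proper surjective morphism between
normal (complex) varieties such that `R¹φ_* O_X = 0` and all fibers of `φ` have
dimension at most `1`.  Let `C` be a projective curve on `X` (an integral
one-dimensional closed subscheme, proper over `ℂ`) such that `φ(C)` is a point.
Then `H¹(C, O_C) = 0`; in particular `C ≅ ℙ¹`. -/
theorem stmt3 {X Y C : Scheme} (φ : X ⟶ Y) [IsProper φ] [Surjective φ]
    [IsIntegral X] [IsIntegral Y]
    (hXnormal : IsNormalScheme X) (hYnormal : IsNormalScheme Y)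
    (hR1 : FirstDirectImageVanishes φ)
    (hfib : ∀ y : Y, IsClosed ({y} : Set Y) →
      topologicalKrullDim (φ.base ⁻¹' {y} : Set X) ≤ 1)
    (ι : C ⟶ X) [IsClosedImmersion ι] [IsIntegral C]
    (pC : C ⟶ Spec (CommRingCat.of ℂ)) [IsProper pC]
    (hdim : topologicalKrullDim C = 1)
    (hpt : ∃ y : Y, φ.base '' Set.range ι.base = {y}) :
    FirstStructureCohomologyVanishes C ∧ Nonempty (C ≅ ProjLine) := by
  obtain ⟨y, hy⟩ := hpt
  have hι (q : C) : φ (ι q) = y := hy.subset ⟨ι q, ⟨q, rfl⟩, rfl⟩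
  have hyc : IsClosed ({y} : Set Y) := by
    rw [← hy]
    exact φ.isClosedMap _ ι.isClosedEmbedding.isClosed_range
  have : IsLocallyNoetherian C := LocallyOfFiniteType.isLocallyNoetherian pC
  have : CompactSpace C := QuasiCompact.compactSpace_of_compactSpace pC
  have : IsNoetherian C := {}
  have : NoetherianSpace C := inferInstance
  have hC : C.HasPrincipalParts := hR1.hasPrincipalParts ι hdim.le hyc (hfib y hyc) hι
  refine ⟨hC.firstStructureCohomologyVanishes hdim.le, ?_⟩
  obtain ⟨p, hp⟩ := Scheme.exists_ne_genericPoint hdim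
  obtain ⟨q, x, hqp, -, hx, hx'⟩ := hC.exists_isParameter (f := pC) hdim.le hp
  exact hx.nonempty_iso_proj hdim.le hqp hx'
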